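/- Let n ≥ 2, 1 < p < ∞ and β > 0. Let Ω ⊂ ℝⁿ be a bounded, open, convex set, let Ω* be the ball centered at the origin with P(Ω*) = P(Ω), let v be a first eigenfunction of λ_{p,β}(Ω*), and set C = ‖v‖_{L^∞(Ω*)}^p · |Ω*| / ‖v‖_{L^p(Ω*)}^p. If C(1 − |Ω|/|Ω*|) < 1, then λ_{p,β}(Ω) ≤ λ_{p,β}(Ω*) / (1 − C(1 − |Ω|/|Ω*|)). -/

import Mathlib

open MeasureTheory Metric Set Bornology
open scoped NNReal ENNReal Pointwise symmDiff

noncomputable section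

/-- The perimeter of a (convex) set: the `(n-1)`-dimensional Hausdorff measure of its
topological boundary. -/
def perim (n : ℕ) (Ω : Set (EuclideanSpace ℝ (Fin n))) : ℝ :=
  (μH[(n : ℝ) - 1] (frontier Ω)).toReal

/-- The Rayleigh quotient of `u` on `Ω` with boundary parameter `β`. -/
def rayleigh (n : ℕ) (p β : ℝ) (Ω : Set (EuclideanSpace ℝ (Fin n)))
    (u : EuclideanSpace ℝ (Fin n) → ℝ) : ℝ :=
  ((∫ x in Ω, ‖fderiv ℝ u x‖ ^ p) +
      β * ∫ x in frontier Ω, |u x| ^ p ∂(μH[(n : ℝ) - 1])) /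
    ∫ x in Ω, |u x| ^ p

/-- The first Robin eigenvalue of the `p`-Laplacian on `Ω` with boundary parameter `β`. -/
def robinEig (n : ℕ) (p β : ℝ) (Ω : Set (EuclideanSpace ℝ (Fin n))) : ℝ :=
  sInf { r : ℝ | ∃ u : EuclideanSpace ℝ (Fin n) → ℝ,
    (∃ K : ℝ≥0, LipschitzOnWith K u (closure Ω)) ∧
    (0 < ∫ x in Ω, |u x| ^ p) ∧ r = rayleigh n p β Ω u }

/-- `v` is a first eigenfunction for the Robin `p`-Laplacian on `Ω`: a positive radial
Lipschitz function on the closure of `Ω` whose Rayleigh quotient equals `λ_{p,β}(Ω)`. -/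
def IsFirstEigenfunction (n : ℕ) (p β : ℝ) (Ω : Set (EuclideanSpace ℝ (Fin n)))
    (v : EuclideanSpace ℝ (Fin n) → ℝ) : Prop :=
  (∃ K : ℝ≥0, LipschitzOnWith K v (closure Ω)) ∧
  (∀ x ∈ closure Ω, 0 < v x) ∧
  (∃ h : ℝ → ℝ, ∀ x ∈ closure Ω, v x = h ‖x‖) ∧
  (0 < ∫ x in Ω, |v x| ^ p) ∧
  rayleigh n p β Ω v = robinEig n p β Ω

/-- `ω_n`, the Lebesgue measure of the unit ball of `ℝⁿ`. -/
def unitBallVol (n : ℕ) : ℝ :=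
  (volume (ball (0 : EuclideanSpace ℝ (Fin n)) 1)).toReal

set_option linter.unusedSectionVars false

theorem volume_add_volume_le_of_add_subset {A B C : Set ℝ} (hA : MeasurableSet A)
    (hB : MeasurableSet B) (hAn : A.Nonempty) (hBn : B.Nonempty) (h : A + B ⊆ C) :
    volume A + volume B ≤ volume C := by
  have key : ∀ K ⊆ A, IsCompact K → K.Nonempty → ∀ L ⊆ B, IsCompact L → L.Nonempty →
      volume K + volume L ≤ volume C := by
    intro K hKA hK hKn L hLB hL hLn
    obtain ⟨a, haK, ha⟩ := hK.exists_isGreatest hKn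
    obtain ⟨b, hbL, hb⟩ := hL.exists_isLeast hLn
    have h1 : volume ((fun x => x + b) '' K) = volume K := by simp
    have h2 : volume ((fun x => a + x) '' L) = volume L := by simp
    have hcK : IsCompact ((fun x => x + b) '' K) := hK.image (by fun_prop)
    have hcL : IsCompact ((fun x => a + x) '' L) := hL.image (by fun_prop)
    have hd : AEDisjoint volume ((fun x => x + b) '' K) ((fun x => a + x) '' L) := by
      refine measure_mono_null (t := {a + b}) ?_ (by simp)
      rintro _ ⟨⟨x, hx, rfl⟩, ⟨y, hy, hxy⟩⟩
      have := ha hx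
      have := hb hy
      simp only at hxy
      simp only [mem_singleton_iff]
      linarith
    rw [← h1, ← h2, ← measure_union₀ hcL.measurableSet.nullMeasurableSet hd]
    refine measure_mono (union_subset ?_ ?_)
    · rintro _ ⟨x, hx, rfl⟩
      exact h (add_mem_add (hKA hx) (hLB hbL))
    · rintro _ ⟨x, hx, rfl⟩
      exact h (add_mem_add (hKA haK) (hLB hx))
  obtain ⟨a0, ha0⟩ := hAn
  obtain ⟨b0, hb0⟩ := hBn
  have hcompact : ∀ (S : Set ℝ), MeasurableSet S → ∀ s0 ∈ S, ∀ r < volume S,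
      ∃ K ⊆ S, IsCompact K ∧ K.Nonempty ∧ r < volume K := by
    intro S hS s0 hs0 r hr
    obtain ⟨K, hKS, hK, hrK⟩ := hS.exists_lt_isCompact hr
    refine ⟨insert s0 K, insert_subset hs0 hKS, hK.insert s0, insert_nonempty _ _, ?_⟩
    exact hrK.trans_le (measure_mono (subset_insert _ _))
  by_contra hlt
  rw [not_le] at hlt
  have hA0 : volume A ≠ 0 ∨ volume A = 0 := (em _).symm
  rcases eq_or_ne (volume A) 0 with hA0 | hA0
  · rw [hA0, zero_add] at hlt
    obtain ⟨L, hLB, hL, hLn, hlt'⟩ := hcompact B hB b0 hb0 _ hlt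
    have := key {a0} (by simpa using ha0) isCompact_singleton (by simp) L hLB hL hLn
    simp at this
    exact absurd this (not_le.2 hlt')
  rcases eq_or_ne (volume B) 0 with hB0 | hB0
  · rw [hB0, add_zero] at hlt
    obtain ⟨L, hLB, hL, hLn, hlt'⟩ := hcompact A hA a0 ha0 _ hlt
    have := key L hLB hL hLn {b0} (by simpa using hb0) isCompact_singleton (by simp) 
    simp at this
    exact absurd this (not_le.2 hlt')
  obtain ⟨x, hx, y, hy, hxy⟩ := ENNReal.exists_lt_add_of_lt_add hlt hA0 hB0
  obtain ⟨K, hKA, hK, hKn, hxK⟩ := hcompact A hA a0 ha0 x hx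
  obtain ⟨L, hLB, hL, hLn, hyL⟩ := hcompact B hB b0 hb0 y hy
  exact absurd (key K hKA hK hKn L hLB hL hLn)
    (not_le.2 (hxy.trans (ENNReal.add_lt_add hxK hyL)))

theorem volume_convex_combo_le {A B C : Set ℝ} (hA : MeasurableSet A)
    (hB : MeasurableSet B) (hAn : A.Nonempty) (hBn : B.Nonempty) {a b : ℝ} (ha : 0 < a)
    (hb : 0 < b) (h : ∀ x ∈ A, ∀ y ∈ B, a * x + b * y ∈ C) :
    ENNReal.ofReal a * volume A + ENNReal.ofReal b * volume B ≤ volume C := by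
  have := volume_add_volume_le_of_add_subset (A := a • A) (B := b • B) (C := C)
    (hA.const_smul₀ a) (hB.const_smul₀ b) (hAn.smul_set) (hBn.smul_set) (by
      rintro _ ⟨_, ⟨x, hx, rfl⟩, _, ⟨y, hy, rfl⟩, rfl⟩
      exact h x hx y hy)
  simpa [Measure.addHaar_smul, abs_of_pos ha, abs_of_pos hb] using this

theorem ENNReal.rpow_mul_rpow_le_weighted_add {a b : ℝ} (ha : 0 < a) (hb : 0 < b)
    (hab : a + b = 1) (x y : ℝ≥0∞) :
    x ^ a * y ^ b ≤ ENNReal.ofReal a * x + ENNReal.ofReal b * y := by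
  have ha' : ENNReal.ofReal a ≠ 0 := by simpa using ha
  have hb' : ENNReal.ofReal b ≠ 0 := by simpa using hb
  rcases eq_or_ne x ∞ with rfl | hx
  · simp [ENNReal.mul_top ha']
  rcases eq_or_ne y ∞ with rfl | hy
  · simp [ENNReal.mul_top hb']
  lift x to ℝ≥0 using hx
  lift y to ℝ≥0 using hy
  have := NNReal.geom_mean_le_arith_mean2_weighted ⟨a, ha.le⟩ ⟨b, hb.le⟩ x y
    (by ext; exact hab)
  rw [← ENNReal.coe_rpow_of_nonneg _ ha.le, ← ENNReal.coe_rpow_of_nonneg _ hb.le,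
    ENNReal.ofReal_eq_coe_nnreal ha.le, ENNReal.ofReal_eq_coe_nnreal hb.le]
  exact_mod_cast this

theorem lintegral_weighted_add_le_of_sup_one {a b : ℝ} (ha : 0 < a) (hb : 0 < b)
    (hab : a + b = 1) {f g h : ℝ → ℝ} (hf : Measurable f) (hg : Measurable g)
    (hh : Measurable h) (hf0 : ∀ x, 0 ≤ f x) (hg0 : ∀ x, 0 ≤ g x) (hh0 : ∀ x, 0 ≤ h x)
    (hf1 : ∀ x, f x ≤ 1) (hg1 : ∀ x, g x ≤ 1)
    (hfs : ∀ t < 1, ∃ x, t < f x) (hgs : ∀ t < 1, ∃ x, t < g x)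
    (hfgh : ∀ x y, f x ^ a * g y ^ b ≤ h (a * x + b * y)) :
    ENNReal.ofReal a * (∫⁻ x, ENNReal.ofReal (f x)) +
      ENNReal.ofReal b * (∫⁻ x, ENNReal.ofReal (g x)) ≤ ∫⁻ x, ENNReal.ofReal (h x) := by
  rw [lintegral_eq_lintegral_meas_lt volume (ae_of_all _ hf0) hf.aemeasurable,
    lintegral_eq_lintegral_meas_lt volume (ae_of_all _ hg0) hg.aemeasurable,
    lintegral_eq_lintegral_meas_lt volume (ae_of_all _ hh0) hh.aemeasurable]
  have hmf : Measurable fun t => volume {x | t < f x} :=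
    Antitone.measurable fun s t hst => measure_mono fun x hx => hst.trans_lt hx
  have hmg : Measurable fun t => volume {x | t < g x} :=
    Antitone.measurable fun s t hst => measure_mono fun x hx => hst.trans_lt hx
  rw [← lintegral_const_mul _ hmf, ← lintegral_const_mul _ hmg, ← lintegral_add_left (by fun_prop)]
  refine setLIntegral_mono_ae' measurableSet_Ioi (ae_of_all _ fun t ht => ?_)
  rcases lt_or_ge t 1 with h1 | h1
  · refine volume_convex_combo_le (measurableSet_lt measurable_const hf)
      (measurableSet_lt measurable_const hg) (hfs t h1) (hgs t h1) ha hb ?_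
    intro x hx y hy
    refine lt_of_lt_of_le ?_ (hfgh x y)
    have e : t = t ^ a * t ^ b := by rw [← Real.rpow_add ht, hab, Real.rpow_one]
    rw [e]
    have ht0 : (0:ℝ) < t := ht
    have h2 : t ^ a < f x ^ a := Real.rpow_lt_rpow ht0.le hx ha
    have h3 : t ^ b < g y ^ b := Real.rpow_lt_rpow ht0.le hy hb
    exact mul_lt_mul'' h2 h3 (by positivity) (by positivity)
  · have e1 : {x | t < f x} = ∅ := by
      ext x; simp only [mem_ofPred_eq, mem_empty_iff_false, iff_false, not_lt]
      exact (hf1 x).trans h1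
    have e2 : {x | t < g x} = ∅ := by
      ext x; simp only [mem_ofPred_eq, mem_empty_iff_false, iff_false, not_lt]
      exact (hg1 x).trans h1
    simp [e1, e2]

/-- The Prékopa–Leindler inequality for the measure `μ`. -/
def PrekopaLeindler {E : Type*} [AddCommGroup E] [Module ℝ E] [MeasurableSpace E]
    (μ : Measure E) : Prop :=
  ∀ ⦃a b : ℝ⦄, 0 < a → 0 < b → a + b = 1 → ∀ ⦃f g h : E → ℝ≥0∞⦄, Measurable f → Measurable g →
    Measurable h → (∀ x y, f x ^ a * g y ^ b ≤ h (a • x + b • y)) →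
    (∫⁻ x, f x ∂μ) ^ a * (∫⁻ x, g x ∂μ) ^ b ≤ ∫⁻ x, h x ∂μ

theorem prekopaLeindler_bounded {a b : ℝ} (ha : 0 < a) (hb : 0 < b)
    (hab : a + b = 1) {f g h : ℝ → ℝ≥0∞} (hf : Measurable f) (hg : Measurable g)
    (hh : Measurable h) {k : ℝ≥0} (hfk : ∀ x, f x ≤ k) (hgk : ∀ x, g x ≤ k)
    (hfgh : ∀ x y, f x ^ a * g y ^ b ≤ h (a • x + b • y)) :
    (∫⁻ x, f x) ^ a * (∫⁻ x, g x) ^ b ≤ ∫⁻ x, h x := by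
  set A := ⨆ x, f x with hA
  set B := ⨆ x, g x with hB
  have hfA : ∀ x, f x ≤ A := fun x => le_iSup f x
  have hgB : ∀ x, g x ≤ B := fun x => le_iSup g x
  have hAk : A ≠ ∞ := ((iSup_le hfk).trans_lt ENNReal.coe_lt_top).ne
  have hBk : B ≠ ∞ := ((iSup_le hgk).trans_lt ENNReal.coe_lt_top).ne
  rcases eq_or_ne A 0 with hA0 | hA0
  · have : ∀ x, f x = 0 := fun x => by simpa [hA0] using hfA x
    simp [this, ENNReal.zero_rpow_of_pos ha]
  rcases eq_or_ne B 0 with hB0 | hB0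
  · have : ∀ x, g x = 0 := fun x => by simpa [hB0] using hgB x
    simp [this, ENNReal.zero_rpow_of_pos hb]
  set D := A ^ a * B ^ b with hD
  have hAa0 : A ^ a ≠ 0 := by simp [ENNReal.rpow_eq_zero_iff, hA0, hAk]
  have hBb0 : B ^ b ≠ 0 := by simp [ENNReal.rpow_eq_zero_iff, hB0, hBk]
  have hAat : A ^ a ≠ ∞ := ENNReal.rpow_ne_top_of_nonneg ha.le hAk
  have hBbt : B ^ b ≠ ∞ := ENNReal.rpow_ne_top_of_nonneg hb.le hBk
  have hD0 : D ≠ 0 := mul_ne_zero hAa0 hBb0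
  have hDt : D ≠ ∞ := ENNReal.mul_ne_top hAat hBbt
  have hfA1 : ∀ x, f x / A ≤ 1 := fun x => ENNReal.div_le_of_le_mul (by simpa using hfA x)
  have hgB1 : ∀ x, g x / B ≤ 1 := fun x => ENNReal.div_le_of_le_mul (by simpa using hgB x)
  have hfAt : ∀ x, f x / A ≠ ∞ := fun x => ne_top_of_le_ne_top (by simp) (hfA1 x)
  have hgBt : ∀ x, g x / B ≠ ∞ := fun x => ne_top_of_le_ne_top (by simp) (hgB1 x)
  have hsup : ∀ (φ : ℝ → ℝ≥0∞) (S : ℝ≥0∞), S = ⨆ x, φ x → S ≠ 0 → S ≠ ∞ → ∀ t < (1:ℝ),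
      ∃ x, t < (φ x / S).toReal := by
    intro φ S hS hS0 hSt t ht
    by_contra! hcon
    have hφ : ∀ x, φ x ≤ ENNReal.ofReal t * S := by
      intro x
      have hx : φ x ≤ S := hS ▸ le_iSup φ x
      have hxt : φ x / S ≠ ∞ := by
        refine ne_top_of_le_ne_top (b := 1) (by simp) ?_
        exact ENNReal.div_le_of_le_mul (by simpa using hx)
      have := hcon x
      rw [← ENNReal.div_le_iff hS0 hSt]
      exact (ENNReal.le_ofReal_iff_toReal_le hxt
        ((ENNReal.toReal_nonneg).trans this)).2 this
    have h1 : S ≤ ENNReal.ofReal t * S := by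
      conv_lhs => rw [hS]
      exact iSup_le hφ
    have h2 : ENNReal.ofReal t * S < 1 * S := by
      refine ENNReal.mul_lt_mul_left hS0 hSt ?_
      simpa using ht
    rw [one_mul] at h2
    exact absurd h1 (not_le.2 h2)
  have hhD : ∀ x, min (h x / D) 1 ≠ ∞ := fun x => ne_top_of_le_ne_top (by simp) (min_le_right _ _)
  have key := lintegral_weighted_add_le_of_sup_one ha hb hab
    (f := fun x => (f x / A).toReal) (g := fun x => (g x / B).toReal)
    (h := fun x => (min (h x / D) 1).toReal)
    (by fun_prop) (by fun_prop) (by fun_prop) (fun x => by positivity) (fun x => by positivity)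
    (fun x => by positivity)
    (fun x => by simpa using ENNReal.toReal_mono (by simp) (hfA1 x))
    (fun x => by simpa using ENNReal.toReal_mono (by simp) (hgB1 x))
    (hsup f A hA hA0 hAk) (hsup g B hB hB0 hBk) (by
      intro x y
      rw [ENNReal.toReal_rpow, ENNReal.toReal_rpow, ← ENNReal.toReal_mul]
      refine ENNReal.toReal_mono (hhD _) (le_min ?_ ?_)
      · rw [ENNReal.div_rpow_of_nonneg _ _ ha.le, ENNReal.div_rpow_of_nonneg _ _ hb.le,
          div_eq_mul_inv, div_eq_mul_inv, mul_mul_mul_comm,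
          ← ENNReal.mul_inv (Or.inl hAa0) (Or.inl hAat), ← div_eq_mul_inv]
        exact ENNReal.div_le_div_right (hfgh x y) _
      · exact mul_le_one' (ENNReal.rpow_le_one (hfA1 x) ha.le) (ENNReal.rpow_le_one (hgB1 y) hb.le))
  simp only [ENNReal.ofReal_toReal (hfAt _), ENNReal.ofReal_toReal (hgBt _),
    ENNReal.ofReal_toReal (hhD _)] at key
  have key2 := (ENNReal.rpow_mul_rpow_le_weighted_add ha hb hab _ _).trans key
  have key3 := key2.trans (lintegral_mono fun x => min_le_left (h x / D) 1)
  simp only [div_eq_mul_inv] at key3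
  rw [lintegral_mul_const _ hf, lintegral_mul_const _ hg, lintegral_mul_const _ hh,
    ENNReal.mul_rpow_of_nonneg _ _ ha.le, ENNReal.mul_rpow_of_nonneg _ _ hb.le,
    mul_mul_mul_comm, ENNReal.inv_rpow, ENNReal.inv_rpow,
    ← ENNReal.mul_inv (Or.inl hAa0) (Or.inl hAat)] at key3
  exact (ENNReal.mul_le_mul_iff_left (ENNReal.inv_ne_zero.2 hDt) (ENNReal.inv_ne_top.2 hD0)).1 key3

theorem prekopaLeindler_real : PrekopaLeindler (volume : Measure ℝ) := by
  intro a b ha hb hab f g h hf hg hh hfgh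
  rcases eq_or_ne (∫⁻ x, f x) 0 with hf0 | hf0
  · simp [hf0, ENNReal.zero_rpow_of_pos ha]
  rcases eq_or_ne (∫⁻ x, g x) 0 with hg0 | hg0
  · simp [hg0, ENNReal.zero_rpow_of_pos hb]
  have hlim : ∀ φ : ℝ → ℝ≥0∞, Measurable φ →
      Filter.Tendsto (fun k : ℕ => ∫⁻ x, min (φ x) k) Filter.atTop (nhds (∫⁻ x, φ x)) := by
    intro φ hφ
    refine lintegral_tendsto_of_tendsto_of_monotone (fun k => by fun_prop) ?_ ?_
    · refine ae_of_all _ fun x i j hij => ?_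
      exact min_le_min le_rfl (by exact_mod_cast hij)
    · refine ae_of_all _ fun x => ?_
      have := (tendsto_const_nhds (x := φ x)).min ENNReal.tendsto_nat_nhds_top
      simpa using this
  have h1 := ((hlim f hf).ennrpow_const a)
  have h2 := ((hlim g hg).ennrpow_const b)
  refine le_of_tendsto (ENNReal.Tendsto.mul h1 (Or.inl ?_) h2 (Or.inl ?_))
    (Filter.Eventually.of_forall fun k => ?_)
  · simp [ENNReal.rpow_eq_zero_iff, hf0, not_lt.2 ha.le]
  · simp [ENNReal.rpow_eq_zero_iff, hg0, not_lt.2 hb.le]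
  · refine prekopaLeindler_bounded ha hb hab (k := k) (by fun_prop) (by fun_prop) hh
      (fun x => by simp) (fun x => by simp) fun x y => le_trans ?_ (hfgh x y)
    exact mul_le_mul' (ENNReal.rpow_le_rpow (min_le_left _ _) ha.le)
      (ENNReal.rpow_le_rpow (min_le_left _ _) hb.le)

theorem PrekopaLeindler.prod {E F : Type*} [AddCommGroup E] [Module ℝ E] [MeasurableSpace E]
    [AddCommGroup F] [Module ℝ F] [MeasurableSpace F] {μ : Measure E} {ν : Measure F}
    [SFinite μ] [SFinite ν] (hμ : PrekopaLeindler μ) (hν : PrekopaLeindler ν) :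
    PrekopaLeindler (μ.prod ν) := by
  intro a b ha hb hab f g h hf hg hh hfgh
  rw [lintegral_prod _ hf.aemeasurable, lintegral_prod _ hg.aemeasurable,
    lintegral_prod _ hh.aemeasurable]
  refine hμ ha hb hab hf.lintegral_prod_right' hg.lintegral_prod_right' hh.lintegral_prod_right'
    fun x y => ?_
  exact hν ha hb hab (by fun_prop) (by fun_prop) (by fun_prop) fun z w => hfgh (x, z) (y, w)

theorem PrekopaLeindler.of_measurePreserving {E F : Type*} [AddCommGroup E] [Module ℝ E]
    [MeasurableSpace E] [AddCommGroup F] [Module ℝ F] [MeasurableSpace F] {μ : Measure E}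
    {ν : Measure F} (hμ : PrekopaLeindler μ) (L : E →ₗ[ℝ] F) (hL : MeasurePreserving L μ ν) :
    PrekopaLeindler ν := by
  intro a b ha hb hab f g h hf hg hh hfgh
  rw [← hL.lintegral_comp hf, ← hL.lintegral_comp hg, ← hL.lintegral_comp hh]
  exact hμ ha hb hab (hf.comp hL.measurable) (hg.comp hL.measurable) (hh.comp hL.measurable)
    fun x y => by simpa using hfgh (L x) (L y)

theorem PrekopaLeindler.smul {E : Type*} [AddCommGroup E] [Module ℝ E]
    [MeasurableSpace E] {μ : Measure E} (hμ : PrekopaLeindler μ) (c : ℝ≥0) :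
    PrekopaLeindler (c • μ) := by
  intro a b ha hb hab f g h hf hg hh hfgh
  simp only [lintegral_smul_measure, ENNReal.smul_def, smul_eq_mul]
  rw [ENNReal.mul_rpow_of_nonneg _ _ ha.le, ENNReal.mul_rpow_of_nonneg _ _ hb.le,
    mul_mul_mul_comm, ← ENNReal.rpow_add_of_nonneg _ _ ha.le hb.le, hab, ENNReal.rpow_one]
  exact mul_le_mul' le_rfl (hμ ha hb hab hf hg hh hfgh)

theorem prekopaLeindler_pi (m : ℕ) : PrekopaLeindler (volume : Measure (Fin m → ℝ)) := by
  induction m with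
  | zero =>
    intro a b ha hb hab f g h hf hg hh hfgh
    have : (volume : Measure (Fin 0 → ℝ)) = Measure.dirac 0 := by
      rw [volume_pi, Measure.pi_of_empty]
      congr 1
      exact Subsingleton.elim _ _
    rw [this, lintegral_dirac' _ hf, lintegral_dirac' _ hg, lintegral_dirac' _ hh]
    simpa using hfgh 0 0
  | succ m ih =>
    have := (volume_preserving_piFinSuccAbove (fun _ : Fin (m + 1) => ℝ) 0).symm
    refine (prekopaLeindler_real.prod ih).of_measurePreserving
      (L := { toFun := (MeasurableEquiv.piFinSuccAbove (fun _ => ℝ) 0).symm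
              map_add' := ?_
              map_smul' := ?_ }) this
    · intro x y
      ext i
      refine Fin.cases ?_ (fun j => ?_) i <;> simp [MeasurableEquiv.piFinSuccAbove]
    · intro x y
      ext i
      refine Fin.cases ?_ (fun j => ?_) i <;> simp [MeasurableEquiv.piFinSuccAbove]

theorem prekopaLeindler_addHaar {E : Type*} [NormedAddCommGroup E] [NormedSpace ℝ E]
    [FiniteDimensional ℝ E] [MeasurableSpace E] [BorelSpace E] (μ : Measure E)
    [μ.IsAddHaarMeasure] : PrekopaLeindler μ := by
  let L : (Fin (Module.finrank ℝ E) → ℝ) ≃L[ℝ] E :=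
    ContinuousLinearEquiv.ofFinrankEq (by simp)
  have : (volume.map L).IsAddHaarMeasure := L.isAddHaarMeasure_map volume
  have h1 : PrekopaLeindler (volume.map L) :=
    (prekopaLeindler_pi _).of_measurePreserving (L : (Fin (Module.finrank ℝ E) → ℝ) →ₗ[ℝ] E)
      ⟨L.continuous.measurable, rfl⟩
  rw [Measure.isAddLeftInvariant_eq_smul μ (volume.map L)]
  exact h1.smul _

/-- The Brunn–Minkowski inequality. -/
theorem brunn_minkowski {E : Type*} [NormedAddCommGroup E] [NormedSpace ℝ E]
    [FiniteDimensional ℝ E] [MeasurableSpace E] [BorelSpace E] (μ : Measure E)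
    [μ.IsAddHaarMeasure] {m : ℕ} (hm : Module.finrank ℝ E = m) (hm0 : 0 < m) {A B C : Set E}
    (hA : MeasurableSet A) (hB : MeasurableSet B) (hC : MeasurableSet C)
    (hA0 : 0 < μ.real A) (hB0 : 0 < μ.real B) (hCt : μ C ≠ ∞) {a b : ℝ} (ha : 0 < a) (hb : 0 < b)
    (hABC : ∀ x ∈ A, ∀ y ∈ B, a • x + b • y ∈ C) :
    a * μ.real A ^ (1 / m : ℝ) + b * μ.real B ^ (1 / m : ℝ) ≤ μ.real C ^ (1 / m : ℝ) := by
  have hm0' : (0:ℝ) < m := by exact_mod_cast hm0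
  set α := μ.real A ^ (1 / m : ℝ) with hα
  set β := μ.real B ^ (1 / m : ℝ) with hβ
  have hα0 : 0 < α := Real.rpow_pos_of_pos hA0 _
  have hβ0 : 0 < β := Real.rpow_pos_of_pos hB0 _
  have hαm : α ^ m = μ.real A := by
    rw [hα, ← Real.rpow_natCast, ← Real.rpow_mul hA0.le]; simp [hm0'.ne']
  have hβm : β ^ m = μ.real B := by
    rw [hβ, ← Real.rpow_natCast, ← Real.rpow_mul hB0.le]; simp [hm0'.ne']
  set s := a * α + b * β with hs
  have hs0 : 0 < s := by positivity
  have hmeas : ∀ (D : Set E) (r : ℝ), 0 < r → μ D ≠ ∞ →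
      μ (r⁻¹ • D) = ENNReal.ofReal (μ.real D / r ^ m) := by
    intro D r hr hD
    rw [Measure.addHaar_smul, hm, abs_of_pos (by positivity), div_eq_inv_mul,
      ENNReal.ofReal_mul (by positivity), inv_pow, Measure.real, ENNReal.ofReal_toReal hD]
  have hAt : μ A ≠ ∞ := fun h => by simp [Measure.real, h] at hA0
  have hBt : μ B ≠ ∞ := fun h => by simp [Measure.real, h] at hB0
  have hA' := hmeas A α hα0 hAt
  have hB' := hmeas B β hβ0 hBt
  have hC' := hmeas C s hs0 hCt
  rw [hαm, div_self hA0.ne'] at hA'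
  rw [hβm, div_self hB0.ne'] at hB'
  have key := prekopaLeindler_addHaar μ (a := a * α / s) (b := b * β / s) (by positivity)
    (by positivity) (by rw [← add_div, ← hs, div_self hs0.ne'])
    (f := (α⁻¹ • A).indicator 1) (g := (β⁻¹ • B).indicator 1) (h := (s⁻¹ • C).indicator 1)
    (measurable_one.indicator (hA.const_smul₀ _)) (measurable_one.indicator (hB.const_smul₀ _))
    (measurable_one.indicator (hC.const_smul₀ _)) (by
      intro x y
      by_cases hx : x ∈ α⁻¹ • A
      swap
      · rw [indicator_of_notMem hx, ENNReal.zero_rpow_of_pos (by positivity)]; simp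
      by_cases hy : y ∈ β⁻¹ • B
      swap
      · rw [indicator_of_notMem hy, ENNReal.zero_rpow_of_pos (by positivity)]; simp
      rw [indicator_of_mem hx, indicator_of_mem hy, indicator_of_mem]
      · simp
      obtain ⟨x, hx, rfl⟩ := hx
      obtain ⟨y, hy, rfl⟩ := hy
      refine ⟨_, hABC x hx y hy, ?_⟩
      simp only [smul_add, smul_smul]
      congr 2 <;> field_simp)
  rw [lintegral_indicator_one (hA.const_smul₀ _), lintegral_indicator_one (hB.const_smul₀ _),
    lintegral_indicator_one (hC.const_smul₀ _), hA', hB', hC'] at key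
  simp only [ENNReal.ofReal_one, ENNReal.one_rpow, mul_one, ENNReal.one_le_ofReal] at key
  rw [one_le_div (by positivity)] at key
  calc s = (s ^ m) ^ (1 / m : ℝ) := by
        rw [← Real.rpow_natCast, ← Real.rpow_mul hs0.le]; simp [hm0'.ne']
    _ ≤ _ := Real.rpow_le_rpow (by positivity) key (by positivity)

theorem volume_add_Icc_of_isOpen_convex {J : Set ℝ} (ho : IsOpen J) (hc : Convex ℝ J)
    (hb : IsBounded J) (hne : J.Nonempty) {x : ℝ} (hx : 0 ≤ x) :
    volume (J + Icc (-x) x) = volume J + ENNReal.ofReal (2 * x) := by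
  have hcon : IsConnected J := ⟨hne, hc.isPreconnected⟩
  have hbb := hb.bddBelow
  have hba := hb.bddAbove
  have hJ : J = Ioo (sInf J) (sSup J) := by
    refine subset_antisymm (fun y hy => ⟨?_, ?_⟩) (hcon.Ioo_csInf_csSup_subset hbb hba)
    · refine lt_of_le_of_ne (csInf_le hbb hy) fun h => ?_
      obtain ⟨e, he, hey⟩ := Metric.isOpen_iff.1 ho y hy
      have h2 : y - e / 2 ∈ J := hey (by simp [abs_of_pos he]; linarith)
      have := csInf_le hbb h2
      linarith
    · refine lt_of_le_of_ne (le_csSup hba hy) fun h => ?_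
      obtain ⟨e, he, hey⟩ := Metric.isOpen_iff.1 ho y hy
      have h2 : y + e / 2 ∈ J := hey (by simp [abs_of_pos he]; linarith)
      have := le_csSup hba h2
      linarith
  set a := sInf J
  set b := sSup J
  have hab : a < b := by
    rw [hJ] at hne
    exact nonempty_Ioo.1 hne
  have : J + Icc (-x) x = Ioo (a - x) (b + x) := by
    rw [hJ]
    ext z
    constructor
    · rintro ⟨y, hy, c, hc, rfl⟩
      simp only [mem_Ioo, mem_Icc] at *
      constructor <;> linarith
    · intro hz
      have hz1 := hz.1
      have hz2 := hz.2
      rcases hx.eq_or_lt with rfl | h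
      · exact ⟨z, by simpa using hz, 0, by simp, by simp⟩
      have : max a (z - x) < min b (z + x) := by
        simp only [lt_min_iff, max_lt_iff]
        refine ⟨⟨hab, by linarith⟩, by linarith, by linarith⟩
      obtain ⟨y, hy1, hy2⟩ := exists_between this
      simp only [lt_min_iff, max_lt_iff] at hy1 hy2
      refine ⟨y, ⟨hy1.1, hy2.1⟩, z - y, ⟨?_, ?_⟩, by simp⟩ <;> linarith
  rw [this, hJ, Real.volume_Ioo, Real.volume_Ioo, ← ENNReal.ofReal_add (by linarith) (by linarith)]
  congr 1
  ring

/-- The segment `[-x u, x u]`. -/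
def segm {E : Type*} [AddCommGroup E] [Module ℝ E] (u : E) (x : ℝ) : Set E :=
  (fun c : ℝ => c • u) '' Icc (-x) x

/-- The zonotope `∑ i, [-x i • u i, x i • u i]`. -/
def zonotope {ι E : Type*} [Fintype ι] [AddCommGroup E] [Module ℝ E] (u : ι → E) (x : ι → ℝ) :
    Set E :=
  {z | ∃ c : ι → ℝ, (∀ i, |c i| ≤ x i) ∧ z = ∑ i, c i • u i}

theorem exists_projection_volume {E : Type*} [NormedAddCommGroup E] [NormedSpace ℝ E]
    [FiniteDimensional ℝ E] [MeasurableSpace E] [BorelSpace E] (μ : Measure E)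
    [μ.IsAddHaarMeasure] {d : ℕ} (hd : Module.finrank ℝ E = d + 1) {u : E} (hu : u ≠ 0) :
    ∃ (π : E →L[ℝ] (Fin d → ℝ)) (ν : Measure (Fin d → ℝ)), ν.IsAddHaarMeasure ∧
      Function.Surjective π ∧ (∀ x, π x = 0 ↔ ∃ c : ℝ, x = c • u) ∧
      ∀ L : Set E, IsOpen L → Convex ℝ L → IsBounded L → ∀ x : ℝ, 0 ≤ x →
        μ (L + segm u x) = μ L + ENNReal.ofReal (2 * x) * ν (π '' L) := by
  obtain ⟨ℓ, hℓ⟩ := SeparatingDual.exists_eq_one (R := ℝ) hu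
  have hrange : LinearMap.range (ℓ : E →ₗ[ℝ] ℝ) = ⊤ := by
    rw [LinearMap.range_eq_top]
    intro c
    exact ⟨c • u, by simp [hℓ]⟩
  have hker : Module.finrank ℝ (LinearMap.ker (ℓ : E →ₗ[ℝ] ℝ)) = d := by
    have := LinearMap.finrank_range_add_finrank_ker (ℓ : E →ₗ[ℝ] ℝ)
    rw [hrange] at this
    simp [hd] at this
    omega
  let e1 : E ≃L[ℝ] ℝ × LinearMap.ker (ℓ : E →ₗ[ℝ] ℝ) :=
    ContinuousLinearEquiv.equivOfRightInverse ℓ (ContinuousLinearMap.toSpanSingleton ℝ u)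
      (fun c => by simp [hℓ])
  let e2 : LinearMap.ker (ℓ : E →ₗ[ℝ] ℝ) ≃L[ℝ] (Fin d → ℝ) :=
    ContinuousLinearEquiv.ofFinrankEq (by simp [hker])
  let e : E ≃L[ℝ] ℝ × (Fin d → ℝ) := e1.trans ((ContinuousLinearEquiv.refl ℝ ℝ).prodCongr e2)
  have heu : e u = (1, 0) := by
    have : e1 u = (1, 0) := by
      ext <;> simp [e1, hℓ]
    simp [e, this]
  have hH : (μ.map e).IsAddHaarMeasure := e.isAddHaarMeasure_map μ
  obtain ⟨c, hc0, hct, hc⟩ : ∃ c : ℝ≥0∞, c ≠ 0 ∧ c ≠ ∞ ∧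
      μ.map e = c • ((volume : Measure ℝ).prod (volume : Measure (Fin d → ℝ))) :=
    ⟨Measure.addHaarScalarFactor _ _, by
      simpa using (Measure.addHaarScalarFactor_pos_of_isAddHaarMeasure _ _).ne', by simp,
      Measure.isAddLeftInvariant_eq_smul _ _⟩
  let ν : Measure (Fin d → ℝ) := c • volume
  have hν : ν.IsAddHaarMeasure := Measure.IsAddHaarMeasure.smul _ hc0 hct
  have hprod : μ.map e = (volume : Measure ℝ).prod ν := by
    rw [hc, Measure.prod_smul_right]
  let π : E →L[ℝ] (Fin d → ℝ) := (ContinuousLinearMap.snd ℝ ℝ (Fin d → ℝ)).comp (e : E →L[ℝ] _)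
  have hπ : ∀ x, π x = (e x).2 := fun x => rfl
  have hesymm : ∀ t y, e (e.symm (t, y)) = (t, y) := fun t y => e.apply_symm_apply _
  refine ⟨π, ν, hν, ?_, ?_, ?_⟩
  · intro y
    exact ⟨e.symm (0, y), by simp [hπ]⟩
  · intro x
    constructor
    · intro h
      refine ⟨(e x).1, e.injective ?_⟩
      rw [map_smul, heu]
      ext1
      · simp
      · simpa [hπ] using h
    · rintro ⟨c, rfl⟩
      simp [hπ, heu]
  · intro L hLo hLc hLb x hx
    have hmeas : ∀ S : Set E, IsOpen S →
        μ S = ∫⁻ y, volume {t | e.symm (t, y) ∈ S} ∂ν := by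
      intro S hS
      have h1 : μ S = (μ.map e) (e.symm ⁻¹' S) := by
        rw [Measure.map_apply e.continuous.measurable
          (e.symm.continuous.measurable hS.measurableSet), ← preimage_comp]
        congr 1
        ext z; simp
      rw [h1, hprod, Measure.prod_apply_symm (e.symm.continuous.measurable hS.measurableSet)]
      rfl
    have hLπ : IsOpen (π '' L) := by
      have : IsOpenMap π := isOpenMap_snd.comp e.toHomeomorph.isOpenMap
      exact this L hLo
    rw [hmeas _ hLo.add_right, hmeas L hLo, ← lintegral_indicator_const hLπ.measurableSet,
      ← lintegral_add_right _ (measurable_const.indicator hLπ.measurableSet)]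
    refine lintegral_congr fun y => ?_
    have hsec : {t | e.symm (t, y) ∈ L + segm u x} = {t | e.symm (t, y) ∈ L} + Icc (-x) x := by
      have hu' : ∀ c, e.symm (c, 0) = c • u := by
        intro c
        rw [e.symm_apply_eq, map_smul, heu]; simp
      ext t
      constructor
      · rintro ⟨l, hl, _, ⟨c, hc, rfl⟩, h⟩
        refine ⟨t - c, ?_, c, hc, by simp⟩
        have : e.symm (t - c, y) = l := by
          have : ((t - c, y) : ℝ × (Fin d → ℝ)) = (t, y) - (c, 0) := by simp
          rw [this, map_sub, hu', ← h]
          simp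
        simpa [this] using hl
      · rintro ⟨s, hs, c, hc, rfl⟩
        refine ⟨_, hs, _, ⟨c, hc, rfl⟩, ?_⟩
        have : ((s + c, y) : ℝ × (Fin d → ℝ)) = (s, y) + (c, 0) := by simp
        change _ = e.symm (s + c, y)
        rw [this, map_add, hu']
    rw [hsec]
    by_cases hy : y ∈ π '' L
    · obtain ⟨l, hl, rfl⟩ := hy
      rw [indicator_of_mem (mem_image_of_mem π hl)]
      refine volume_add_Icc_of_isOpen_convex (hLo.preimage (by fun_prop)) ?_ ?_
        ⟨(e l).1, by simpa [hπ] using hl⟩ hx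
      · intro s hs t ht a b ha hb hab
        have := hLc hs ht ha hb hab
        rw [← map_smul, ← map_smul, ← map_add] at this
        simpa [← add_smul, hab] using this
      · obtain ⟨C, hC⟩ := (e.lipschitz.isBounded_image hLb).exists_norm_le
        refine isBounded_iff_forall_norm_le.2 ⟨C, fun t ht => ?_⟩
        have := hC _ ⟨_, ht, e.apply_symm_apply _⟩
        exact (le_max_left _ _).trans this
    · have : {t | e.symm (t, y) ∈ L} = ∅ := by
        ext t
        simp only [mem_ofPred_eq, mem_empty_iff_false, iff_false]
        exact fun h => hy ⟨_, h, by simp [hπ]⟩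
      simp [this, indicator_of_notMem hy]

section Zonotope

variable {ι E F : Type*} [Fintype ι]

theorem zonotope_eq_image [AddCommGroup E] [Module ℝ E] (u : ι → E) (x : ι → ℝ) :
    zonotope u x = Fintype.linearCombination ℝ u '' Icc (-x) x := by
  ext z
  simp only [zonotope, mem_ofPred_eq, mem_image, Fintype.linearCombination_apply, mem_Icc,
    Pi.le_def, Pi.neg_apply, ← forall_and, abs_le]
  exact ⟨fun ⟨c, h, e⟩ => ⟨c, h, e.symm⟩, fun ⟨c, h, e⟩ => ⟨c, h, e.symm⟩⟩

theorem convex_zonotope [AddCommGroup E] [Module ℝ E] (u : ι → E) (x : ι → ℝ) :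
    Convex ℝ (zonotope u x) := by
  rw [zonotope_eq_image]
  exact (convex_Icc _ _).linear_image _

theorem isCompact_zonotope [NormedAddCommGroup E] [NormedSpace ℝ E] (u : ι → E) (x : ι → ℝ) :
    IsCompact (zonotope u x) := by
  rw [zonotope_eq_image]
  exact isCompact_Icc.image (LinearMap.continuous_of_finiteDimensional _)

theorem image_zonotope [AddCommGroup E] [Module ℝ E] [AddCommGroup F] [Module ℝ F]
    (π : E →ₗ[ℝ] F) (u : ι → E) (x : ι → ℝ) :
    π '' zonotope u x = zonotope (π ∘ u) x := by
  ext z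
  constructor
  · rintro ⟨_, ⟨c, hc, rfl⟩, rfl⟩
    exact ⟨c, hc, by simp⟩
  · rintro ⟨c, hc, rfl⟩
    exact ⟨_, ⟨c, hc, rfl⟩, by simp⟩

theorem zonotope_add_single [DecidableEq ι] [AddCommGroup E] [Module ℝ E] (u : ι → E)
    {x : ι → ℝ} (hx : 0 ≤ x) (i : ι) {t : ℝ} (ht : 0 ≤ t) :
    zonotope u (x + Pi.single i t) = zonotope u x + segm (u i) t := by
  ext z
  constructor
  · rintro ⟨c, hc, rfl⟩
    have hci := hc i
    simp only [Pi.add_apply, Pi.single_eq_same] at hci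
    rw [abs_le] at hci
    have hxi : 0 ≤ x i := hx i
    set r := max (-x i) (min (x i) (c i)) with hr
    refine ⟨_, ⟨Function.update c i r, ?_, rfl⟩, _, ⟨c i - r, ?_, rfl⟩, ?_⟩
    · intro j
      rcases eq_or_ne j i with rfl | hj
      · rw [Function.update_self, abs_le]
        exact ⟨le_max_left _ _, max_le (by linarith) (min_le_left _ _)⟩
      · simpa [hj] using hc j
    · rw [mem_Icc, hr]
      rcases le_total (x i) (c i) with h | h
      · rw [min_eq_left h, max_eq_right (by linarith)]
        constructor <;> linarith
      · rw [min_eq_right h]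
        rcases le_total (-x i) (c i) with h' | h'
        · rw [max_eq_right h']; constructor <;> linarith
        · rw [max_eq_left h']; constructor <;> linarith
    · simp only [sub_smul]
      rw [← Finset.add_sum_erase _ _ (Finset.mem_univ i),
        ← Finset.add_sum_erase Finset.univ (fun j => c j • u j) (Finset.mem_univ i)]
      have : ∑ j ∈ Finset.univ.erase i, Function.update c i r j • u j =
          ∑ j ∈ Finset.univ.erase i, c j • u j :=
        Finset.sum_congr rfl fun j hj => by simp [Finset.ne_of_mem_erase hj]
      rw [this, Function.update_self]
      abel
  · rintro ⟨_, ⟨c, hc, rfl⟩, _, ⟨r, hr, rfl⟩, rfl⟩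
    refine ⟨c + Pi.single i r, fun j => ?_, ?_⟩
    · rcases eq_or_ne j i with rfl | hj
      · have := abs_le.1 (hc j)
        simp only [Pi.add_apply, Pi.single_eq_same]
        rw [abs_le]; constructor <;> linarith [hr.1, hr.2]
      · simpa [hj] using hc j
    · simp [add_smul, Finset.sum_add_distrib, Pi.single_apply, ite_smul]

theorem zonotope_nonneg_nonempty [AddCommGroup E] [Module ℝ E] (u : ι → E) {x : ι → ℝ}
    (hx : 0 ≤ x) : (zonotope u x).Nonempty :=
  ⟨0, 0, fun i => by simpa using hx i, by simp⟩

theorem smul_zonotope_add_smul_zonotope_mem [AddCommGroup E] [Module ℝ E] {u : ι → E}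
    {x y : ι → ℝ} {a b : ℝ} (ha : 0 ≤ a) (hb : 0 ≤ b) {z w : E} (hz : z ∈ zonotope u x)
    (hw : w ∈ zonotope u y) : a • z + b • w ∈ zonotope u (a • x + b • y) := by
  obtain ⟨c, hc, rfl⟩ := hz
  obtain ⟨c', hc', rfl⟩ := hw
  refine ⟨a • c + b • c', fun i => ?_, ?_⟩
  · simp only [Pi.add_apply, Pi.smul_apply, smul_eq_mul]
    refine (abs_add_le _ _).trans ?_
    rw [abs_mul, abs_mul, abs_of_nonneg ha, abs_of_nonneg hb]
    exact add_le_add (mul_le_mul_of_nonneg_left (hc i) ha) (mul_le_mul_of_nonneg_left (hc' i) hb)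
  · simp [Finset.smul_sum, add_smul, mul_smul, Finset.sum_add_distrib]

end Zonotope

/-- A bounded, open, convex, nonempty set. -/
structure IsConvexBody {E : Type*} [NormedAddCommGroup E] [NormedSpace ℝ E] (K : Set E) :
    Prop where
  isOpen : IsOpen K
  convex : Convex ℝ K
  isBounded : IsBounded K
  nonempty : K.Nonempty

theorem IsConvexBody.add {E : Type*} [NormedAddCommGroup E] [NormedSpace ℝ E] {K L : Set E}
    (hK : IsConvexBody K) (hL : Convex ℝ L) (hLb : IsBounded L) (hLn : L.Nonempty) :
    IsConvexBody (K + L) :=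
  ⟨hK.isOpen.add_right, hK.convex.add hL, hK.isBounded.add hLb, hK.nonempty.add hLn⟩

theorem IsConvexBody.add_zonotope {ι E : Type*} [Fintype ι] [NormedAddCommGroup E]
    [NormedSpace ℝ E] {K : Set E} (hK : IsConvexBody K) (u : ι → E) {x : ι → ℝ} (hx : 0 ≤ x) :
    IsConvexBody (K + zonotope u x) :=
  hK.add (convex_zonotope u x) (isCompact_zonotope u x).isBounded (zonotope_nonneg_nonempty u hx)

theorem IsConvexBody.image {E F : Type*} [NormedAddCommGroup E] [NormedSpace ℝ E]
    [CompleteSpace E] [NormedAddCommGroup F] [NormedSpace ℝ F] [CompleteSpace F] {K : Set E}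
    (hK : IsConvexBody K) (π : E →L[ℝ] F) (hπ : Function.Surjective π) : IsConvexBody (π '' K) :=
  ⟨π.isOpenMap hπ _ hK.isOpen, hK.convex.linear_image (π : E →ₗ[ℝ] F),
    π.lipschitz.isBounded_image hK.isBounded, hK.nonempty.image _⟩

section Volume

variable {E : Type*} [NormedAddCommGroup E] [NormedSpace ℝ E] [FiniteDimensional ℝ E]
  [MeasurableSpace E] [BorelSpace E] (μ : Measure E) [μ.IsAddHaarMeasure]

theorem IsConvexBody.measure_ne_top {K : Set E} (hK : IsConvexBody K) : μ K ≠ ∞ :=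
  hK.isBounded.measure_lt_top.ne

theorem IsConvexBody.measureReal_pos {K : Set E} (hK : IsConvexBody K) : 0 < μ.real K :=
  ENNReal.toReal_pos (hK.isOpen.measure_pos μ hK.nonempty).ne' (hK.measure_ne_top μ)

/-- `P` is the polynomial `x ↦ μ (K + ∑ i, [-x i • u i, x i • u i])`. -/
def IsVolumePolynomial {ι : Type*} [Fintype ι] (K : Set E) (u : ι → E)
    (P : MvPolynomial ι ℝ) : Prop :=
  ∀ x : ι → ℝ, 0 ≤ x → MvPolynomial.eval x P = μ.real (K + zonotope u x)

theorem MvPolynomial.hasDerivAt_eval_line {ι : Type*} [Fintype ι] (P : MvPolynomial ι ℝ)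
    (x Y : ι → ℝ) (s : ℝ) :
    HasDerivAt (fun s : ℝ => MvPolynomial.eval (x + s • Y) P)
      (∑ j, Y j * MvPolynomial.eval (x + s • Y) (MvPolynomial.pderiv j P)) s := by
  classical
  induction P using MvPolynomial.induction_on with
  | C a => simpa using hasDerivAt_const s a
  | add p q hp hq =>
    simp only [map_add, mul_add, Finset.sum_add_distrib]
    exact hp.fun_add hq
  | mul_X p i hp =>
    have hX : HasDerivAt (fun s : ℝ => x i + s * Y i) (Y i) s := by
      simpa using ((hasDerivAt_id s).mul_const (Y i)).const_add (x i)
    have := hp.fun_mul hX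
    have e : (fun s : ℝ => MvPolynomial.eval (x + s • Y) (p * MvPolynomial.X i)) =
        fun s : ℝ => MvPolynomial.eval (x + s • Y) p * (x i + s * Y i) := by
      ext s; simp
    rw [e]
    refine this.congr_deriv ?_
    simp only [Derivation.leibniz, map_add, MvPolynomial.pderiv_X, smul_eq_mul, map_mul,
      MvPolynomial.eval_X, Pi.add_apply, Pi.smul_apply, mul_add, Finset.sum_add_distrib,
      Finset.sum_mul]
    rw [add_comm]
    congr 1
    · rw [Finset.sum_eq_single i] <;> simp +contextual [mul_comm]
    · simp only [← Finset.sum_add_distrib]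
      exact Finset.sum_congr rfl fun j _ => by ring

theorem exists_polynomial_of_separately_affine {ι : Type*} [Fintype ι] [DecidableEq ι]
    (f : (ι → ℝ) → ℝ)
    (hf : ∀ i x, 0 ≤ x → ∃ A g : ℝ, ∀ t, 0 ≤ t → f (Function.update x i t) = A + t * g) :
    ∃ P : MvPolynomial ι ℝ, ∀ x, 0 ≤ x → MvPolynomial.eval x P = f x := by
  have key : ∀ (s : Finset ι) (y : ι → ℝ), 0 ≤ y → ∃ P : MvPolynomial ι ℝ, ∀ x, 0 ≤ x →
      MvPolynomial.eval x P = f (s.piecewise x y) := by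
    intro s
    induction s using Finset.induction_on with
    | empty => exact fun y hy => ⟨MvPolynomial.C (f y), by simp⟩
    | insert i s his ih =>
      intro y hy
      obtain ⟨P0, h0⟩ := ih (Function.update y i 0)
        (by intro j; rcases eq_or_ne j i with rfl | h <;> simp_all [Pi.le_def])
      obtain ⟨P1, h1⟩ := ih (Function.update y i 1)
        (by intro j; rcases eq_or_ne j i with rfl | h <;> simp_all [Pi.le_def])
      refine ⟨(1 - MvPolynomial.X i) * P0 + MvPolynomial.X i * P1, fun x hx => ?_⟩
      have hz : 0 ≤ s.piecewise x y := by
        intro j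
        by_cases hj : j ∈ s
        · simpa [hj] using hx j
        · simpa [hj] using hy j
      obtain ⟨A, g, hA⟩ := hf i (s.piecewise x y) hz
      have e : ∀ t, s.piecewise x (Function.update y i t) =
          Function.update (s.piecewise x y) i t := by
        intro t
        rw [Finset.update_piecewise_of_notMem _ _ _ his]
      have e0 := hA 0 le_rfl
      have e1 := hA 1 zero_le_one
      have ex := hA (x i) (hx i)
      simp only [map_add, map_mul, map_sub, map_one, MvPolynomial.eval_X, h0 x hx, h1 x hx, e,
        Finset.piecewise_insert, e0, e1, ex]
      ring
  obtain ⟨P, hP⟩ := key Finset.univ 0 le_rfl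
  exact ⟨P, fun x hx => by simpa using hP x hx⟩

variable {ι : Type*} [Fintype ι] {K : Set E} {u : ι → E}

theorem measureReal_add_segm (hK : IsConvexBody K) {v : E} {d : ℕ} {π : E →L[ℝ] (Fin d → ℝ)}
    {ν : Measure (Fin d → ℝ)} [ν.IsAddHaarMeasure] (hs : Function.Surjective π)
    (h : ∀ L : Set E, IsOpen L → Convex ℝ L → IsBounded L → ∀ x : ℝ, 0 ≤ x →
        μ (L + segm v x) = μ L + ENNReal.ofReal (2 * x) * ν (π '' L)) {t : ℝ} (ht : 0 ≤ t) :
    μ.real (K + segm v t) = μ.real K + t * (2 * ν.real (π '' K)) := by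
  rw [Measure.real, h K hK.isOpen hK.convex hK.isBounded t ht, ENNReal.toReal_add,
    ENNReal.toReal_mul, ENNReal.toReal_ofReal (by positivity)]
  · simp only [Measure.real]; ring
  · exact hK.measure_ne_top μ
  · exact ENNReal.mul_ne_top ENNReal.ofReal_ne_top ((hK.image π hs).measure_ne_top ν)

theorem segm_zero_left (t : ℝ) (ht : 0 ≤ t) : segm (0 : E) t = {0} := by
  ext z
  simp only [segm, smul_zero, mem_image, mem_Icc, exists_and_right, mem_singleton_iff]
  exact ⟨fun h => h.2.symm, fun h => ⟨⟨0, by simpa⟩, h.symm⟩⟩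

variable [DecidableEq ι]

theorem IsConvexBody.measureReal_add_single (hK : IsConvexBody K) (i : ι) {x : ι → ℝ}
    (hx : 0 ≤ x) : ∃ g : ℝ, ∀ t, 0 ≤ t →
      μ.real (K + zonotope u (x + Pi.single i t)) = μ.real (K + zonotope u x) + t * g := by
  by_cases hu : u i = 0
  · refine ⟨0, fun t ht => ?_⟩
    rw [zonotope_add_single u hx i ht, hu, segm_zero_left t ht]
    simp
  · have hd : Module.finrank ℝ E = (Module.finrank ℝ E - 1) + 1 := by
      have : Nontrivial E := ⟨_, _, hu⟩
      have := Module.finrank_pos (R := ℝ) (M := E)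
      omega
    obtain ⟨π, ν, hν, hs, -, h⟩ := exists_projection_volume μ hd hu
    refine ⟨2 * ν.real (π '' (K + zonotope u x)), fun t ht => ?_⟩
    rw [zonotope_add_single u hx i ht, ← add_assoc]
    exact measureReal_add_segm μ (hK.add_zonotope u hx) hs h ht

theorem IsConvexBody.exists_volumePolynomial (hK : IsConvexBody K) (u : ι → E) :
    ∃ P, IsVolumePolynomial μ K u P := by
  refine exists_polynomial_of_separately_affine _ fun i x hx => ?_
  obtain ⟨g, hg⟩ := hK.measureReal_add_single μ (u := u) i (x := Function.update x i 0)
    (by intro j; rcases eq_or_ne j i with rfl | h <;> simp_all [Pi.le_def])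
  refine ⟨μ.real (K + zonotope u (Function.update x i 0)), g, fun t ht => ?_⟩
  rw [← hg t ht]
  congr 3
  ext j
  rcases eq_or_ne j i with rfl | h <;> simp_all

theorem hasDerivAt_zero_of_affine_nonneg {f : ℝ → ℝ} {f' A g : ℝ} (hf : HasDerivAt f f' 0)
    (h : ∀ t, 0 ≤ t → f t = A + t * g) : f' = g := by
  have h1 : HasDerivWithinAt f f' (Ici 0) 0 := hf.hasDerivWithinAt
  have h2 : HasDerivWithinAt f g (Ici 0) 0 := by
    have : HasDerivAt (fun t : ℝ => A + t * g) g 0 := by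
      simpa using ((hasDerivAt_id (0:ℝ)).mul_const g).const_add A
    exact this.hasDerivWithinAt.congr (fun t ht => h t ht) (h 0 le_rfl)
  exact (uniqueDiffWithinAt_Ici (0:ℝ)).eq_deriv _ h1 h2

theorem IsVolumePolynomial.eval_pderiv {P : MvPolynomial ι ℝ} (hP : IsVolumePolynomial μ K u P)
    {i : ι} {x : ι → ℝ} (hx : 0 ≤ x) {g : ℝ} (hg : ∀ t, 0 ≤ t →
      μ.real (K + zonotope u (x + Pi.single i t)) = μ.real (K + zonotope u x) + t * g) :
    MvPolynomial.eval x (MvPolynomial.pderiv i P) = g := by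
  have h1 := MvPolynomial.hasDerivAt_eval_line P x (Pi.single i 1) 0
  have h2 := hasDerivAt_zero_of_affine_nonneg h1 (A := μ.real (K + zonotope u x)) (g := g) ?_
  · rw [← h2, Finset.sum_eq_single i] <;> simp +contextual
  · intro t ht
    have : t • (Pi.single i 1 : ι → ℝ) = Pi.single i t := by
      rw [← Pi.single_smul]; simp
    rw [this, hP, hg t ht]
    exact add_nonneg hx (Pi.single_nonneg.2 ht)

theorem IsVolumePolynomial.eval_pderiv_of_eq_zero {P : MvPolynomial ι ℝ}
    (hP : IsVolumePolynomial μ K u P) {i : ι} (hu : u i = 0) {x : ι → ℝ} (hx : 0 ≤ x) :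
    MvPolynomial.eval x (MvPolynomial.pderiv i P) = 0 := by
  refine hP.eval_pderiv μ hx fun t ht => ?_
  rw [zonotope_add_single u hx i ht, hu, segm_zero_left t ht]
  simp

/-- The partial derivative of a volume polynomial in the direction of a nonzero segment is twice
a volume polynomial of the projection along this segment. -/
theorem IsVolumePolynomial.exists_pderiv (hK : IsConvexBody K) {P : MvPolynomial ι ℝ}
    (hP : IsVolumePolynomial μ K u P) {i : ι} (hu : u i ≠ 0) {d : ℕ}
    (hd : Module.finrank ℝ E = d + 1) :
    ∃ (π : E →L[ℝ] (Fin d → ℝ)) (ν : Measure (Fin d → ℝ)), ν.IsAddHaarMeasure ∧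
      Function.Surjective π ∧ (∀ x, π x = 0 ↔ ∃ c : ℝ, x = c • u i) ∧
      IsConvexBody (π '' K) ∧
      IsVolumePolynomial ν (π '' K) (π ∘ u) (MvPolynomial.C (1 / 2) * MvPolynomial.pderiv i P) := by
  obtain ⟨π, ν, hν, hs, hker, h⟩ := exists_projection_volume μ hd hu
  refine ⟨π, ν, hν, hs, hker, hK.image π hs, fun x hx => ?_⟩
  rw [map_mul, MvPolynomial.eval_C, hP.eval_pderiv μ hx (g := 2 * ν.real (π '' (K + zonotope u x)))]
  · rw [image_add]
    have := image_zonotope (π : E →ₗ[ℝ] (Fin d → ℝ)) u x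
    simp only [ContinuousLinearMap.coe_coe] at this
    rw [this]
    ring
  · intro t ht
    rw [zonotope_add_single u hx i ht, ← add_assoc]
    exact measureReal_add_segm μ (hK.add_zonotope u hx) hs h ht

end Volume

theorem nonpos_of_symmetric_spectral_gap {V : Type*} [NormedAddCommGroup V]
    [InnerProductSpace ℝ V] [FiniteDimensional ℝ V] {T : V →ₗ[ℝ] V} (hT : T.IsSymmetric)
    {c : V} {q : ℝ} (hq : ∀ w, q ≤ ‖c - T w‖ ^ 2 + 2 * inner ℝ c w - inner ℝ w (T w))
    (h1 : ∀ w, inner ℝ w (T w) ≤ ‖T w‖ ^ 2) (h2 : ∀ w, inner ℝ w (T w) ≤ ‖w‖ ^ 2)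
    (h3 : ∀ w, T w = w → inner ℝ c w = 0) : q ≤ 0 := by
  let b := hT.eigenvectorBasis rfl
  let l := hT.eigenvalues rfl
  have hb : ∀ k, T (b k) = l k • b k := fun k => hT.apply_eigenvectorBasis rfl k
  have hbn : ∀ k, ‖b k‖ = 1 := fun k => b.orthonormal.1 k
  have hl : ∀ k, l k ≤ 0 ∨ l k = 1 := by
    intro k
    have e1 := h1 (b k)
    have e2 := h2 (b k)
    rw [hb, inner_smul_right, real_inner_self_eq_norm_sq, hbn] at e1 e2
    rw [norm_smul, hbn] at e1
    simp only [one_pow, mul_one, Real.norm_eq_abs, sq_abs] at e1 e2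
    by_contra! h
    rcases lt_or_eq_of_le e2 with h' | h'
    · nlinarith [h.1]
    · exact h.2 h'
  set γ : Fin (Module.finrank ℝ V) → ℝ := fun k => inner ℝ (b k) c with hγ
  have hl1 : ∀ k, l k = 1 → γ k = 0 := by
    intro k hk
    rw [hγ]; simp only
    rw [real_inner_comm]
    exact h3 _ (by rw [hb, hk, one_smul])
  let ω : Fin (Module.finrank ℝ V) → ℝ := fun k => if l k = 0 then - γ k / 2 else γ k / l k
  let w : V := ∑ k, ω k • b k
  have hw : ∀ k, inner ℝ (b k) w = ω k := fun k => by
    simp [w, inner_sum, inner_smul_right, b.inner_eq_ite]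
  have hTw : ∀ k, inner ℝ (b k) (T w) = l k * ω k := fun k => by
    rw [← hT, hb, inner_smul_left, hw]; simp
  have hn : ∀ x y : V, inner ℝ x y = ∑ k, inner ℝ (b k) x * inner ℝ (b k) y := by
    intro x y
    rw [← b.sum_inner_mul_inner x y]
    exact Finset.sum_congr rfl fun k _ => by rw [real_inner_comm]
  refine (hq w).trans ?_
  rw [← real_inner_self_eq_norm_sq, hn, hn c w, hn w (T w), Finset.mul_sum,
    ← Finset.sum_add_distrib, ← Finset.sum_sub_distrib]
  refine Finset.sum_nonpos fun k _ => ?_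
  simp only [inner_sub_right, hw, hTw]
  change (γ k - l k * ω k) * (γ k - l k * ω k) + 2 * (γ k * ω k) - ω k * (l k * ω k) ≤ 0
  by_cases h0 : l k = 0
  · simp only [ω, h0, if_true]
    nlinarith
  · simp only [ω, h0, if_false]
    have e : l k * (γ k / l k) = γ k := by field_simp
    rw [e]
    rcases hl k with h | h
    · have : γ k * (γ k / l k) ≤ 0 := by
        rw [← mul_div_assoc]
        exact div_nonpos_of_nonneg_of_nonpos (mul_self_nonneg _) h
      linarith
    · simp [hl1 k h]

theorem mul_sum_le_sq_of_bochner {ι : Type*} [Fintype ι] {H : ι → ι → ℝ}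
    (hsymm : ∀ i j, H i j = H j i) (hH : ∀ i j, 0 ≤ H i j) (hD : ∀ i, 0 < ∑ j, H i j)
    (hconn : ∀ z : ι → ℝ, (∀ i j, 0 < H i j → z i = z j) → ∀ i j, z i = z j)
    {σ : ι → ℝ} {κ : ℝ} (hB : ∀ (α : ℝ) (y : ι → ℝ),
      α ^ 2 * κ + 2 * α * ∑ j, σ j * y j + ∑ i, y i * ∑ j, H i j * y j ≤
        ∑ i, (α * σ i + ∑ j, H i j * y j) ^ 2 / ∑ j, H i j) :
    κ * ∑ i, ∑ j, H i j ≤ (∑ i, σ i) ^ 2 := by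
  rcases isEmpty_or_nonempty ι with hι | hι
  · simp
  set D : ι → ℝ := fun i => ∑ j, H i j with hDdef
  have hDs : 0 < ∑ i, D i := Finset.sum_pos (fun i _ => hD i) Finset.univ_nonempty
  set r : ι → ℝ := fun i => √(D i) with hr
  have hr0 : ∀ i, 0 < r i := fun i => Real.sqrt_pos.2 (hD i)
  have hrD : ∀ i, r i ^ 2 = D i := fun i => Real.sq_sqrt (hD i).le
  let T : EuclideanSpace ℝ ι →ₗ[ℝ] EuclideanSpace ℝ ι :=
    { toFun := fun w => WithLp.toLp 2 fun i => (∑ j, H i j * (w j / r j)) / r i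
      map_add' := fun w w' => by
        ext i; simp [add_div, mul_add, Finset.sum_add_distrib]
      map_smul' := fun a w => by
        ext i
        simp only [PiLp.smul_apply, smul_eq_mul, RingHom.id_apply, ← mul_div_assoc, Finset.mul_sum]
        congr 1
        exact Finset.sum_congr rfl fun j _ => by ring }
  have hTa : ∀ w i, T w i = (∑ j, H i j * (w j / r j)) / r i := fun w i => rfl
  have hin : ∀ x y : EuclideanSpace ℝ ι, inner ℝ x y = ∑ i, x i * y i := fun x y => by
    simp [PiLp.inner_apply, mul_comm]
  have hno : ∀ x : EuclideanSpace ℝ ι, ‖x‖ ^ 2 = ∑ i, x i ^ 2 := fun x => by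
    rw [← real_inner_self_eq_norm_sq, hin]
    exact Finset.sum_congr rfl fun i _ => by ring
  have hTsymm : T.IsSymmetric := by
    intro x y
    rw [hin, hin]
    simp only [hTa, Finset.sum_div, Finset.sum_mul, Finset.mul_sum]
    rw [Finset.sum_comm]
    refine Finset.sum_congr rfl fun i _ => Finset.sum_congr rfl fun j _ => ?_
    rw [hsymm i j]
    ring
  have hwT : ∀ w : EuclideanSpace ℝ ι, inner ℝ w (T w) =
      ∑ i, (w i / r i) * ∑ j, H i j * (w j / r j) := fun w => by
    rw [hin]
    exact Finset.sum_congr rfl fun i _ => by rw [hTa]; ring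
  have hww : ∀ w : EuclideanSpace ℝ ι, ‖w‖ ^ 2 = ∑ i, D i * (w i / r i) ^ 2 := fun w => by
    rw [hno]
    refine Finset.sum_congr rfl fun i _ => ?_
    rw [← hrD]
    field_simp [(hr0 i).ne']
  have hgap : ∀ w : EuclideanSpace ℝ ι, ‖w‖ ^ 2 - inner ℝ w (T w) =
      1 / 2 * ∑ i, ∑ j, H i j * (w i / r i - w j / r j) ^ 2 := fun w => by
    have e1 : ∑ i, D i * (w i / r i) ^ 2 = ∑ i, ∑ j, H i j * (w i / r i) ^ 2 :=
      Finset.sum_congr rfl fun i _ => by rw [hDdef]; simp only; rw [Finset.sum_mul]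
    have e2 : ∑ i, D i * (w i / r i) ^ 2 = ∑ i, ∑ j, H i j * (w j / r j) ^ 2 := by
      rw [e1, Finset.sum_comm]
      exact Finset.sum_congr rfl fun i _ => Finset.sum_congr rfl fun j _ => by rw [hsymm]
    have e3 : ∑ i, ∑ j, H i j * (w i / r i - w j / r j) ^ 2 =
        ∑ i, ∑ j, H i j * (w i / r i) ^ 2 + ∑ i, ∑ j, H i j * (w j / r j) ^ 2 -
          2 * ∑ i, (w i / r i) * ∑ j, H i j * (w j / r j) := by
      simp only [Finset.mul_sum, ← Finset.sum_add_distrib, ← Finset.sum_sub_distrib]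
      exact Finset.sum_congr rfl fun i _ => Finset.sum_congr rfl fun j _ => by ring
    rw [e3, ← e1, ← e2, hww, hwT]
    ring
  have hterm : ∀ (z : ι → ℝ) i j, 0 ≤ H i j * (z i - z j) ^ 2 :=
    fun z i j => mul_nonneg (hH i j) (sq_nonneg _)
  set θ := (∑ i, σ i) / ∑ i, D i with hθ
  let c : EuclideanSpace ℝ ι := WithLp.toLp 2 fun i => (σ i - θ * D i) / r i
  have hca : ∀ i, c i = (σ i - θ * D i) / r i := fun i => rfl
  have hmain : κ - (∑ i, σ i) ^ 2 / (∑ i, D i) ≤ 0 := by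
    refine nonpos_of_symmetric_spectral_gap hTsymm (c := c) ?_ ?_ ?_ ?_
    · intro w
      have h := hB 1 (fun i => -θ - w i / r i)
      have e1 : ∀ i, ∑ j, H i j * (-θ - w j / r j) = - θ * D i - ∑ j, H i j * (w j / r j) := by
        intro i
        simp only [hDdef, Finset.mul_sum, mul_sub, Finset.sum_sub_distrib]
        congr 1
        exact Finset.sum_congr rfl fun j _ => by ring
      simp only [e1] at h
      have e2 : ‖c - T w‖ ^ 2 =
          ∑ i, (1 * σ i + (-θ * D i - ∑ j, H i j * (w j / r j))) ^ 2 / ∑ j, H i j := by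
        rw [hno]
        refine Finset.sum_congr rfl fun i _ => ?_
        rw [show ∑ j, H i j = r i ^ 2 from (hrD i).symm, PiLp.sub_apply, hca, hTa, ← div_pow]
        ring
      rw [← e2] at h
      have e3 : ∑ j, σ j * (-θ - w j / r j) = - θ * (∑ j, σ j) - ∑ j, σ j * (w j / r j) := by
        simp only [Finset.mul_sum, ← Finset.sum_sub_distrib]
        exact Finset.sum_congr rfl fun j _ => by ring
      have e4 : ∑ i, (-θ - w i / r i) * (-θ * D i - ∑ j, H i j * (w j / r j)) =
          θ ^ 2 * ∑ i, D i + 2 * θ * ∑ i, D i * (w i / r i) + inner ℝ w (T w) := by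
        have e5 : ∑ i, D i * (w i / r i) = ∑ i, ∑ j, H i j * (w j / r j) := by
          rw [Finset.sum_comm]
          refine Finset.sum_congr rfl fun i _ => ?_
          simp only [hDdef]
          rw [Finset.sum_mul]
          exact Finset.sum_congr rfl fun j _ => by rw [hsymm]
        rw [hwT]
        have : 2 * θ * ∑ i, D i * (w i / r i) = θ * ∑ i, D i * (w i / r i) +
            θ * ∑ i, ∑ j, H i j * (w j / r j) := by rw [← e5]; ring
        rw [this]
        have hG : ∀ G : ι → ℝ, ∑ i, (-θ - w i / r i) * (-θ * D i - G i) =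
            θ ^ 2 * ∑ i, D i + (θ * ∑ i, D i * (w i / r i) + θ * ∑ i, G i) +
              ∑ i, w i / r i * G i := by
          intro G
          simp only [Finset.mul_sum, ← Finset.sum_add_distrib]
          exact Finset.sum_congr rfl fun i _ => by ring
        exact hG _
      have e6 : inner ℝ c w = ∑ j, σ j * (w j / r j) - θ * ∑ i, D i * (w i / r i) := by
        rw [hin, Finset.mul_sum, ← Finset.sum_sub_distrib]
        exact Finset.sum_congr rfl fun i _ => by rw [hca]; ring
      rw [e3, e4] at h
      rw [e6]
      have e7 : θ * ∑ i, D i = ∑ i, σ i := by rw [hθ]; field_simp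
      have e8 : (∑ i, σ i) ^ 2 / (∑ i, D i) = θ * ∑ i, σ i := by rw [hθ]; ring
      rw [e8]
      have e9 : θ ^ 2 * ∑ i, D i = θ * ∑ i, σ i := by rw [← e7]; ring
      rw [e9] at h
      linarith
    · intro w
      have h := hB 0 (fun i => w i / r i)
      have e2 : ‖T w‖ ^ 2 = ∑ i, (0 * σ i + ∑ j, H i j * (w j / r j)) ^ 2 / ∑ j, H i j := by
        rw [hno]
        refine Finset.sum_congr rfl fun i _ => ?_
        rw [show ∑ j, H i j = r i ^ 2 from (hrD i).symm, hTa, ← div_pow]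
        ring
      rw [hwT, e2]
      simpa using h
    · intro w
      have := hgap w
      have h0 : 0 ≤ ∑ i, ∑ j, H i j * (w i / r i - w j / r j) ^ 2 :=
        Finset.sum_nonneg fun i _ => Finset.sum_nonneg fun j _ => hterm (fun i => w i / r i) i j
      linarith
    · intro w hw
      have h := hgap w
      rw [hw, real_inner_self_eq_norm_sq, sub_self] at h
      have h0 : ∑ i, ∑ j, H i j * (w i / r i - w j / r j) ^ 2 = 0 := by linarith
      rw [Finset.sum_eq_zero_iff_of_nonneg fun i _ =>
        Finset.sum_nonneg fun j _ => hterm (fun i => w i / r i) i j] at h0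
      have hz := hconn (fun i => w i / r i) (by
        intro i j hij
        have h1 := h0 i (Finset.mem_univ i)
        rw [Finset.sum_eq_zero_iff_of_nonneg fun j _ => hterm (fun i => w i / r i) i j] at h1
        have h2 := h1 j (Finset.mem_univ j)
        have h3 := (mul_eq_zero.1 h2).resolve_left hij.ne'
        exact sub_eq_zero.1 (pow_eq_zero_iff two_ne_zero |>.1 h3))
      obtain ⟨i0⟩ := hι
      have e6 : inner ℝ c w = ∑ i, (σ i - θ * D i) * (w i / r i) := by
        rw [hin]
        exact Finset.sum_congr rfl fun i _ => by rw [hca]; ring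
      rw [e6, Finset.sum_congr rfl fun i _ => by rw [hz i i0], ← Finset.sum_mul,
        Finset.sum_sub_distrib, ← Finset.mul_sum, hθ, div_mul_cancel₀ _ hDs.ne', sub_self, zero_mul]
  rw [sub_nonpos, le_div_iff₀ hDs] at hmain
  exact hmain

theorem lorentz_of_concave {d a α Sy S1 Tyy Ty1 T11 : ℝ} (hd : 1 < d) (ha : 0 < a)
    (h : ∀ s t : ℝ, d * a * (s ^ 2 * Tyy + 2 * s * t * Ty1 + t ^ 2 * T11) ≤
      (d - 1) * (s * Sy + t * S1) ^ 2) (hT : 0 < T11) :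
    (α ^ 2 * (d * (d - 1) * a) + 2 * α * ((d - 1) * Sy) + Tyy) * T11 ≤
      (α * ((d - 1) * S1) + Ty1) ^ 2 := by
  set pp := d * (d - 1) * a with hpp
  have hd1 : 0 < d - 1 := by linarith
  have hpp0 : 0 < pp := by positivity
  set qyy := α ^ 2 * pp + 2 * α * ((d - 1) * Sy) + Tyy with hqyy
  set qyz := α * ((d - 1) * S1) + Ty1 with hqyz
  set py := α * pp + (d - 1) * Sy with hpy
  set pz := (d - 1) * S1 with hpz
  have key : ∀ s t : ℝ, pp * (s ^ 2 * qyy + 2 * s * t * qyz + t ^ 2 * T11) ≤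
      (s * py + t * pz) ^ 2 := by
    intro s t
    have := mul_le_mul_of_nonneg_left (h s t) hd1.le
    have e : (s * py + t * pz) ^ 2 - pp * (s ^ 2 * qyy + 2 * s * t * qyz + t ^ 2 * T11) =
      (d - 1) * ((d - 1) * (s * Sy + t * S1) ^ 2) -
        (d - 1) * (d * a * (s ^ 2 * Tyy + 2 * s * t * Ty1 + t ^ 2 * T11)) := by
      rw [hqyy, hqyz, hpy, hpz, hpp]; ring
    linarith
  have hz : 0 < pz ^ 2 := by
    have := key 0 1
    have h2 : 0 < pp * T11 := by positivity
    nlinarith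
  have hw : pz ^ 2 * qyy - 2 * pz * py * qyz + py ^ 2 * T11 ≤ 0 := by
    have := key pz (-py)
    have e : pz * py + -py * pz = 0 := by ring
    rw [e] at this
    have : pp * (pz ^ 2 * qyy + 2 * pz * -py * qyz + (-py) ^ 2 * T11) ≤ 0 := by simpa using this
    have := nonpos_of_mul_nonpos_right this hpp0
    linarith
  have h3 : pz ^ 2 * (qyy * T11 - qyz ^ 2) ≤ 0 := by
    have := mul_nonpos_of_nonpos_of_nonneg hw hT.le
    nlinarith [sq_nonneg (py * T11 - pz * qyz)]
  have := nonpos_of_mul_nonpos_right h3 hz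
  linarith

theorem mul_sum_le_sq_sum_of_concave {ι : Type*} [Fintype ι] {d : ℝ} (hd : 1 < d) {a : ι → ℝ}
    {S : ι → ι → ℝ} {T : ι → ι → ι → ℝ} (ha : ∀ i, 0 < a i) (hS : ∀ i j, S i j = S j i)
    (hT1 : ∀ i j k, T i j k = T j i k) (hT2 : ∀ i j k, T i j k = T i k j)
    (hT : ∀ i j k, 0 ≤ T i j k) (hD : ∀ i, 0 < ∑ j, ∑ k, T i j k)
    (hconn : ∀ z : ι → ℝ, (∀ i j, 0 < ∑ k, T i j k → z i = z j) → ∀ i j, z i = z j)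
    (hc : ∀ i (Y : ι → ℝ), d * a i * ∑ j, ∑ k, T i j k * Y j * Y k ≤
      (d - 1) * (∑ j, S i j * Y j) ^ 2) :
    d * (∑ i, a i) * (∑ i, ∑ j, ∑ k, T i j k) ≤ (d - 1) * (∑ i, ∑ j, S i j) ^ 2 := by
  have hd1 : 0 < d - 1 := by linarith
  have hmain := mul_sum_le_sq_of_bochner (H := fun i j => ∑ k, T i j k)
    (σ := fun i => (d - 1) * ∑ j, S i j) (κ := d * (d - 1) * ∑ i, a i)
    (fun i j => Finset.sum_congr rfl fun k _ => hT1 i j k)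
    (fun i j => Finset.sum_nonneg fun k _ => hT i j k) hD hconn ?_
  · rw [← Finset.mul_sum] at hmain
    have : (d - 1) * (d * (∑ i, a i) * (∑ i, ∑ j, ∑ k, T i j k)) ≤
        (d - 1) * ((d - 1) * (∑ i, ∑ j, S i j) ^ 2) := by nlinarith
    exact le_of_mul_le_mul_left this hd1
  · intro α y
    have hterm : ∀ i, α ^ 2 * (d * (d - 1) * a i) + 2 * α * ((d - 1) * ∑ j, S i j * y j) +
        ∑ j, ∑ k, T i j k * y j * y k ≤
        (α * ((d - 1) * ∑ j, S i j) + ∑ j, (∑ k, T i j k) * y j) ^ 2 / ∑ j, ∑ k, T i j k := by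
      intro i
      rw [le_div_iff₀ (hD i)]
      refine lorentz_of_concave hd (ha i) (fun s t => ?_) (hD i)
      have e1 : ∑ j, ∑ k, T i j k * y k = ∑ j, (∑ k, T i j k) * y j := by
        rw [Finset.sum_comm]
        refine Finset.sum_congr rfl fun j _ => ?_
        rw [Finset.sum_mul]
        exact Finset.sum_congr rfl fun k _ => by rw [hT2]
      have h := hc i (fun j => s * y j + t)
      have e2 : ∑ j, S i j * (s * y j + t) = s * ∑ j, S i j * y j + t * ∑ j, S i j := by
        simp only [Finset.mul_sum, ← Finset.sum_add_distrib]
        exact Finset.sum_congr rfl fun j _ => by ring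
      have e3 : ∑ j, ∑ k, T i j k * (s * y j + t) * (s * y k + t) =
          s ^ 2 * ∑ j, ∑ k, T i j k * y j * y k + 2 * s * t * ∑ j, (∑ k, T i j k) * y j +
            t ^ 2 * ∑ j, ∑ k, T i j k := by
        have : 2 * s * t * ∑ j, (∑ k, T i j k) * y j =
            s * t * ∑ j, ∑ k, T i j k * y k + s * t * ∑ j, ∑ k, T i j k * y j := by
          rw [e1]; simp only [← Finset.sum_mul]; ring
        rw [this]
        simp only [Finset.mul_sum, ← Finset.sum_add_distrib]
        exact Finset.sum_congr rfl fun j _ => Finset.sum_congr rfl fun k _ => by ring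
      rw [e2, e3] at h
      exact h
    refine le_trans (le_of_eq ?_) (Finset.sum_le_sum fun i _ => hterm i)
    rw [Finset.sum_add_distrib, Finset.sum_add_distrib]
    congr 1
    · congr 1
      · simp only [Finset.mul_sum]
      · rw [← Finset.mul_sum]
        congr 1
        simp only [mul_assoc, ← Finset.mul_sum]
        congr 1
        simp only [Finset.sum_mul]
        rw [Finset.sum_comm]
        exact Finset.sum_congr rfl fun i _ => Finset.sum_congr rfl fun j _ => by rw [hS]
    · have e1 : ∑ i, y i * ∑ j, (∑ k, T i j k) * y j = ∑ i, ∑ j, ∑ k, T i j k * y i * y j := by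
        simp only [Finset.mul_sum, Finset.sum_mul]
        exact Finset.sum_congr rfl fun i _ => Finset.sum_congr rfl fun j _ =>
          Finset.sum_congr rfl fun k _ => by ring
      rw [e1]
      have e2 : ∀ i, ∑ j, ∑ k, T i j k * y i * y j = ∑ k, ∑ j, T k i j * y i * y j := by
        intro i
        rw [Finset.sum_comm]
        exact Finset.sum_congr rfl fun i _ => Finset.sum_congr rfl fun j _ => by
          rw [hT2, hT1]
      rw [Finset.sum_congr rfl fun i _ => e2 i, Finset.sum_comm]

theorem mul_deriv_deriv_le_of_rpow_midpoint {G G1 : ℝ → ℝ} {G2 α : ℝ} (hα : 0 < α)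
    (h1 : ∀ s, HasDerivAt G (G1 s) s) (h2 : HasDerivAt G1 G2 0) (h0 : 0 < G 0)
    (hmid : ∀ᶠ s in nhds 0, G s ^ α + G (-s) ^ α ≤ 2 * G 0 ^ α) :
    G 0 * G2 ≤ (1 - α) * G1 0 ^ 2 := by
  have hcont : Continuous G := continuous_iff_continuousAt.2 fun s => (h1 s).continuousAt
  let ψ : ℝ → ℝ := fun s => G s ^ α + G (-s) ^ α
  have hpos : ∀ᶠ s in nhds (0:ℝ), 0 < G s := hcont.continuousAt.eventually (lt_mem_nhds h0)
  have hpos' : ∀ᶠ s in nhds (0:ℝ), 0 < G (-s) := by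
    have : Filter.Tendsto (fun s : ℝ => G (-s)) (nhds 0) (nhds (G 0)) := by
      have := (hcont.comp continuous_neg).tendsto 0
      simpa [Function.comp_def] using this
    exact this.eventually (lt_mem_nhds h0)
  have hder : ∀ s, 0 < G s → HasDerivAt (fun s => G s ^ α) (G1 s * α * G s ^ (α - 1)) s :=
    fun s hs => (h1 s).rpow_const (Or.inl hs.ne')
  have hderψ : ∀ᶠ s in nhds (0:ℝ), HasDerivAt ψ
      (G1 s * α * G s ^ (α - 1) - G1 (-s) * α * G (-s) ^ (α - 1)) s := by
    filter_upwards [hpos, hpos'] with s hs hs'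
    have := (hder s hs).fun_add ((hder (-s) hs').comp s (hasDerivAt_neg s))
    exact this.congr_deriv (by ring)
  have hdψ : deriv ψ =ᶠ[nhds 0] fun s => G1 s * α * G s ^ (α - 1) - G1 (-s) * α * G (-s) ^ (α - 1) :=
    hderψ.mono fun s hs => hs.deriv
  set D := G2 * α * G 0 ^ (α - 1) + G1 0 * α * (G1 0 * (α - 1) * G 0 ^ (α - 1 - 1)) with hD
  have hA : HasDerivAt (fun s => G1 s * α * G s ^ (α - 1)) D 0 :=
    (h2.mul_const α).mul ((h1 0).rpow_const (Or.inl h0.ne'))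
  have hdd : HasDerivAt (deriv ψ) (2 * D) 0 := by
    have hB : HasDerivAt (fun s => G1 (-s) * α * G (-s) ^ (α - 1)) (D * -1) 0 := by
      have hA' : HasDerivAt (fun s => G1 s * α * G s ^ (α - 1)) D (-0) := by simpa using hA
      exact hA'.comp (0:ℝ) (hasDerivAt_neg 0)
    have := (hA.fun_sub hB).congr_of_eventuallyEq hdψ
    exact this.congr_deriv (by ring)
  have hDle : D ≤ 0 := by
    by_contra! hpD
    have hψ0 : ψ 0 = 2 * G 0 ^ α := by simp [ψ]; ring
    have hcψ : ContinuousAt ψ 0 := hderψ.self_of_nhds.continuousAt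
    have hmin := isLocalMin_of_deriv_deriv_pos (f := ψ) (x₀ := 0) (by rw [hdd.deriv]; linarith)
      (by rw [hdψ.self_of_nhds]; simp) hcψ
    have heq : ψ =ᶠ[nhds 0] fun _ => ψ 0 := by
      filter_upwards [hmin, hmid] with s hs hs'
      refine le_antisymm ?_ hs
      rw [hψ0]; exact hs'
    have e1 : deriv ψ =ᶠ[nhds 0] fun _ => 0 := by
      have := heq.deriv
      simpa using this
    have e2 := e1.deriv_eq
    rw [hdd.deriv] at e2
    simp at e2
    linarith
  have e : D = α * G 0 ^ (α - 1 - 1) * (G 0 * G2 - (1 - α) * G1 0 ^ 2) := by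
    have : G 0 ^ (α - 1) = G 0 ^ (α - 1 - 1) * G 0 := by
      rw [← Real.rpow_add_one h0.ne']; congr 1; ring
    rw [hD, this]; ring
  rw [e] at hDle
  have := nonpos_of_mul_nonpos_right hDle (by positivity)
  linarith

theorem MvPolynomial.pderiv_comm {σ : Type*} (i j : σ) (P : MvPolynomial σ ℝ) :
    pderiv i (pderiv j P) = pderiv j (pderiv i P) := by
  classical
  have h : ⁅pderiv (R := ℝ) i, pderiv (R := ℝ) j⁆ = 0 := by
    refine derivation_ext fun k => ?_
    rw [Derivation.commutator_apply]
    simp only [pderiv_X, Pi.single_apply]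
    split_ifs <;> simp
  have := congrArg (fun D => D P) h
  simpa [Derivation.commutator_apply, sub_eq_zero] using this

section Volume

variable {E : Type*} [NormedAddCommGroup E] [NormedSpace ℝ E] [FiniteDimensional ℝ E]
  [MeasurableSpace E] [BorelSpace E] (μ : Measure E) [μ.IsAddHaarMeasure]
  {ι : Type*} [Fintype ι] [DecidableEq ι] {K : Set E} {u : ι → E} {P : MvPolynomial ι ℝ}

namespace IsVolumePolynomial

theorem pderiv_eq_zero (hP : IsVolumePolynomial μ K u P) {i : ι} (hu : u i = 0) :
    MvPolynomial.pderiv i P = 0 := by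
  refine MvPolynomial.funext_set (fun _ => Ici (0:ℝ)) (fun _ => Ici_infinite 0) fun x hx => ?_
  rw [map_zero]
  exact hP.eval_pderiv_of_eq_zero μ hu fun i => by simpa using hx i (mem_univ i)

theorem finrank_eq_succ {v : E} (hv : v ≠ 0) :
    Module.finrank ℝ E = (Module.finrank ℝ E - 1) + 1 := by
  have : Nontrivial E := ⟨_, _, hv⟩
  have := Module.finrank_pos (R := ℝ) (M := E)
  omega

theorem pderiv_pos (hK : IsConvexBody K) (hP : IsVolumePolynomial μ K u P) {i : ι} (hu : u i ≠ 0)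
    {x : ι → ℝ} (hx : 0 ≤ x) : 0 < MvPolynomial.eval x (MvPolynomial.pderiv i P) := by
  obtain ⟨π, ν, hν, -, -, hK', hQ⟩ := hP.exists_pderiv μ hK hu (finrank_eq_succ hu)
  have h1 := hQ x hx
  have h2 := (hK'.add_zonotope (π ∘ u) hx).measureReal_pos ν
  rw [map_mul, MvPolynomial.eval_C] at h1
  linarith

theorem pderiv_nonneg (hK : IsConvexBody K) (hP : IsVolumePolynomial μ K u P) (i : ι)
    {x : ι → ℝ} (hx : 0 ≤ x) : 0 ≤ MvPolynomial.eval x (MvPolynomial.pderiv i P) := by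
  by_cases hu : u i = 0
  · simp [hP.pderiv_eq_zero μ hu]
  · exact (hP.pderiv_pos μ hK hu hx).le

theorem pderiv_pderiv_pos (hK : IsConvexBody K) (hP : IsVolumePolynomial μ K u P) {i j : ι}
    (hi : u i ≠ 0) (hj : ∀ c : ℝ, u j ≠ c • u i) {x : ι → ℝ} (hx : 0 ≤ x) :
    0 < MvPolynomial.eval x (MvPolynomial.pderiv j (MvPolynomial.pderiv i P)) := by
  obtain ⟨π, ν, hν, -, hker, hK', hQ⟩ := hP.exists_pderiv μ hK hi (finrank_eq_succ hi)
  have h1 := hQ.pderiv_pos ν hK' (i := j) (fun h => by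
    obtain ⟨c, hc⟩ := (hker (u j)).1 h
    exact hj c hc) hx
  rw [MvPolynomial.pderiv_C_mul, map_mul, MvPolynomial.eval_C] at h1
  linarith

theorem pderiv_pderiv_nonneg (hK : IsConvexBody K) (hP : IsVolumePolynomial μ K u P) (i j : ι)
    {x : ι → ℝ} (hx : 0 ≤ x) :
    0 ≤ MvPolynomial.eval x (MvPolynomial.pderiv j (MvPolynomial.pderiv i P)) := by
  by_cases hi : u i = 0
  · simp [hP.pderiv_eq_zero μ hi]
  · obtain ⟨π, ν, hν, -, hker, hK', hQ⟩ := hP.exists_pderiv μ hK hi (finrank_eq_succ hi)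
    have h1 := hQ.pderiv_nonneg ν hK' j hx
    rw [MvPolynomial.pderiv_C_mul, map_mul, MvPolynomial.eval_C] at h1
    linarith

theorem pderiv_pderiv_pderiv_pos (hK : IsConvexBody K) (hP : IsVolumePolynomial μ K u P)
    {i j k : ι} (hi : u i ≠ 0) (hj : ∀ c : ℝ, u j ≠ c • u i)
    (hk : ∀ c c' : ℝ, u k ≠ c • u i + c' • u j) {x : ι → ℝ} (hx : 0 ≤ x) :
    0 < MvPolynomial.eval x
      (MvPolynomial.pderiv k (MvPolynomial.pderiv j (MvPolynomial.pderiv i P))) := by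
  obtain ⟨π, ν, hν, -, hker, hK', hQ⟩ := hP.exists_pderiv μ hK hi (finrank_eq_succ hi)
  have h1 := hQ.pderiv_pderiv_pos ν hK' (i := j) (j := k) (fun h => by
    obtain ⟨c, hc⟩ := (hker (u j)).1 h
    exact hj c hc) (fun c' h => by
    have h0 : π (u k - c' • u j) = 0 := by
      rw [map_sub, map_smul, sub_eq_zero]; exact h
    obtain ⟨c, hc⟩ := (hker _).1 h0
    exact hk c c' (by rw [← hc]; abel)) hx
  rw [MvPolynomial.pderiv_C_mul, MvPolynomial.pderiv_C_mul, map_mul, MvPolynomial.eval_C] at h1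
  linarith

theorem pderiv_pderiv_pderiv_nonneg (hK : IsConvexBody K) (hP : IsVolumePolynomial μ K u P)
    (i j k : ι) {x : ι → ℝ} (hx : 0 ≤ x) :
    0 ≤ MvPolynomial.eval x
      (MvPolynomial.pderiv k (MvPolynomial.pderiv j (MvPolynomial.pderiv i P))) := by
  by_cases hi : u i = 0
  · simp [hP.pderiv_eq_zero μ hi]
  · obtain ⟨π, ν, hν, -, hker, hK', hQ⟩ := hP.exists_pderiv μ hK hi (finrank_eq_succ hi)
    have h1 := hQ.pderiv_pderiv_nonneg ν hK' j k hx
    rw [MvPolynomial.pderiv_C_mul, MvPolynomial.pderiv_C_mul, map_mul, MvPolynomial.eval_C] at h1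
    linarith

theorem pderiv_pderiv_eq_zero (hK : IsConvexBody K) (hP : IsVolumePolynomial μ K u P) (i j : ι)
    (hE : Module.finrank ℝ E ≤ 1) : MvPolynomial.pderiv j (MvPolynomial.pderiv i P) = 0 := by
  by_cases hi : u i = 0
  · simp [hP.pderiv_eq_zero μ hi]
  · obtain ⟨π, ν, hν, -, hker, hK', hQ⟩ := hP.exists_pderiv μ hK hi
      (d := 0) (by have := finrank_eq_succ hi; omega)
    have h1 := hQ.pderiv_eq_zero ν (i := j) (Subsingleton.elim _ _)
    rw [MvPolynomial.pderiv_C_mul] at h1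
    simpa using h1

theorem pderiv_pderiv_pderiv_eq_zero (hK : IsConvexBody K) (hP : IsVolumePolynomial μ K u P)
    (i j k : ι) (hE : Module.finrank ℝ E ≤ 2) :
    MvPolynomial.pderiv k (MvPolynomial.pderiv j (MvPolynomial.pderiv i P)) = 0 := by
  by_cases hi : u i = 0
  · simp [hP.pderiv_eq_zero μ hi]
  · obtain ⟨π, ν, hν, -, hker, hK', hQ⟩ := hP.exists_pderiv μ hK hi (finrank_eq_succ hi)
    have h1 := hQ.pderiv_pderiv_eq_zero ν hK' j k (by simp; omega)
    rw [MvPolynomial.pderiv_C_mul, MvPolynomial.pderiv_C_mul] at h1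
    simpa using h1

/-- Infinitesimal form of the Brunn–Minkowski inequality for volume polynomials. -/
theorem mul_sum_pderiv_le (hK : IsConvexBody K) (hP : IsVolumePolynomial μ K u P) {m : ℕ}
    (hm : Module.finrank ℝ E = m) (hm0 : 0 < m) {x : ι → ℝ} (hx : ∀ i, 0 < x i) (Y : ι → ℝ) :
    m * MvPolynomial.eval x P *
        ∑ j, ∑ k, MvPolynomial.eval x (MvPolynomial.pderiv k (MvPolynomial.pderiv j P)) *
          Y j * Y k ≤
      (m - 1) * (∑ j, MvPolynomial.eval x (MvPolynomial.pderiv j P) * Y j) ^ 2 := by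
  have hm0' : (0:ℝ) < m := by exact_mod_cast hm0
  have hx0 : 0 ≤ x := fun i => (hx i).le
  have hnear : ∀ᶠ s in nhds (0:ℝ), ∀ i, 0 < (x + s • Y) i := by
    rw [Filter.eventually_all]
    intro i
    have : Filter.Tendsto (fun s : ℝ => (x + s • Y) i) (nhds 0) (nhds (x i)) := by
      have h : Continuous (fun s : ℝ => (x + s • Y) i) := by
        simp only [Pi.add_apply, Pi.smul_apply, smul_eq_mul]; fun_prop
      simpa using h.tendsto 0
    exact this.eventually (lt_mem_nhds (hx i))
  have hnear' : ∀ᶠ s in nhds (0:ℝ), ∀ i, 0 < (x + (-s) • Y) i := by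
    have : Filter.Tendsto (fun s : ℝ => -s) (nhds 0) (nhds 0) := by
      simpa using (continuous_neg (G := ℝ)).tendsto 0
    exact this.eventually hnear
  have key := mul_deriv_deriv_le_of_rpow_midpoint (α := 1 / m) (by positivity)
    (G := fun s => MvPolynomial.eval (x + s • Y) P)
    (fun s => MvPolynomial.hasDerivAt_eval_line P x Y s)
    (HasDerivAt.fun_sum fun j _ =>
      (MvPolynomial.hasDerivAt_eval_line (MvPolynomial.pderiv j P) x Y 0).const_mul (Y j))
    (by simpa [hP x hx0] using (hK.add_zonotope u hx0).measureReal_pos μ) ?_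
  · simp only [zero_smul, add_zero] at key
    have e1 : ∑ j, ∑ k, MvPolynomial.eval x (MvPolynomial.pderiv k (MvPolynomial.pderiv j P)) *
          Y j * Y k = ∑ j, Y j * ∑ k, Y k *
            MvPolynomial.eval x (MvPolynomial.pderiv k (MvPolynomial.pderiv j P)) := by
      refine Finset.sum_congr rfl fun j _ => ?_
      rw [Finset.mul_sum]
      exact Finset.sum_congr rfl fun k _ => by ring
    have e2 : ∑ j, MvPolynomial.eval x (MvPolynomial.pderiv j P) * Y j =
        ∑ j, Y j * MvPolynomial.eval x (MvPolynomial.pderiv j P) :=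
      Finset.sum_congr rfl fun j _ => mul_comm _ _
    rw [e1, e2, mul_assoc]
    refine (mul_le_mul_of_nonneg_left key hm0'.le).trans (le_of_eq ?_)
    field_simp
  · filter_upwards [hnear, hnear'] with s hs hs'
    have h1 : 0 ≤ x + s • Y := fun i => (hs i).le
    have h2 : 0 ≤ x + (-s) • Y := fun i => (hs' i).le
    have b1 := hK.add_zonotope u h1
    have b2 := hK.add_zonotope u h2
    have b := hK.add_zonotope u hx0
    simp only [zero_smul, add_zero]
    rw [hP _ h1, hP _ h2, hP _ hx0]
    have := brunn_minkowski μ hm hm0 b1.isOpen.measurableSet b2.isOpen.measurableSet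
      b.isOpen.measurableSet (b1.measureReal_pos μ) (b2.measureReal_pos μ) (b.measure_ne_top μ)
      (a := 1 / 2) (b := 1 / 2) (by norm_num) (by norm_num) ?_
    · linarith
    · rintro _ ⟨k, hk, z, hz, rfl⟩ _ ⟨k', hk', z', hz', rfl⟩
      refine ⟨(1 / 2 : ℝ) • k + (1 / 2 : ℝ) • k', hK.convex hk hk' (by norm_num) (by norm_num)
        (by norm_num), (1 / 2 : ℝ) • z + (1 / 2 : ℝ) • z', ?_, ?_⟩
      · have := smul_zonotope_add_smul_zonotope_mem (a := 1 / 2) (b := 1 / 2) (by norm_num)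
          (by norm_num) hz hz'
        convert this using 2
        module
      · module

end IsVolumePolynomial

theorem exists_notMem_span_pair (hspan : Submodule.span ℝ (range u) = ⊤)
    (hE : 3 ≤ Module.finrank ℝ E) (i j : ι) : ∃ k, ∀ c c' : ℝ, u k ≠ c • u i + c' • u j := by
  by_contra! h
  have h1 : (⊤ : Submodule ℝ E) ≤ Submodule.span ℝ {u i, u j} := by
    rw [← hspan, Submodule.span_le]
    rintro _ ⟨k, rfl⟩
    obtain ⟨c, c', hc⟩ := h k
    exact Submodule.mem_span_pair.2 ⟨c, c', hc.symm⟩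
  have h2 := Submodule.finrank_mono h1
  rw [finrank_top] at h2
  classical
  have h3 := finrank_span_finset_le_card (R := ℝ) ({u i, u j} : Finset E)
  rw [Finset.coe_insert, Finset.coe_singleton] at h3
  have h4 : ({u i, u j} : Finset E).card ≤ 2 := Finset.card_le_two
  have h5 := h2.trans (h3.trans h4)
  omega

/-- Third order consequence of the Brunn–Minkowski inequality: the derivative `p'` of
`p s = μ (K + s Z)` satisfies `d p' p''' ≤ (d - 1) (p'')²`, where `d + 1` is the dimension. -/
theorem IsVolumePolynomial.mul_sum_third_le (hK : IsConvexBody K)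
    (hP : IsVolumePolynomial μ K u P) (hu : ∀ i, u i ≠ 0)
    (hspan : Submodule.span ℝ (range u) = ⊤) {d : ℕ} (hd : 1 ≤ d)
    (hE : Module.finrank ℝ E = d + 1) {x : ι → ℝ} (hx : ∀ i, 0 < x i) :
    d * (∑ i, MvPolynomial.eval x (MvPolynomial.pderiv i P)) *
        (∑ i, ∑ j, ∑ k, MvPolynomial.eval x
          (MvPolynomial.pderiv k (MvPolynomial.pderiv j (MvPolynomial.pderiv i P)))) ≤
      (d - 1) * (∑ i, ∑ j,
        MvPolynomial.eval x (MvPolynomial.pderiv j (MvPolynomial.pderiv i P))) ^ 2 := by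
  have hx0 : 0 ≤ x := fun i => (hx i).le
  rcases hd.eq_or_lt with rfl | hd
  · simp [hP.pderiv_pderiv_pderiv_eq_zero μ hK _ _ _ hE.le]
  have hE3 : 3 ≤ Module.finrank ℝ E := by omega
  have hpos : ∀ i j, (∀ c : ℝ, u j ≠ c • u i) → 0 < ∑ k, MvPolynomial.eval x
      (MvPolynomial.pderiv k (MvPolynomial.pderiv j (MvPolynomial.pderiv i P))) := by
    intro i j hij
    obtain ⟨k, hk⟩ := exists_notMem_span_pair hspan hE3 i j
    exact Finset.sum_pos' (fun k _ => hP.pderiv_pderiv_pderiv_nonneg μ hK i j k hx0)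
      ⟨k, Finset.mem_univ k, hP.pderiv_pderiv_pderiv_pos μ hK (hu i) hij hk hx0⟩
  have hex : ∀ i, ∃ k, ∀ c : ℝ, u k ≠ c • u i := by
    intro i
    obtain ⟨k, hk⟩ := exists_notMem_span_pair hspan hE3 i i
    exact ⟨k, fun c => by simpa using hk c 0⟩
  refine mul_sum_le_sq_sum_of_concave (by exact_mod_cast hd) (fun i => hP.pderiv_pos μ hK (hu i) hx0)
    (fun i j => by rw [MvPolynomial.pderiv_comm]) (fun i j k => by rw [MvPolynomial.pderiv_comm j i])
    (fun i j k => by rw [MvPolynomial.pderiv_comm])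
    (fun i j k => hP.pderiv_pderiv_pderiv_nonneg μ hK i j k hx0) (fun i => ?_) ?_ ?_
  · obtain ⟨j, hj⟩ := hex i
    exact Finset.sum_pos' (fun j _ => Finset.sum_nonneg fun k _ =>
      hP.pderiv_pderiv_pderiv_nonneg μ hK i j k hx0) ⟨j, Finset.mem_univ j, hpos i j hj⟩
  · intro z hz i j
    by_cases hij : ∀ c : ℝ, u j ≠ c • u i
    · exact hz i j (hpos i j hij)
    · push Not at hij
      obtain ⟨c, hc⟩ := hij
      have hc0 : c ≠ 0 := by
        rintro rfl
        exact hu j (by simpa using hc)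
      obtain ⟨k, hk⟩ := hex i
      have hk' : ∀ c' : ℝ, u k ≠ c' • u j := fun c' h => hk (c' * c) (by rw [h, hc, smul_smul])
      rw [hz i k (hpos i k hk), hz j k (hpos j k hk')]
  · intro i Y
    obtain ⟨π, ν, hν, -, hker, hK', hQ⟩ := hP.exists_pderiv μ hK (hu i) hE
    have := hQ.mul_sum_pderiv_le ν hK' (m := d) (by simp) (by omega) hx Y
    simp only [MvPolynomial.pderiv_C_mul, map_mul, MvPolynomial.eval_C, mul_assoc,
      ← Finset.mul_sum] at this ⊢
    rw [mul_pow] at this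
    nlinarith

end Volume

/-- If `r > 0` and `d r r'' ≤ (d - 1) r'²` then `r ^ (1/d)` is concave. -/
theorem concaveOn_rpow_of_mul_le {r r1 r2 : ℝ → ℝ} {d : ℝ} (hd : 0 < d)
    (h1 : ∀ s, HasDerivAt r (r1 s) s) (h2 : ∀ s, HasDerivAt r1 (r2 s) s)
    (hpos : ∀ s, 0 ≤ s → 0 < r s)
    (h : ∀ s, 0 < s → d * r s * r2 s ≤ (d - 1) * r1 s ^ 2) :
    ConcaveOn ℝ (Ici 0) fun s => r s ^ (1 / d) := by
  set α := 1 / d with hα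
  have hα0 : 0 < α := by positivity
  have hcont : Continuous r := continuous_iff_continuousAt.2 fun s => (h1 s).continuousAt
  refine concaveOn_of_hasDerivWithinAt2_nonpos (convex_Ici 0)
    (f' := fun s => r1 s * α * r s ^ (α - 1))
    (f'' := fun s => r2 s * α * r s ^ (α - 1) + r1 s * α * (r1 s * (α - 1) * r s ^ (α - 1 - 1)))
    (hcont.continuousOn.rpow_const fun s _ => Or.inr hα0.le) ?_ ?_ ?_
  · intro s hs
    rw [interior_Ici] at hs
    exact ((h1 s).rpow_const (Or.inl (hpos s hs.le).ne')).hasDerivWithinAt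
  · intro s hs
    rw [interior_Ici] at hs
    exact (((h2 s).mul_const α).fun_mul
      ((h1 s).rpow_const (Or.inl (hpos s hs.le).ne'))).hasDerivWithinAt
  · intro s hs
    rw [interior_Ici] at hs
    have hr := hpos s hs.le
    have e : r s ^ (α - 1) = r s ^ (α - 1 - 1) * r s := by
      rw [← Real.rpow_add_one hr.ne']; congr 1; ring
    rw [e]
    have h3 := h s hs
    have h4 : r s * r2 s ≤ (1 - α) * r1 s ^ 2 := by
      have : d * (r s * r2 s) ≤ d * ((1 - α) * r1 s ^ 2) := by
        have e : d * ((1 - α) * r1 s ^ 2) = (d - 1) * r1 s ^ 2 := by rw [hα]; field_simp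
        rw [e]; linarith
      exact le_of_mul_le_mul_left this hd
    have h5 : 0 ≤ α * r s ^ (α - 1 - 1) := by positivity
    have := mul_le_mul_of_nonneg_left h4 h5
    linarith

/-- If `p' = f ^ d` with `f` concave and `p` grows at least like `m s ^ (d+1)`, then the slope of
`f` is at least `((d + 1) m) ^ (1/d)`. -/
theorem ConcaveOn.add_mul_le_of_growth {f p : ℝ → ℝ} {d : ℕ} (hd : 1 ≤ d)
    (hf : ConcaveOn ℝ (Ici 0) f) (hpos : ∀ s, 0 ≤ s → 0 < f s)
    (hp : ∀ s, 0 ≤ s → HasDerivAt p (f s ^ d) s) {κ : ℝ} (hκ : 0 < κ)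
    (hgrow : ∀ s, 0 ≤ s → s ^ (d + 1) * (κ ^ d / (d + 1)) ≤ p s) {t : ℝ} (ht : 0 ≤ t) :
    f 0 + t * κ ≤ f t := by
  by_contra! hlt
  have ht0 : 0 < t := by
    rcases ht.eq_or_lt with rfl | h
    · simp at hlt
    · exact h
  set κ' := (f t - f 0) / t with hκ'
  have hκ'lt : κ' < κ := by rw [hκ', div_lt_iff₀ ht0]; linarith
  obtain ⟨κ₂, h1, h2⟩ := exists_between (max_lt hκ'lt hκ)
  have hκ₂ : 0 < κ₂ := lt_of_le_of_lt (le_max_right _ _) h1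
  have hκ₂' : κ' < κ₂ := lt_of_le_of_lt (le_max_left _ _) h1
  have hf0 := hpos 0 le_rfl
  have hline : ∀ s, t < s → f s ≤ f 0 + κ₂ * s := by
    intro s hs
    have hs0 := ht0.trans hs
    have := hf.slope_anti_adjacent (mem_Ici.2 le_rfl) (mem_Ici.2 hs0.le) ht0 hs
    rw [sub_zero, ← hκ', div_le_iff₀ (by linarith)] at this
    have e : f t = f 0 + κ' * t := by rw [hκ']; field_simp; ring
    nlinarith
  have hd1 : (0:ℝ) < d + 1 := by positivity
  set H : ℝ → ℝ := fun s => (f 0 + κ₂ * s) ^ (d + 1) / ((d + 1) * κ₂) with hH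
  have hHd : ∀ s, HasDerivAt H ((f 0 + κ₂ * s) ^ d) s := by
    intro s
    have := ((((hasDerivAt_id s).const_mul κ₂).const_add (f 0)).fun_pow (d + 1)).div_const
      ((d + 1) * κ₂)
    refine this.congr_deriv ?_
    simp only [id, Nat.add_sub_cancel, Nat.cast_add, Nat.cast_one]
    field_simp
  have hanti : AntitoneOn (fun s => p s - H s) (Ici t) := by
    have hder : ∀ s, 0 ≤ s → HasDerivAt (fun s => p s - H s) (f s ^ d - (f 0 + κ₂ * s) ^ d) s :=
      fun s hs => (hp s hs).fun_sub (hHd s)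
    refine antitoneOn_of_deriv_nonpos (convex_Ici t)
      (fun s hs => (hder s (ht0.le.trans hs)).continuousAt.continuousWithinAt)
      (fun s hs => ?_) (fun s hs => ?_)
    · rw [interior_Ici] at hs
      exact (hder s (ht0.le.trans hs.le)).differentiableAt.differentiableWithinAt
    · rw [interior_Ici] at hs
      rw [(hder s (ht0.le.trans hs.le)).deriv]
      have := pow_le_pow_left₀ (hpos s (ht0.le.trans hs.le)).le (hline s hs) d
      linarith
  have hfin : ∀ s, t ≤ s → κ ^ d / (d + 1) ≤
      (p t - H t) * (s⁻¹) ^ (d + 1) + (f 0 * s⁻¹ + κ₂) ^ (d + 1) / ((d + 1) * κ₂) := by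
    intro s hs
    have hs0 : 0 < s := ht0.trans_le hs
    have h3 := hanti (mem_Ici.2 le_rfl) (mem_Ici.2 hs) hs
    have h4 := hgrow s hs0.le
    simp only at h3
    have e : (f 0 * s⁻¹ + κ₂) ^ (d + 1) = (f 0 + κ₂ * s) ^ (d + 1) * (s⁻¹) ^ (d + 1) := by
      rw [← mul_pow]; congr 1; field_simp
    rw [e, mul_div_right_comm]
    change _ ≤ _ + H s * _
    rw [← add_mul]
    have h5 : s ^ (d + 1) * (κ ^ d / (d + 1)) ≤ p t - H t + H s := by linarith
    have h6 := mul_le_mul_of_nonneg_right h5 (by positivity : 0 ≤ (s⁻¹) ^ (d + 1))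
    refine le_trans (le_of_eq ?_) h6
    rw [inv_pow]; field_simp
  have hlim : Filter.Tendsto (fun s : ℝ => (p t - H t) * (s⁻¹) ^ (d + 1) +
      (f 0 * s⁻¹ + κ₂) ^ (d + 1) / ((d + 1) * κ₂)) Filter.atTop
      (nhds ((p t - H t) * 0 ^ (d + 1) + (f 0 * 0 + κ₂) ^ (d + 1) / ((d + 1) * κ₂))) := by
    have hi : Filter.Tendsto (fun s : ℝ => s⁻¹) Filter.atTop (nhds 0) := tendsto_inv_atTop_zero
    exact ((hi.pow _).const_mul _).add ((((hi.const_mul _).add_const _).pow _).div_const _)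
  have hle := ge_of_tendsto hlim (Filter.eventually_atTop.2 ⟨t, hfin⟩)
  rw [zero_pow (by omega), mul_zero, mul_zero, zero_add, zero_add, pow_succ,
    mul_div_mul_right _ _ hκ₂.ne', div_le_div_iff_of_pos_right hd1] at hle
  exact absurd hle (not_le.2 (pow_lt_pow_left₀ h2 hκ₂.le (by omega)))

section Volume

variable {E : Type*} [NormedAddCommGroup E] [NormedSpace ℝ E] [FiniteDimensional ℝ E]
  [MeasurableSpace E] [BorelSpace E] (μ : Measure E) [μ.IsAddHaarMeasure]
  {ι : Type*} [Fintype ι] {K : Set E} {u : ι → E}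

theorem smul_zonotope_one (u : ι → E) {s : ℝ} (hs : 0 < s) :
    s • zonotope u 1 = zonotope u (s • 1) := by
  ext z
  simp only [mem_smul_set, zonotope, mem_ofPred_eq, Pi.smul_apply, Pi.one_apply, smul_eq_mul,
    mul_one]
  constructor
  · rintro ⟨_, ⟨c, hc, rfl⟩, rfl⟩
    refine ⟨fun i => s * c i, fun i => ?_, by simp [Finset.smul_sum, smul_smul]⟩
    rw [abs_mul, abs_of_pos hs]
    nlinarith [hc i]
  · rintro ⟨c, hc, rfl⟩
    refine ⟨_, ⟨fun i => s⁻¹ * c i, fun i => ?_, rfl⟩, ?_⟩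
    · rw [abs_mul, abs_of_pos (by positivity), inv_mul_le_iff₀ hs]
      simpa using hc i
    · simp [Finset.smul_sum, smul_smul, ne_of_gt hs]

/-- The Minkowski inequality for the surface area: with `p s = μ (K + s Z)` the function
`p' ^ (1/d)` grows at least linearly with slope `((d + 1) μ Z) ^ (1/d)`. -/
theorem IsConvexBody.exists_hasDerivAt_volume (hK : IsConvexBody K) (hu : ∀ i, u i ≠ 0)
    (hspan : Submodule.span ℝ (range u) = ⊤) {d : ℕ} (hd : 1 ≤ d)
    (hE : Module.finrank ℝ E = d + 1) (hZ : 0 < μ.real (zonotope u 1)) :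
    ∃ p r : ℝ → ℝ, (∀ s, 0 ≤ s → p s = μ.real (K + zonotope u (s • 1))) ∧
      (∀ s, HasDerivAt p (r s) s) ∧ (∀ s, 0 ≤ s → 0 < r s) ∧ MonotoneOn r (Ici 0) ∧
      ∀ t, 0 ≤ t → r 0 ^ (1 / d : ℝ) + t * ((d + 1) * μ.real (zonotope u 1)) ^ (1 / d : ℝ) ≤
        r t ^ (1 / d : ℝ) := by
  classical
  obtain ⟨P, hP⟩ := hK.exists_volumePolynomial μ u
  have hd0 : (0:ℝ) < d := by exact_mod_cast hd
  have hι : Nonempty ι := by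
    by_contra hne
    rw [not_nonempty_iff] at hne
    have h1 : Submodule.span ℝ (range u) = ⊥ := by simp
    have h2 : Module.finrank ℝ (⊤ : Submodule ℝ E) = 0 := by rw [← hspan, h1]; simp
    rw [finrank_top] at h2
    omega
  let one : ι → ℝ := 1
  let p0 : ℝ → ℝ := fun s => MvPolynomial.eval (s • one) P
  let r : ℝ → ℝ := fun s => ∑ i, MvPolynomial.eval (s • one) (MvPolynomial.pderiv i P)
  let r1 : ℝ → ℝ := fun s => ∑ i, ∑ j,
    MvPolynomial.eval (s • one) (MvPolynomial.pderiv j (MvPolynomial.pderiv i P))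
  let r2 : ℝ → ℝ := fun s => ∑ i, ∑ j, ∑ k, MvPolynomial.eval (s • one)
    (MvPolynomial.pderiv k (MvPolynomial.pderiv j (MvPolynomial.pderiv i P)))
  have hder : ∀ (Q : MvPolynomial ι ℝ) (s : ℝ), HasDerivAt (fun s => MvPolynomial.eval (s • one) Q)
      (∑ j, MvPolynomial.eval (s • one) (MvPolynomial.pderiv j Q)) s := by
    intro Q s
    have := MvPolynomial.hasDerivAt_eval_line Q 0 one s
    simpa [one] using this
  have hp : ∀ s, HasDerivAt p0 (r s) s := fun s => hder P s
  have hr : ∀ s, HasDerivAt r (r1 s) s := fun s => HasDerivAt.fun_sum fun i _ => hder _ s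
  have hr1 : ∀ s, HasDerivAt r1 (r2 s) s := fun s =>
    HasDerivAt.fun_sum fun i _ => HasDerivAt.fun_sum fun j _ => hder _ s
  have hs0 : ∀ s : ℝ, 0 ≤ s → 0 ≤ s • one := fun s hs i => by simpa [one] using hs
  have hpos : ∀ s, 0 ≤ s → 0 < r s := fun s hs =>
    Finset.sum_pos (fun i _ => hP.pderiv_pos μ hK (hu i) (hs0 s hs)) Finset.univ_nonempty
  have hconc := concaveOn_rpow_of_mul_le hd0 hr hr1 hpos fun s hs =>
    hP.mul_sum_third_le μ hK hu hspan hd hE fun i => by simpa [one] using hs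
  refine ⟨p0, r, fun s hs => hP _ (hs0 s hs), hp, hpos, ?_, fun t ht => ?_⟩
  · refine monotoneOn_of_deriv_nonneg (convex_Ici 0)
      (fun s _ => (hr s).continuousAt.continuousWithinAt)
      (fun s _ => (hr s).differentiableAt.differentiableWithinAt) fun s hs => ?_
    rw [interior_Ici] at hs
    rw [(hr s).deriv]
    exact Finset.sum_nonneg fun i _ => Finset.sum_nonneg fun j _ =>
      hP.pderiv_pderiv_nonneg μ hK i j (hs0 s hs.le)
  · have hpw : ∀ x : ℝ, 0 ≤ x → (x ^ (1 / d : ℝ)) ^ d = x := by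
      intro x hx
      rw [← Real.rpow_natCast, ← Real.rpow_mul hx]
      simp [hd0.ne']
    refine hconc.add_mul_le_of_growth (p := p0) hd
      (fun s hs => Real.rpow_pos_of_pos (hpos s hs) _)
      (fun s hs => by rw [hpw _ (hpos s hs).le]; exact hp s) (by positivity) (fun s hs => ?_) ht
    rw [hpw _ (by positivity)]
    rw [show p0 s = _ from hP _ (hs0 s hs)]
    rcases hs.eq_or_lt with rfl | hs
    · simp
    obtain ⟨k, hk⟩ := hK.nonempty
    have h1 : k +ᵥ (s • zonotope u 1) ⊆ K + zonotope u (s • one) := by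
      rw [smul_zonotope_one u hs]
      rintro _ ⟨z, hz, rfl⟩
      exact ⟨k, hk, z, hz, rfl⟩
    have h2 := measureReal_mono h1 ((hK.add_zonotope u (hs0 s hs.le)).measure_ne_top μ)
    refine le_trans (le_of_eq ?_) h2
    rw [measureReal_def μ (k +ᵥ _), measure_vadd, Measure.addHaar_smul, hE, ENNReal.toReal_mul,
      ENNReal.toReal_ofReal (by positivity), abs_of_pos (by positivity), ← measureReal_def]
    field_simp

end Volume

/-- The set `F + J a`. -/
def prism {E : Type*} [AddCommGroup E] [Module ℝ E] (F : Set E) (a : E) (J : Set ℝ) : Set E :=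
  (fun q : E × ℝ => q.1 + q.2 • a) '' (F ×ˢ J)

theorem exists_orthogonal_coordinates {d : ℕ} {a : EuclideanSpace ℝ (Fin (d + 1))}
    (ha : ‖a‖ = 1) :
    ∃ (φ : EuclideanSpace ℝ (Fin d) →ₗᵢ[ℝ] EuclideanSpace ℝ (Fin (d + 1)))
      (Ψ : (EuclideanSpace ℝ (Fin d) × ℝ) ≃L[ℝ] EuclideanSpace ℝ (Fin (d + 1))),
      (∀ x, inner ℝ a x = 0 → ∃ w, φ w = x) ∧ (∀ w t, Ψ (w, t) = φ w + t • a) ∧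
      ∀ w t, ‖Ψ (w, t)‖ ^ 2 = ‖w‖ ^ 2 + t ^ 2 := by
  have ha0 : a ≠ 0 := by rintro rfl; simp at ha
  have : Fact (Module.finrank ℝ (EuclideanSpace ℝ (Fin (d + 1))) = d + 1) := ⟨by simp⟩
  let e := (OrthonormalBasis.fromOrthogonalSpanSingleton (𝕜 := ℝ) d ha0).repr
  let φ : EuclideanSpace ℝ (Fin d) →ₗᵢ[ℝ] EuclideanSpace ℝ (Fin (d + 1)) :=
    (Submodule.subtypeₗᵢ _).comp e.symm.toLinearIsometry
  have horth : ∀ w, inner ℝ a (φ w) = 0 := fun w =>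
    Submodule.mem_orthogonal_singleton_iff_inner_right.1 (e.symm w).2
  let L : (EuclideanSpace ℝ (Fin d) × ℝ) →ₗ[ℝ] EuclideanSpace ℝ (Fin (d + 1)) :=
    φ.toLinearMap.coprod (LinearMap.toSpanSingleton ℝ _ a)
  have hL : ∀ w t, L (w, t) = φ w + t • a := fun w t => by simp [L]
  have hnorm : ∀ w t, ‖L (w, t)‖ ^ 2 = ‖w‖ ^ 2 + t ^ 2 := by
    intro w t
    rw [hL, norm_add_sq_real, inner_smul_right, real_inner_comm, horth, norm_smul, ha, φ.norm_map]
    simp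
  have hinj : Function.Injective L := by
    rw [← LinearMap.ker_eq_bot, LinearMap.ker_eq_bot']
    rintro ⟨w, t⟩ h
    have := hnorm w t
    rw [h, norm_zero] at this
    have h1 : ‖w‖ = 0 := by nlinarith [sq_nonneg t, sq_nonneg ‖w‖]
    have h2 : t = 0 := by nlinarith [sq_nonneg t, sq_nonneg ‖w‖]
    simp [norm_eq_zero.1 h1, h2]
  let Ψ := (L.linearEquivOfInjective hinj (by simp)).toContinuousLinearEquiv
  refine ⟨φ, Ψ, fun x hx => ?_, hL, hnorm⟩
  refine ⟨e ⟨x, Submodule.mem_orthogonal_singleton_iff_inner_right.2 hx⟩, ?_⟩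
  simp [φ]

theorem exists_hausdorff_prism_const (d : ℕ) : ∃ c : ℝ≥0∞, c ≠ 0 ∧ c ≠ ∞ ∧
    ∀ a : EuclideanSpace ℝ (Fin (d + 1)), ‖a‖ = 1 → ∀ (b : ℝ)
      (F : Set (EuclideanSpace ℝ (Fin (d + 1)))), MeasurableSet F → (∀ y ∈ F, inner ℝ a y = b) →
      ∀ J : Set ℝ, MeasurableSet J → MeasurableSet (prism F a J) ∧
        c * volume (prism F a J) = μH[(d : ℝ)] F * volume J := by
  have hH : (μH[(d : ℝ)] : Measure (EuclideanSpace ℝ (Fin d))).IsAddHaarMeasure := by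
    simpa using MeasureTheory.isAddHaarMeasure_hausdorffMeasure (E := EuclideanSpace ℝ (Fin d))
  let m : Measure (EuclideanSpace ℝ (Fin d) × ℝ) := (μH[(d : ℝ)]).prod volume
  let D : Set (EuclideanSpace ℝ (Fin d) × ℝ) := {q | ‖q.1‖ ^ 2 + q.2 ^ 2 < 1}
  have hDo : IsOpen D := isOpen_lt (by fun_prop) continuous_const
  have hDb : IsBounded D := by
    refine isBounded_ball.subset (t := ball 0 1) fun q hq => ?_
    have hq' : ‖q.1‖ ^ 2 + q.2 ^ 2 < 1 := hq
    rw [mem_ball_zero_iff, Prod.norm_def, max_lt_iff]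
    constructor
    · nlinarith [sq_nonneg q.2, norm_nonneg q.1]
    · rw [Real.norm_eq_abs, abs_lt]
      constructor <;> nlinarith [sq_nonneg ‖q.1‖]
  have hD0 : m D ≠ 0 := (hDo.measure_pos m ⟨0, by simp [D]⟩).ne'
  have hDt : m D ≠ ∞ := hDb.measure_lt_top.ne
  let V := volume (ball (0 : EuclideanSpace ℝ (Fin (d + 1))) 1)
  have hV0 : V ≠ 0 := (measure_ball_pos _ _ one_pos).ne'
  have hVt : V ≠ ∞ := measure_ball_lt_top.ne
  refine ⟨m D / V, (ENNReal.div_pos hD0 hVt).ne', ENNReal.div_ne_top hDt hV0, ?_⟩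
  intro a ha b F hF hFb J hJ
  obtain ⟨φ, Ψ, hφ, hΨ, hnorm⟩ := exists_orthogonal_coordinates ha
  have : (m.map Ψ).IsAddHaarMeasure := Ψ.isAddHaarMeasure_map m
  have hsmul := Measure.isAddLeftInvariant_eq_smul (m.map Ψ) volume
  set c := Measure.addHaarScalarFactor (m.map Ψ) volume
  have hmeas : ∀ S : Set (EuclideanSpace ℝ (Fin d) × ℝ), m S = c * volume (Ψ '' S) := by
    intro S
    have h1 : m.map Ψ (Ψ '' S) = m S := by
      have h2 := (Ψ.toHomeomorph.measurableEmbedding).map_apply m (Ψ '' S)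
      rw [ContinuousLinearEquiv.coe_toHomeomorph, preimage_image_eq _ Ψ.injective] at h2
      exact h2
    rw [← h1, hsmul]
    rfl
  have hc : (c : ℝ≥0∞) = m D / V := by
    rw [hmeas D]
    have : Ψ '' D = ball 0 1 := by
      ext x
      constructor
      · rintro ⟨⟨w, t⟩, hq, rfl⟩
        rw [mem_ball_zero_iff, ← sq_lt_one_iff₀ (norm_nonneg _), hnorm]
        exact hq
      · intro hx
        obtain ⟨⟨w, t⟩, rfl⟩ := Ψ.surjective x
        rw [mem_ball_zero_iff, ← sq_lt_one_iff₀ (norm_nonneg _), hnorm] at hx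
        exact ⟨(w, t), hx, rfl⟩
    rw [this, ENNReal.mul_div_cancel_right hV0 hVt]
  let W : Set (EuclideanSpace ℝ (Fin d)) := (fun w => b • a + φ w) ⁻¹' F
  have hiso : Isometry (fun w => b • a + φ w) := (IsometryEquiv.addLeft (b • a)).isometry.comp φ.isometry
  have hW : MeasurableSet W := hF.preimage hiso.continuous.measurable
  have haa : inner ℝ a a = (1:ℝ) := by rw [real_inner_self_eq_norm_sq, ha]; norm_num
  have hWF : (fun w => b • a + φ w) '' W = F := by
    refine image_preimage_eq_of_subset fun y hy => ?_
    obtain ⟨w, hw⟩ := hφ (y - b • a) (by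
      rw [inner_sub_right, inner_smul_right, hFb y hy, haa]; ring)
    exact ⟨w, by simp [hw]⟩
  have hpr : prism F a J = (b • a) +ᵥ (Ψ '' (W ×ˢ J)) := by
    rw [← hWF]
    ext x
    simp only [prism, mem_image, mem_prod, Prod.exists, mem_vadd_set, vadd_eq_add]
    constructor
    · rintro ⟨_, t, ⟨⟨w, hw, rfl⟩, ht⟩, rfl⟩
      exact ⟨_, ⟨w, t, ⟨hw, ht⟩, rfl⟩, by rw [hΨ]; abel⟩
    · rintro ⟨_, ⟨w, t, ⟨hw, ht⟩, rfl⟩, rfl⟩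
      exact ⟨_, t, ⟨⟨w, hw, rfl⟩, ht⟩, by rw [hΨ]; abel⟩
  rw [hpr]
  refine ⟨MeasurableSet.const_vadd
    ((Ψ.toHomeomorph.measurableEmbedding).measurableSet_image.2 (hW.prod hJ)) _, ?_⟩
  rw [measure_vadd, ← hc, ← hmeas, Measure.prod_prod, ← hWF,
    hiso.hausdorffMeasure_image (Or.inl d.cast_nonneg)]

theorem hausdorffMeasure_le_of_expanding {X Y : Type*} [MetricSpace X] [MeasurableSpace X]
    [BorelSpace X] [MetricSpace Y] [MeasurableSpace Y] [BorelSpace Y] {d : ℝ} (hd : 0 ≤ d)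
    {G : Set X} {S : Set Y} (z : G → Y) (hz : ∀ y, z y ∈ S)
    (h : ∀ y y', dist y y' ≤ dist (z y) (z y')) : μH[d] G ≤ μH[d] S := by
  have h1 : AntilipschitzWith 1 z := AntilipschitzWith.of_le_mul_dist fun y y' => by
    simpa using h y y'
  have h2 := h1.le_hausdorffMeasure_image hd univ
  have h3 := isometry_subtype_coe (s := G).hausdorffMeasure_image (Or.inl hd) univ
  rw [image_univ, Subtype.range_coe] at h3
  rw [h3]
  refine h2.trans ?_
  simp only [ENNReal.coe_one, ENNReal.one_rpow, one_mul]
  exact measure_mono (by rintro _ ⟨y, -, rfl⟩; exact hz y)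

/-- Pushing points along outward normals expands distances. -/
theorem hausdorffMeasure_le_frontier_of_normals {E : Type*} [NormedAddCommGroup E]
    [InnerProductSpace ℝ E] [MeasurableSpace E] [BorelSpace E] {d : ℝ} (hd : 0 ≤ d)
    {G W : Set E} (hW : IsBounded W) (hG : G ⊆ closure W)
    (h : ∀ y ∈ G, ∃ a : E, a ≠ 0 ∧ ∀ y' ∈ G, inner ℝ a (y' - y) ≤ 0) :
    μH[d] G ≤ μH[d] (frontier W) := by
  have hex : ∀ y : G, ∃ z : E, z ∈ frontier W ∧ ∀ y' ∈ G, inner ℝ (z - y) (y' - y) ≤ 0 := by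
    intro y
    obtain ⟨a, ha, hay⟩ := h y y.2
    by_contra! hne
    have hray : ∀ s : ℝ, 0 ≤ s → y.1 + s • a ∉ frontier W := by
      intro s hs hmem
      obtain ⟨y', hy', hpos⟩ := hne _ hmem
      rw [add_sub_cancel_left, inner_smul_left] at hpos
      have := mul_nonpos_of_nonneg_of_nonpos hs (hay y' hy')
      simp at hpos
      linarith
    let γ : ℝ → E := fun s => y.1 + s • a
    have hγ : Continuous γ := by fun_prop
    have hpre : IsPreconnected (γ '' Ici 0) :=
      isPreconnected_Ici.image _ hγ.continuousOn
    have hsub : γ '' Ici 0 ⊆ interior W ∪ (closure W)ᶜ := by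
      rintro _ ⟨s, hs, rfl⟩
      by_contra hcon
      rw [mem_union, not_or, mem_compl_iff, not_not] at hcon
      exact hray s hs ⟨hcon.2, hcon.1⟩
    have h0 : y.1 ∈ γ '' Ici 0 := ⟨0, mem_Ici.2 le_rfl, by simp [γ]⟩
    have h0' : y.1 ∈ interior W := by
      rcases hsub h0 with h | h
      · exact h
      · exact absurd (hG y.2) h
    have hall : γ '' Ici 0 ⊆ interior W :=
      hpre.subset_left_of_subset_union isOpen_interior isClosed_closure.isOpen_compl
        (disjoint_left.2 fun x hx hx' => hx' (subset_closure (interior_subset hx))) hsub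
        ⟨_, h0, h0'⟩
    obtain ⟨r, hr⟩ := (hW.subset (hall.trans interior_subset)).subset_closedBall 0
    have ha' : 0 < ‖a‖ := norm_pos_iff.2 ha
    have hs0 : 0 ≤ (|r| + ‖y.1‖ + 1) / ‖a‖ := by positivity
    have := hr ⟨_, mem_Ici.2 hs0, rfl⟩
    rw [mem_closedBall_zero_iff] at this
    have h3 : ‖((|r| + ‖y.1‖ + 1) / ‖a‖) • a‖ = |r| + ‖y.1‖ + 1 := by
      rw [norm_smul, Real.norm_eq_abs, abs_of_nonneg hs0]; field_simp
    have h4 := norm_sub_le (y.1 + ((|r| + ‖y.1‖ + 1) / ‖a‖) • a) y.1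
    rw [add_sub_cancel_left, h3] at h4
    have := le_abs_self r
    simp only [γ] at *
    linarith
  choose z hz1 hz2 using hex
  refine hausdorffMeasure_le_of_expanding hd z hz1 fun y y' => ?_
  rw [Subtype.dist_eq, dist_eq_norm, dist_eq_norm]
  have h1 := hz2 y y' y'.2
  have h2 := hz2 y' y y.2
  rw [← sq_le_sq₀ (norm_nonneg _) (norm_nonneg _)]
  have e : z y - z y' = (y.1 - y'.1) + ((z y - y.1) - (z y' - y'.1)) := by abel
  rw [e, norm_add_sq_real]
  have h3 : inner ℝ (y.1 - y'.1) ((z y - y.1) - (z y' - y'.1)) =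
      -inner ℝ (z y - y.1) (y'.1 - y.1) - inner ℝ (z y' - y'.1) (y.1 - y'.1) := by
    rw [inner_sub_right, real_inner_comm (z y - y.1), real_inner_comm (z y' - y'.1),
      ← neg_sub y.1 y'.1, inner_neg_right]
    ring
  rw [h3]
  nlinarith [sq_nonneg ‖(z y - y.1) - (z y' - y'.1)‖]

section Polytope

variable {E : Type*} [NormedAddCommGroup E] [InnerProductSpace ℝ E]

/-- The open polytope of the points satisfying the strict inequalities `⟪a, x⟫ < b` for
`(a, b) ∈ s`. -/
def polytope (s : Finset (E × ℝ)) : Set E := {x | ∀ q ∈ s, inner ℝ q.1 x < q.2}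

/-- The face of `polytope s` with normal `q.1`. -/
def facet (s : Finset (E × ℝ)) (q : E × ℝ) : Set E :=
  {y | inner ℝ q.1 y = q.2 ∧ ∀ a ∈ s, inner ℝ a.1 y ≤ a.2}

/-- The relatively open face of `polytope s` with normal `q.1`. -/
def openFacet (s : Finset (E × ℝ)) (q : E × ℝ) : Set E :=
  {y | inner ℝ q.1 y = q.2 ∧ ∀ a ∈ s, a ≠ q → inner ℝ a.1 y < a.2}

/-- The set of the points whose distance to the complement of `K` is greater than `ε`. -/
def innerPar {X : Type*} [PseudoMetricSpace X] (K : Set X) (ε : ℝ) : Set X :=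
  {x | closedBall x ε ⊆ K}

theorem innerPar_mono {X : Type*} [PseudoMetricSpace X] {K L : Set X} (h : K ⊆ L) (ε : ℝ) :
    innerPar K ε ⊆ innerPar L ε := fun _ hx => Subset.trans hx h

theorem innerPar_subset {X : Type*} [PseudoMetricSpace X] {K : Set X} {ε : ℝ} (hε : 0 ≤ ε) :
    innerPar K ε ⊆ K := fun _ hx => hx (mem_closedBall_self hε)

theorem convex_polytope (s : Finset (E × ℝ)) : Convex ℝ (polytope s) := by
  have : polytope s = ⋂ q ∈ s, {x | innerSL ℝ q.1 x < q.2} := by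
    ext x; simp [polytope]
  rw [this]
  exact convex_iInter₂ fun q _ => convex_halfSpace_lt (innerSL ℝ q.1).isLinear _

theorem isOpen_polytope (s : Finset (E × ℝ)) : IsOpen (polytope s) := by
  have : polytope s = ⋂ q ∈ s, {x | innerSL ℝ q.1 x < q.2} := by
    ext x; simp [polytope]
  rw [this]
  exact isOpen_biInter_finset fun q _ => isOpen_lt (innerSL ℝ q.1).continuous continuous_const

theorem isClosed_facet (s : Finset (E × ℝ)) (q : E × ℝ) : IsClosed (facet s q) := by
  have : facet s q = {x | innerSL ℝ q.1 x = q.2} ∩ ⋂ q ∈ s, {x | innerSL ℝ q.1 x ≤ q.2} := by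
    ext x; simp [facet]
  rw [this]
  exact (isClosed_eq (innerSL ℝ q.1).continuous continuous_const).inter
    (isClosed_biInter fun q _ => isClosed_le (innerSL ℝ q.1).continuous continuous_const)

theorem openFacet_subset_facet {s : Finset (E × ℝ)} (q : E × ℝ) :
    openFacet s q ⊆ facet s q := fun y hy => ⟨hy.1, fun q' h => by
  by_cases e : q' = q
  · rw [e]; exact hy.1.le
  · exact (hy.2 q' h e).le⟩

theorem measurableSet_openFacet [MeasurableSpace E] [BorelSpace E] (s : Finset (E × ℝ))
    (q : E × ℝ) : MeasurableSet (openFacet s q) := by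
  classical
  have : openFacet s q = {x | innerSL ℝ q.1 x = q.2} ∩ polytope (s.erase q) := by
    ext x
    simp only [openFacet, polytope, Finset.mem_erase, ne_eq, mem_inter_iff, mem_ofPred_eq,
      innerSL_apply_apply]
    grind
  rw [this]
  exact (isClosed_eq (innerSL ℝ q.1).continuous continuous_const).measurableSet.inter
    (isOpen_polytope _).measurableSet

theorem frontier_polytope_subset (s : Finset (E × ℝ)) :
    frontier (polytope s) ⊆ ⋃ q ∈ s, facet s q := by
  intro x hx
  have hcl : ∀ q ∈ s, inner ℝ q.1 x ≤ q.2 := by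
    intro q hq
    have : closure (polytope s) ⊆ {x | innerSL ℝ q.1 x ≤ q.2} :=
      closure_minimal (fun y hy => (hy q hq).le)
        (isClosed_le (innerSL ℝ q.1).continuous continuous_const)
    exact this hx.1
  have hn : x ∉ polytope s := by
    have := hx.2
    rwa [(isOpen_polytope s).interior_eq] at this
  simp only [polytope, mem_ofPred_eq, not_forall, not_lt] at hn
  obtain ⟨q, hq, h⟩ := hn
  exact mem_biUnion hq ⟨le_antisymm (hcl q hq) h, hcl⟩

theorem exists_polytope_between [CompleteSpace E] {C L : Set E} (hC : IsCompact C)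
    (hCc : Convex ℝ C) (hCn : C.Nonempty) (hL : IsOpen L) (hLf : IsCompact (frontier L))
    (hCL : C ⊆ L) :
    ∃ s : Finset (E × ℝ), (∀ q ∈ s, ‖q.1‖ = 1) ∧ C ⊆ polytope s ∧ polytope s ⊆ L := by
  classical
  have hsep : ∀ y : frontier L, ∃ q : E × ℝ, ‖q.1‖ = 1 ∧ (∀ x ∈ C, inner ℝ q.1 x < q.2) ∧
      q.2 < inner ℝ q.1 (y : E) := by
    rintro ⟨y, hy⟩
    have hyC : y ∉ C := fun h => by
      have := hy.2
      rw [hL.interior_eq] at this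
      exact this (hCL h)
    obtain ⟨f, u, h1, h2⟩ := geometric_hahn_banach_closed_point hCc hC.isClosed hyC
    set w := (InnerProductSpace.toDual ℝ E).symm f with hw
    have hf : ∀ x, f x = inner ℝ w x := fun x => by
      rw [hw, InnerProductSpace.toDual_symm_apply]
    have hw0 : w ≠ 0 := by
      intro h
      obtain ⟨x, hx⟩ := hCn
      have := h1 x hx
      rw [hf, h, inner_zero_left] at this
      rw [hf, h, inner_zero_left] at h2
      linarith
    have hwp : 0 < ‖w‖ := norm_pos_iff.2 hw0
    refine ⟨(‖w‖⁻¹ • w, ‖w‖⁻¹ * u), ?_, fun x hx => ?_, ?_⟩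
    · simp [norm_smul, hwp.ne']
    · simp only [inner_smul_left, conj_trivial]
      rw [← hf]
      exact mul_lt_mul_of_pos_left (h1 x hx) (by positivity)
    · simp only [inner_smul_left, conj_trivial]
      rw [← hf]
      exact mul_lt_mul_of_pos_left h2 (by positivity)
  choose q hq1 hq2 hq3 using hsep
  obtain ⟨t, ht⟩ := hLf.elim_finite_subcover (fun y : frontier L => {x | (q y).2 <
    innerSL ℝ (q y).1 x}) (fun y => isOpen_lt continuous_const (innerSL ℝ _).continuous)
    (fun y hy => mem_iUnion.2 ⟨⟨y, hy⟩, hq3 ⟨y, hy⟩⟩)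
  have hCP : C ⊆ polytope (t.image q) := by
    intro x hx p hp
    obtain ⟨y, -, rfl⟩ := Finset.mem_image.1 hp
    exact hq2 y x hx
  refine ⟨t.image q, fun p hp => ?_, hCP, ?_⟩
  · obtain ⟨y, -, rfl⟩ := Finset.mem_image.1 hp
    exact hq1 y
  · refine (convex_polytope _).isPreconnected.subset_of_closure_inter_subset hL
      (hCn.mono fun x hx => ⟨hCP hx, hCL hx⟩) ?_
    rintro x ⟨hx1, hx2⟩
    by_contra hxL
    have hxf : x ∈ frontier L := ⟨hx1, by rwa [hL.interior_eq]⟩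
    obtain ⟨y, hy, h⟩ := mem_iUnion₂.1 (ht hxf)
    have := hx2 (q y) (Finset.mem_image_of_mem _ hy)
    have h' : (q y).2 < inner ℝ (q y).1 x := h
    linarith

theorem openFacet_subset_closure {s : Finset (E × ℝ)} (hs : ∀ q ∈ s, ‖q.1‖ = 1) {q : E × ℝ}
    (hq : q ∈ s) : openFacet s q ⊆ closure (polytope s) := by
  intro y hy
  have hlim : Filter.Tendsto (fun τ : ℝ => y - τ • q.1) (nhdsWithin 0 (Ioi 0)) (nhds y) := by
    have : Continuous fun τ : ℝ => y - τ • q.1 := by fun_prop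
    simpa using (this.tendsto 0).mono_left nhdsWithin_le_nhds
  refine mem_closure_of_tendsto hlim ?_
  simp only [polytope, mem_ofPred_eq]
  rw [Filter.eventually_all_finset]
  intro q' hq'
  by_cases e : q' = q
  · subst e
    filter_upwards [self_mem_nhdsWithin] with τ hτ
    rw [inner_sub_right, hy.1, inner_smul_right, real_inner_self_eq_norm_sq, hs _ hq]
    have : (0:ℝ) < τ := hτ
    linarith
  · have hc : Continuous fun x : E => inner ℝ q'.1 x := by fun_prop
    have h := (hc.tendsto y).comp hlim
    exact h.eventually (gt_mem_nhds (hy.2 q' hq' e))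

theorem inner_lt_one_of_ne {a b : E} (ha : ‖a‖ = 1) (hb : ‖b‖ = 1) (h : a ≠ b) :
    inner ℝ a b < 1 := by
  simpa using (inner_lt_one_iff_real_of_norm_eq_one ha hb).2 h

theorem diff_innerPar_subset_prism {s : Finset (E × ℝ)} (hs : ∀ q ∈ s, ‖q.1‖ = 1) (ε : ℝ) :
    polytope s \ innerPar (polytope s) ε ⊆
      ⋃ q ∈ s, prism (openFacet s q) q.1 (Ico (-ε) 0) := by
  rintro x ⟨hx, hxn⟩
  simp only [innerPar, mem_ofPred_eq, not_subset] at hxn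
  obtain ⟨z, hz, hzn⟩ := hxn
  simp only [polytope, mem_ofPred_eq, not_forall, not_lt] at hzn
  obtain ⟨q0, hq0, h0⟩ := hzn
  obtain ⟨q, hq, hmin⟩ := s.exists_min_image (fun q => q.2 - inner ℝ q.1 x) ⟨q0, hq0⟩
  have hsl : q0.2 - inner ℝ q0.1 x ≤ ε := by
    have h1 : inner ℝ q0.1 (z - x) ≤ ‖q0.1‖ * ‖z - x‖ := real_inner_le_norm _ _
    rw [hs _ hq0, one_mul, inner_sub_right] at h1
    have h2 : ‖z - x‖ ≤ ε := by rwa [mem_closedBall, dist_eq_norm] at hz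
    linarith
  refine mem_biUnion hq ⟨(x + (q.2 - inner ℝ q.1 x) • q.1, -(q.2 - inner ℝ q.1 x)), ⟨⟨?_, ?_⟩, ?_⟩,
    ?_⟩
  · simp only [inner_add_right, inner_smul_right, real_inner_self_eq_norm_sq, hs _ hq]
    ring
  · intro q' hq' hne
    simp only [inner_add_right, inner_smul_right]
    have h1 := hmin q' hq'
    have hpos : 0 < q.2 - inner ℝ q.1 x := sub_pos.2 (hx q hq)
    by_cases e : q'.1 = q.1
    · have : q'.2 ≠ q.2 := fun h => hne (Prod.ext e h)
      rw [e] at h1 ⊢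
      rw [real_inner_self_eq_norm_sq, hs _ hq]
      have : q.2 < q'.2 := lt_of_le_of_ne (by linarith) this.symm
      linarith
    · have := inner_lt_one_of_ne (hs _ hq') (hs _ hq) e
      nlinarith
  · have hpos : 0 < q.2 - inner ℝ q.1 x := sub_pos.2 (hx q hq)
    exact ⟨by linarith [hmin q0 hq0], by linarith⟩
  · simp only [add_assoc, ← add_smul]
    simp

theorem prism_facet_inter {s : Finset (E × ℝ)} (hs : ∀ q ∈ s, ‖q.1‖ = 1) {q q' : E × ℝ}
    (hq : q ∈ s) (hq' : q' ∈ s) {δ : ℝ} {x : E} (hx : x ∈ prism (facet s q) q.1 (Ioo 0 δ))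
    (hx' : x ∈ prism (facet s q') q'.1 (Ioo 0 δ)) : q = q' := by
  obtain ⟨⟨y, t⟩, ⟨hy, ht⟩, rfl⟩ := hx
  obtain ⟨⟨y', t'⟩, ⟨hy', ht'⟩, he⟩ := hx'
  simp only at hy ht hy' ht' he
  have h1 : inner ℝ q.1 (y' - y) ≤ 0 := by
    rw [inner_sub_right, hy.1]; linarith [hy'.2 q hq]
  have h2 : inner ℝ q'.1 (y - y') ≤ 0 := by
    rw [inner_sub_right, hy'.1]; linarith [hy.2 q' hq']
  have h3 : y - y' = t' • q'.1 - t • q.1 := by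
    rw [sub_eq_sub_iff_add_eq_add, ← he]; abel
  have h4 : inner ℝ (y - y') (y - y') ≤ 0 := by
    nth_rewrite 1 [h3]
    rw [inner_sub_left, inner_smul_left, inner_smul_left]
    have h1' : 0 ≤ inner ℝ q.1 (y - y') := by
      rw [← neg_sub, inner_neg_right]; linarith
    simp only [conj_trivial]
    nlinarith [ht.1, ht'.1]
  have hyy : y = y' := by
    rw [real_inner_self_eq_norm_sq] at h4
    have : ‖y - y'‖ = 0 := by nlinarith [sq_nonneg ‖y - y'‖]
    exact sub_eq_zero.1 (norm_eq_zero.1 this)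
  subst hyy
  have h5 : t' • q'.1 = t • q.1 := by
    rw [sub_self] at h3; exact sub_eq_zero.1 h3.symm
  have htt : t' = t := by
    have := congrArg norm h5
    rwa [norm_smul, norm_smul, hs _ hq, hs _ hq', Real.norm_of_nonneg ht.1.le,
      Real.norm_of_nonneg ht'.1.le, mul_one, mul_one] at this
  subst htt
  have ha : q'.1 = q.1 := smul_right_injective E ht'.1.ne' h5
  refine Prod.ext ha.symm ?_
  rw [← hy.1, ← hy'.1, ha]

end Polytope

theorem closure_innerPar_subset {X : Type*} [PseudoMetricSpace X] {K : Set X} {ε ε' : ℝ}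
    (h : ε' < ε) : closure (innerPar K ε) ⊆ innerPar K ε' := by
  intro x hx
  obtain ⟨y, hy, hxy⟩ := Metric.mem_closure_iff.1 hx (ε - ε') (by linarith)
  exact (closedBall_subset_closedBall' (by linarith)).trans hy

theorem innerPar_innerPar_subset {E : Type*} [NormedAddCommGroup E] [NormedSpace ℝ E]
    [ProperSpace E] {K : Set E}
    {t ε : ℝ} (ht : 0 ≤ t) (hε : 0 ≤ ε) : innerPar (innerPar K t) ε ⊆ innerPar K (t + ε) := by
  intro x hx z hz
  rw [add_comm, ← add_zero x, ← closedBall_add_closedBall hε ht] at hz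
  obtain ⟨y, hy, w, hw, rfl⟩ := hz
  exact hx hy (by simpa [dist_eq_norm] using hw)

theorem Convex.innerPar {E : Type*} [NormedAddCommGroup E] [NormedSpace ℝ E] {K : Set E}
    (hK : Convex ℝ K) (ε : ℝ) : Convex ℝ (innerPar K ε) := by
  intro x hx y hy a b ha hb hab z hz
  have h1 := hK (hx (show x + (z - (a • x + b • y)) ∈ closedBall x ε by
    simpa [dist_eq_norm] using hz)) (hy (show y + (z - (a • x + b • y)) ∈ closedBall y ε by
    simpa [dist_eq_norm] using hz)) ha hb hab
  convert h1 using 1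
  rw [smul_add, smul_add, add_add_add_comm, ← add_smul, hab, one_smul]
  abel

theorem iUnion_innerPar {X : Type*} [PseudoMetricSpace X] {K : Set X} (hK : IsOpen K) :
    ⋃ n : ℕ, innerPar K (1 / ((n : ℝ) + 1)) = K := by
  refine Subset.antisymm (iUnion_subset fun n => innerPar_subset (by positivity)) fun x hx => ?_
  obtain ⟨ε, hε, h⟩ := Metric.nhds_basis_closedBall.mem_iff.1 (hK.mem_nhds hx)
  obtain ⟨n, hn⟩ := exists_nat_one_div_lt hε
  exact mem_iUnion.2 ⟨n, (closedBall_subset_closedBall hn.le).trans h⟩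

theorem exists_innerPar_measure_gt {X : Type*} [PseudoMetricSpace X] [MeasurableSpace X]
    (μ : Measure X) {K : Set X} (hK : IsOpen K) {m : ℝ≥0∞} (hm : m < μ K) :
    ∃ ε > 0, m < μ (innerPar K ε) := by
  have hmono : Monotone fun n : ℕ => innerPar K (1 / ((n : ℝ) + 1)) := by
    intro i j hij x hx
    refine Subset.trans (closedBall_subset_closedBall ?_) hx
    have : (i : ℝ) ≤ j := by exact_mod_cast hij
    gcongr
  have h := tendsto_measure_iUnion_atTop (μ := μ) hmono
  rw [iUnion_innerPar hK] at h
  obtain ⟨n, hn⟩ := (h.eventually (lt_mem_nhds hm)).exists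
  exact ⟨_, by positivity, hn⟩

theorem IsConvexBody.exists_polytope_subset {E : Type*} [NormedAddCommGroup E]
    [InnerProductSpace ℝ E] [FiniteDimensional ℝ E] [MeasurableSpace E] (μ : Measure E)
    {K : Set E} (hK : IsConvexBody K) {m : ℝ≥0∞} (hm : m < μ K) :
    ∃ s : Finset (E × ℝ), (∀ q ∈ s, ‖q.1‖ = 1) ∧ (polytope s).Nonempty ∧ polytope s ⊆ K ∧
      m < μ (polytope s) := by
  obtain ⟨ε, hε, h⟩ := exists_innerPar_measure_gt μ hK.isOpen hm
  have hn : (innerPar K ε).Nonempty := nonempty_of_measure_ne_zero (pos_of_gt h).ne'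
  have hsub : closure (innerPar K ε) ⊆ K :=
    (closure_innerPar_subset hε).trans (innerPar_subset le_rfl)
  obtain ⟨s, hs, h1, h2⟩ := exists_polytope_between
    (isCompact_of_isClosed_isBounded isClosed_closure (hK.isBounded.subset hsub))
    (hK.convex.innerPar ε).closure hn.closure hK.isOpen
    (isCompact_of_isClosed_isBounded isClosed_frontier
      (hK.isBounded.closure.subset frontier_subset_closure)) hsub
  exact ⟨s, hs, hn.mono (subset_closure.trans h1), h2,
    h.trans_le (measure_mono (subset_closure.trans h1))⟩

theorem facet_subset_closure {E : Type*} [NormedAddCommGroup E] [InnerProductSpace ℝ E]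
    {s : Finset (E × ℝ)} (hn : (polytope s).Nonempty) (q : E × ℝ) :
    facet s q ⊆ closure (polytope s) := by
  obtain ⟨x, hx⟩ := hn
  intro y hy
  have hlim : Filter.Tendsto (fun τ : ℝ => y + τ • (x - y)) (nhdsWithin 0 (Ioo 0 1)) (nhds y) := by
    have : Continuous fun τ : ℝ => y + τ • (x - y) := by fun_prop
    simpa using (this.tendsto 0).mono_left nhdsWithin_le_nhds
  have : (nhdsWithin (0:ℝ) (Ioo 0 1)).NeBot := by
    rw [← mem_closure_iff_nhdsWithin_neBot, closure_Ioo (by norm_num)]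
    simp
  refine mem_closure_of_tendsto hlim ?_
  filter_upwards [self_mem_nhdsWithin] with τ hτ q' hq'
  have h1 := hx q' hq'
  have h2 := hy.2 q' hq'
  simp only [inner_add_right, inner_smul_right, inner_sub_right]
  nlinarith [hτ.1, hτ.2]

theorem prism_facet_subset {E : Type*} [NormedAddCommGroup E] [InnerProductSpace ℝ E]
    {s : Finset (E × ℝ)} (hn : (polytope s).Nonempty) {q : E × ℝ} (hq : ‖q.1‖ = 1) (δ : ℝ) :
    prism (facet s q) q.1 (Ioo 0 δ) ⊆ polytope s + ball 0 δ := by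
  rintro _ ⟨⟨y, t⟩, ⟨hy, ht⟩, rfl⟩
  obtain ⟨z, hz, hyz⟩ := Metric.mem_closure_iff.1 (facet_subset_closure hn q hy) (δ - t)
    (by linarith [ht.2])
  refine ⟨z, hz, y - z + t • q.1, ?_, by simp [← add_assoc]⟩
  rw [mem_ball_zero_iff]
  rw [dist_eq_norm] at hyz
  calc _ ≤ ‖y - z‖ + ‖t • q.1‖ := norm_add_le _ _
    _ = ‖y - z‖ + t := by rw [norm_smul, hq, Real.norm_of_nonneg ht.1.le, mul_one]
    _ < δ := by linarith

section Measure

variable {d : ℕ}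

/-- `c` is the constant relating the `d`-dimensional Hausdorff measure and the volume. -/
structure IsPrismConst (d : ℕ) (c : ℝ≥0∞) : Prop where
  ne_zero : c ≠ 0
  ne_top : c ≠ ∞
  measurableSet_and_eq : ∀ a : EuclideanSpace ℝ (Fin (d + 1)), ‖a‖ = 1 → ∀ (b : ℝ)
      (F : Set (EuclideanSpace ℝ (Fin (d + 1)))), MeasurableSet F → (∀ y ∈ F, inner ℝ a y = b) →
      ∀ J : Set ℝ, MeasurableSet J → MeasurableSet (prism F a J) ∧
        c * volume (prism F a J) = μH[(d : ℝ)] F * volume J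

theorem exists_isPrismConst (d : ℕ) : ∃ c, IsPrismConst d c := by
  obtain ⟨c, h0, h1, h2⟩ := exists_hausdorff_prism_const d
  exact ⟨c, h0, h1, h2⟩

variable {c : ℝ≥0∞} {s : Finset (EuclideanSpace ℝ (Fin (d + 1)) × ℝ)}

theorem IsPrismConst.volume_polytope_le (hc : IsPrismConst d c) (hs : ∀ q ∈ s, ‖q.1‖ = 1) (ε : ℝ) :
    c * volume (polytope s) ≤ c * volume (innerPar (polytope s) ε) +
      ENNReal.ofReal ε * ∑ q ∈ s, μH[(d : ℝ)] (openFacet s q) := by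
  calc c * volume (polytope s) ≤ c * (volume (innerPar (polytope s) ε) +
        ∑ q ∈ s, volume (prism (openFacet s q) q.1 (Ico (-ε) 0))) := by
        gcongr
        refine (measure_mono (t := innerPar (polytope s) ε ∪
          ⋃ q ∈ s, prism (openFacet s q) q.1 (Ico (-ε) 0)) fun x hx => ?_).trans
          ((measure_union_le _ _).trans (by gcongr; exact measure_biUnion_finset_le _ _))
        by_cases h : x ∈ innerPar (polytope s) ε
        · exact Or.inl h
        · exact Or.inr (diff_innerPar_subset_prism hs ε ⟨hx, h⟩)
    _ = _ := by
        rw [mul_add, Finset.mul_sum, Finset.mul_sum]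
        congr 1
        refine Finset.sum_congr rfl fun q hq => ?_
        rw [(hc.measurableSet_and_eq q.1 (hs q hq) q.2 _ (measurableSet_openFacet s q)
          (fun y hy => hy.1) _ measurableSet_Ico).2, Real.volume_Ico]
        simp [mul_comm]

theorem sum_openFacet_le (hs : ∀ q ∈ s, ‖q.1‖ = 1)
    {W : Set (EuclideanSpace ℝ (Fin (d + 1)))} (hW : IsBounded W)
    (h : polytope s ⊆ W) : ∑ q ∈ s, μH[(d : ℝ)] (openFacet s q) ≤ μH[(d : ℝ)] (frontier W) := by
  rw [← measure_biUnion_finset (fun q hq q' hq' hne => ?_)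
    (fun q _ => measurableSet_openFacet s q)]
  · refine hausdorffMeasure_le_frontier_of_normals (by positivity) hW
      (iUnion₂_subset fun q hq => (openFacet_subset_closure hs hq).trans (closure_mono h)) ?_
    intro y hy
    obtain ⟨q, hq, hy⟩ := mem_iUnion₂.1 hy
    refine ⟨q.1, norm_pos_iff.1 (by simp [hs q hq]), fun y' hy' => ?_⟩
    obtain ⟨q', hq', hy'⟩ := mem_iUnion₂.1 hy'
    rw [inner_sub_right, hy.1]
    linarith [(openFacet_subset_facet q' hy').2 q hq]
  · refine disjoint_left.2 fun y hy hy' => ?_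
    have := hy.2 q' hq' hne.symm
    linarith [hy'.1]

theorem IsPrismConst.volume_add_sum_facet_le (hc : IsPrismConst d c) (hs : ∀ q ∈ s, ‖q.1‖ = 1)
    (hn : (polytope s).Nonempty) {δ : ℝ} (hδ : 0 < δ) :
    c * volume (polytope s) + ENNReal.ofReal δ * ∑ q ∈ s, μH[(d : ℝ)] (facet s q) ≤
      c * volume (polytope s + ball 0 δ) := by
  have hp : ∀ q ∈ s, MeasurableSet (prism (facet s q) q.1 (Ioo 0 δ)) ∧
      c * volume (prism (facet s q) q.1 (Ioo 0 δ)) =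
        μH[(d : ℝ)] (facet s q) * volume (Ioo 0 δ) := fun q hq =>
    hc.measurableSet_and_eq q.1 (hs q hq) q.2 _ (isClosed_facet s q).measurableSet
      (fun y hy => hy.1) _ measurableSet_Ioo
  calc _ = c * (volume (polytope s) + ∑ q ∈ s, volume (prism (facet s q) q.1 (Ioo 0 δ))) := by
        rw [mul_add, Finset.mul_sum, Finset.mul_sum]
        congr 1
        refine Finset.sum_congr rfl fun q hq => ?_
        rw [(hp q hq).2, Real.volume_Ioo]
        simp [mul_comm]
    _ = c * volume (polytope s ∪ ⋃ q ∈ s, prism (facet s q) q.1 (Ioo 0 δ)) := by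
        rw [measure_union, measure_biUnion_finset]
        · intro q hq q' hq' hne
          refine disjoint_left.2 fun x hx hx' => hne (prism_facet_inter hs hq hq' hx hx')
        · exact fun q hq => (hp q hq).1
        · refine disjoint_left.2 fun x hx hx' => ?_
          obtain ⟨q, hq, ⟨y, t⟩, ⟨hy, ht⟩, rfl⟩ := mem_iUnion₂.1 hx'
          have := hx q hq
          simp only [inner_add_right, inner_smul_right, real_inner_self_eq_norm_sq,
            hs q hq] at this
          have h1 : inner ℝ q.1 y = q.2 := hy.1
          have h2 : 0 < t := ht.1
          linarith
        · exact s.measurableSet_biUnion fun q hq => (hp q hq).1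
    _ ≤ _ := by
        gcongr
        refine union_subset (fun x hx => ⟨x, hx, 0, by simpa using hδ, by simp⟩)
          (iUnion₂_subset fun q hq => prism_facet_subset hn (hs q hq) δ)

/-- The inner parallel set at distance `ε` loses at most `ε` times the surface area of any
surrounding set. -/
theorem IsPrismConst.volume_le_innerPar_add (hc : IsPrismConst d c)
    {L W : Set (EuclideanSpace ℝ (Fin (d + 1)))} (hL : IsConvexBody L)
    (hW : IsBounded W) (h : L ⊆ W) (ε : ℝ) :
    c * volume L ≤ c * volume (innerPar L ε) +
      ENNReal.ofReal ε * μH[(d : ℝ)] (frontier W) := by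
  rw [mul_comm, ← ENNReal.le_div_iff_mul_le (Or.inl hc.ne_zero) (Or.inl hc.ne_top)]
  refine le_of_forall_lt fun m hm => ?_
  obtain ⟨s, hs, hn, h1, h2⟩ := hL.exists_polytope_subset volume hm
  refine h2.trans_le ?_
  rw [ENNReal.le_div_iff_mul_le (Or.inl hc.ne_zero) (Or.inl hc.ne_top), mul_comm]
  refine (hc.volume_polytope_le hs ε).trans ?_
  gcongr
  · exact innerPar_mono h1 ε
  · exact sum_openFacet_le hs hW (h1.trans h)

/-- Inner volume differences are at most outer volume differences. -/
theorem IsConvexBody.volume_innerPar_add_le {K : Set (EuclideanSpace ℝ (Fin (d + 1)))}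
    (hK : IsConvexBody K) {δ ε : ℝ}
    (hδ : 0 < δ) :
    (ENNReal.ofReal δ + ENNReal.ofReal ε) * volume K ≤
      ENNReal.ofReal δ * volume (innerPar K ε) + ENNReal.ofReal ε * volume (K + ball 0 δ) := by
  obtain ⟨c, hc⟩ := exists_isPrismConst d
  have hA : ENNReal.ofReal δ + ENNReal.ofReal ε ≠ 0 := by simp [hδ]
  have hB : ENNReal.ofReal δ + ENNReal.ofReal ε ≠ ∞ := by simp
  rw [mul_comm, ← ENNReal.le_div_iff_mul_le (Or.inl hA) (Or.inl hB)]
  refine le_of_forall_lt fun m hm => ?_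
  obtain ⟨s, hs, hn, h1, h2⟩ := hK.exists_polytope_subset volume hm
  refine h2.trans_le ?_
  rw [ENNReal.le_div_iff_mul_le (Or.inl hA) (Or.inl hB), mul_comm]
  refine le_trans ?_ (add_le_add (mul_le_mul_right (measure_mono (innerPar_mono h1 ε)) _)
    (mul_le_mul_right (measure_mono (add_subset_add_right h1)) _))
  rw [← ENNReal.mul_le_mul_iff_right hc.ne_zero hc.ne_top]
  have e1 := hc.volume_polytope_le hs ε
  have e2 := hc.volume_add_sum_facet_le hs hn hδ
  have e3 : ∑ q ∈ s, μH[(d : ℝ)] (openFacet s q) ≤ ∑ q ∈ s, μH[(d : ℝ)] (facet s q) :=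
    Finset.sum_le_sum fun q _ => measure_mono (openFacet_subset_facet q)
  calc _ = ENNReal.ofReal δ * (c * volume (polytope s)) +
        ENNReal.ofReal ε * (c * volume (polytope s)) := by ring
    _ ≤ ENNReal.ofReal δ * (c * volume (innerPar (polytope s) ε) +
      ENNReal.ofReal ε * ∑ q ∈ s, μH[(d : ℝ)] (facet s q)) +
        ENNReal.ofReal ε * (c * volume (polytope s)) := by
        gcongr
        exact e1.trans (by gcongr)
    _ = ENNReal.ofReal δ * (c * volume (innerPar (polytope s) ε)) + ENNReal.ofReal ε *
      (c * volume (polytope s) + ENNReal.ofReal δ * ∑ q ∈ s, μH[(d : ℝ)] (facet s q)) := by ring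
    _ ≤ ENNReal.ofReal δ * (c * volume (innerPar (polytope s) ε)) + ENNReal.ofReal ε *
      (c * volume (polytope s + ball 0 δ)) := by gcongr
    _ = _ := by ring

end Measure

theorem hausdorffMeasure_sphere_le_frontier {E : Type*} [NormedAddCommGroup E]
    [InnerProductSpace ℝ E] [MeasurableSpace E] [BorelSpace E] {d : ℝ} (hd : 0 ≤ d) {R : ℝ}
    (hR : 0 < R) {W : Set E} (hW : IsBounded W) (h : sphere 0 R ⊆ closure W) :
    μH[d] (sphere (0 : E) R) ≤ μH[d] (frontier W) := by
  refine hausdorffMeasure_le_frontier_of_normals hd hW h fun y hy => ⟨y, ?_, fun y' hy' => ?_⟩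
  · rintro rfl
    simp at hy
    exact hR.ne hy
  · rw [mem_sphere_zero_iff_norm] at hy hy'
    have := real_inner_le_norm y y'
    rw [inner_sub_right, real_inner_self_eq_norm_sq, hy] at *
    rw [hy'] at this
    nlinarith

theorem polytope_add_ball_subset {E : Type*} [NormedAddCommGroup E]
    [InnerProductSpace ℝ E] {Q : Set E} (hQ : Convex ℝ Q) {R r : ℝ} (hr : 0 < r)
    (hB : ball 0 R ⊆ Q) : Q + ball 0 (r * R) ⊆ (1 + r) • Q := by
  rw [hQ.add_smul zero_le_one hr.le, one_smul]
  gcongr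
  have : ball (0 : E) (r * R) = r • ball (0 : E) R := by
    rw [_root_.smul_ball hr.ne', smul_zero, Real.norm_of_nonneg hr.le]
  rw [this]
  exact smul_set_mono hB

theorem IsPrismConst.hausdorffMeasure_frontier_ball_le {d : ℕ} {c : ℝ≥0∞} (hc : IsPrismConst d c)
    {R : ℝ} (hR : 0 < R) :
    μH[(d : ℝ)] (frontier (ball (0 : EuclideanSpace ℝ (Fin (d + 1))) R)) ≤
      c * ENNReal.ofReal ((d + 1) * volume.real (ball (0 : EuclideanSpace ℝ (Fin (d + 1))) 1) *
        R ^ d) := by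
  set S := μH[(d : ℝ)] (frontier (ball (0 : EuclideanSpace ℝ (Fin (d + 1))) R)) with hS
  set ω := volume.real (ball (0 : EuclideanSpace ℝ (Fin (d + 1))) 1) with hω
  have hω0 : 0 ≤ ω := measureReal_nonneg
  have hball : ∀ r : ℝ, 0 ≤ r → volume.real (ball (0 : EuclideanSpace ℝ (Fin (d + 1))) r) =
      r ^ (d + 1) * ω := by
    intro r hr
    rw [Measure.real, Measure.addHaar_ball _ _ hr, ENNReal.toReal_mul,
      ENNReal.toReal_ofReal (by positivity)]
    simp [hω, Measure.real]
  have key : ∀ η : ℝ, 0 < η → S / c ≠ ∞ ∧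
      (S / c).toReal ≤ ((1 + η) ^ (d + 1) - 1) / η * (ω * R ^ d * (1 + η) ^ (d + 1)) := by
    intro η hη
    obtain ⟨s, hs, h1, h2⟩ := exists_polytope_between
      (isCompact_closedBall (0 : EuclideanSpace ℝ (Fin (d + 1))) R)
      (convex_closedBall _ _) (nonempty_closedBall.2 hR.le)
      (isOpen_ball (x := (0 : EuclideanSpace ℝ (Fin (d + 1)))) (ε := R * (1 + η)))
      (by rw [frontier_ball _ (by positivity)]; exact isCompact_sphere _ _)
      (closedBall_subset_ball (by nlinarith))
    have hQb : IsBounded (polytope s) := isBounded_ball.subset h2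
    have hSle : S ≤ ∑ q ∈ s, μH[(d : ℝ)] (facet s q) := by
      rw [hS, frontier_ball _ hR.ne']
      refine (hausdorffMeasure_sphere_le_frontier (by positivity) hR hQb
        ((sphere_subset_closedBall.trans h1).trans subset_closure)).trans ?_
      exact (measure_mono (frontier_polytope_subset s)).trans (measure_biUnion_finset_le _ _)
    have h3 := hc.volume_add_sum_facet_le hs ⟨0, h1 (mem_closedBall_self hR.le)⟩
      (mul_pos hη hR)
    have h4 : volume (polytope s + ball 0 (η * R)) ≤
        ENNReal.ofReal ((1 + η) ^ (d + 1)) * volume (polytope s) := by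
      refine (measure_mono (polytope_add_ball_subset (convex_polytope s) hη
        (ball_subset_closedBall.trans h1))).trans_eq ?_
      rw [Measure.addHaar_smul, abs_of_nonneg (by positivity)]
      simp
    have h5 : volume (polytope s) + ENNReal.ofReal (η * R) * (S / c) ≤
        ENNReal.ofReal ((1 + η) ^ (d + 1)) * volume (polytope s) := by
      rw [← ENNReal.mul_le_mul_iff_right hc.ne_zero hc.ne_top]
      calc _ = c * volume (polytope s) + ENNReal.ofReal (η * R) * S := by
            rw [mul_add, mul_left_comm, ENNReal.mul_div_cancel hc.ne_zero hc.ne_top]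
        _ ≤ _ := (by gcongr : _ ≤ _).trans h3
        _ ≤ _ := by gcongr
    have hQf : volume (polytope s) ≠ ∞ := hQb.measure_lt_top.ne
    have h6 : S / c ≠ ∞ := by
      intro h
      rw [h, ENNReal.mul_top (by simp; positivity)] at h5
      have := ENNReal.mul_lt_top (ENNReal.ofReal_lt_top (r := (1 + η) ^ (d + 1))) hQf.lt_top
      simp [this.ne] at h5
    refine ⟨h6, ?_⟩
    have h7 := ENNReal.toReal_mono (ENNReal.mul_ne_top ENNReal.ofReal_ne_top hQf) h5
    rw [ENNReal.toReal_add hQf (ENNReal.mul_ne_top ENNReal.ofReal_ne_top h6), ENNReal.toReal_mul,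
      ENNReal.toReal_mul, ENNReal.toReal_ofReal (by positivity),
      ENNReal.toReal_ofReal (by positivity)] at h7
    have h8 : (volume (polytope s)).toReal ≤ (R * (1 + η)) ^ (d + 1) * ω := by
      rw [← hball _ (by positivity)]
      exact measureReal_mono h2 (isBounded_ball.measure_lt_top.ne)
    have h9 : 0 ≤ (1 + η) ^ (d + 1) - 1 := by
      have := one_le_pow₀ (n := d + 1) (by linarith : 1 ≤ 1 + η)
      linarith
    have h10 : η * R * (S / c).toReal ≤
        ((1 + η) ^ (d + 1) - 1) * ((R * (1 + η)) ^ (d + 1) * ω) := by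
      nlinarith
    rw [← mul_le_mul_iff_right₀ (mul_pos hη hR)]
    refine h10.trans_eq ?_
    rw [mul_pow]
    field_simp
    ring
  have hlim : Filter.Tendsto (fun η : ℝ => ((1 + η) ^ (d + 1) - 1) / η *
      (ω * R ^ d * (1 + η) ^ (d + 1))) (nhdsWithin 0 (Ioi 0)) (nhds ((d + 1) * ω * R ^ d)) := by
    have e1 : HasDerivAt (fun η : ℝ => (1 + η) ^ (d + 1)) ((d + 1 : ℝ)) 0 := by
      have := ((hasDerivAt_id (0:ℝ)).const_add 1).fun_pow (d + 1)
      simpa using this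
    have e2 := (hasDerivWithinAt_iff_tendsto_slope' (by simp)).1 (e1.hasDerivWithinAt (s := Ioi 0))
    have e3 : Filter.Tendsto (fun η : ℝ => ω * R ^ d * (1 + η) ^ (d + 1)) (nhdsWithin 0 (Ioi 0))
        (nhds (ω * R ^ d * (1 + 0) ^ (d + 1))) := by
      have : Continuous fun η : ℝ => ω * R ^ d * (1 + η) ^ (d + 1) := by fun_prop
      exact (this.tendsto 0).mono_left nhdsWithin_le_nhds
    have e4 := e2.mul e3
    simp only [add_zero, one_pow, mul_one] at e4
    rw [← mul_assoc] at e4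
    refine e4.congr fun η => ?_
    simp [slope_def_field]
  have hfin := (key 1 one_pos).1
  have h := ge_of_tendsto hlim (by filter_upwards [self_mem_nhdsWithin] with η hη using (key η hη).2)
  rw [mul_comm, ← ENNReal.div_le_iff hc.ne_zero hc.ne_top]
  exact (ENNReal.le_ofReal_iff_toReal_le hfin (by positivity)).2 h

theorem hausdorffMeasure_frontier_ball_pos {d : ℕ} {R : ℝ} (hR : 0 < R) :
    0 < μH[(d : ℝ)] (frontier (ball (0 : EuclideanSpace ℝ (Fin (d + 1))) R)) := by
  obtain ⟨c, hc⟩ := exists_isPrismConst d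
  have hB : IsConvexBody (ball (0 : EuclideanSpace ℝ (Fin (d + 1))) R) :=
    ⟨isOpen_ball, convex_ball _ _, isBounded_ball, nonempty_ball.2 hR⟩
  have h := hc.volume_le_innerPar_add hB isBounded_ball subset_rfl (2 * R)
  have he : innerPar (ball (0 : EuclideanSpace ℝ (Fin (d + 1))) R) (2 * R) = ∅ := by
    refine eq_empty_of_forall_notMem fun x hx => ?_
    have hx0 := innerPar_subset (by positivity) hx
    have hw : ‖EuclideanSpace.single (0 : Fin (d + 1)) (2 * R)‖ = 2 * R := by
      simp [abs_of_pos hR]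
    have := hx (show x + EuclideanSpace.single (0 : Fin (d + 1)) (2 * R) ∈ closedBall x (2 * R) by
      rw [mem_closedBall, dist_eq_norm, add_sub_cancel_left, hw])
    rw [mem_ball_zero_iff] at this hx0
    have h2 := norm_sub_le (x + EuclideanSpace.single (0 : Fin (d + 1)) (2 * R)) x
    rw [add_sub_cancel_left, hw] at h2
    linarith
  rw [he, measure_empty, mul_zero, zero_add] at h
  refine pos_iff_ne_zero.2 fun h0 => ?_
  rw [h0, mul_zero] at h
  have := mul_ne_zero hc.ne_zero (hB.isOpen.measure_pos volume hB.nonempty).ne'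
  exact this (le_antisymm h zero_le)

section Zonoid

variable {E : Type*} [NormedAddCommGroup E] [InnerProductSpace ℝ E] [FiniteDimensional ℝ E]
  [MeasurableSpace E] [BorelSpace E]

theorem integrableOn_abs_inner (y : E) : IntegrableOn (fun x : E => |inner ℝ x y|) (ball 0 1) := by
  have : Continuous fun x : E => |inner ℝ x y| := by fun_prop
  exact (this.continuousOn.integrableOn_compact (isCompact_closedBall (0 : E) 1)).mono_set
    ball_subset_closedBall

/-- The mean of `|⟪x, y⟫|` over the unit ball is proportional to `‖y‖`. -/
theorem exists_integral_abs_inner [Nontrivial E] : ∃ κ : ℝ, 0 < κ ∧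
    ∀ y : E, ∫ x in ball (0 : E) 1, |inner ℝ x y| = κ * ‖y‖ := by
  obtain ⟨e, he⟩ := NormedSpace.sphere_nonempty (E := E) (x := 0) (r := 1) |>.2 zero_le_one
  rw [mem_sphere_zero_iff_norm] at he
  refine ⟨∫ x in ball (0 : E) 1, |inner ℝ x e|, ?_, fun y => ?_⟩
  · rw [setIntegral_pos_iff_support_of_nonneg_ae (by filter_upwards with x using abs_nonneg _)
      (integrableOn_abs_inner e)]
    have hc : Continuous fun x : E => |inner ℝ x e| := by fun_prop
    refine (IsOpen.inter (isOpen_ne_fun hc continuous_const) isOpen_ball).measure_pos _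
      ⟨(1 / 2 : ℝ) • e, ?_, ?_⟩
    · simp [inner_smul_left, he]
    · simp [norm_smul, he]
      norm_num
  · have hn : ‖‖y‖ • e‖ = ‖y‖ := by simp [norm_smul, he]
    set A := (ℝ ∙ (‖y‖ • e - y))ᗮ.reflection with hA
    have hAy : A (‖y‖ • e) = y := Submodule.reflection_sub hn
    have h := (A.measurePreserving).setIntegral_preimage_emb
      A.toHomeomorph.measurableEmbedding (fun x => |inner ℝ x y|) (ball 0 1)
    rw [← h, A.preimage_ball, map_zero]
    have : ∀ x, |inner ℝ (A x) y| = |inner ℝ x e| * ‖y‖ := fun x => by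
      rw [← hAy, A.inner_map_map, inner_smul_right, abs_mul, abs_norm, A.norm_map, hn, mul_comm]
    simp_rw [this]
    rw [integral_mul_const]

/-- The norm is approximated by the support functions of zonotopes. -/
theorem exists_sum_abs_inner_near_norm [Nontrivial E] {η : ℝ} (hη : 0 < η) :
    ∃ (s : Finset E) (u : E → E), ∀ y : E, |∑ i ∈ s, |inner ℝ (u i) y| - ‖y‖| ≤ η * ‖y‖ := by
  obtain ⟨κ, hκ, hy⟩ := exists_integral_abs_inner (E := E)
  set μ := (volume : Measure E).restrict (ball 0 1) with hμ
  have : IsFiniteMeasure μ := ⟨by rw [hμ, Measure.restrict_apply_univ]; exact measure_ball_lt_top⟩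
  have hid : Integrable (fun x : E => x) μ :=
    (continuous_id.continuousOn.integrableOn_compact (isCompact_closedBall (0 : E) 1)).mono_set
      ball_subset_closedBall
  obtain ⟨g, hg, -⟩ := (memLp_one_iff_integrable.2 hid).exists_simpleFunc_eLpNorm_sub_lt
    ENNReal.one_ne_top (ε := ENNReal.ofReal (η * κ)) (by simp; positivity)
  have hgi : Integrable g μ := SimpleFunc.integrable_of_isFiniteMeasure g
  have hsub : Integrable (fun x => x - g x) μ := hid.sub hgi
  have hd : ∫ x, ‖x - g x‖ ∂μ ≤ η * κ := by
    rw [eLpNorm_one_eq_lintegral_enorm] at hg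
    have := ofReal_integral_norm_eq_lintegral_enorm hsub
    have h2 := this.trans_lt hg
    exact (ENNReal.ofReal_lt_ofReal_iff (by positivity)).1 h2 |>.le
  refine ⟨g.range, fun x => (μ.real (g ⁻¹' {x}) / κ) • x, fun y => ?_⟩
  have h1 : ∫ x, |inner ℝ (g x) y| ∂μ = ∑ x ∈ g.range, μ.real (g ⁻¹' {x}) * |inner ℝ x y| := by
    have := SimpleFunc.map_integral g (fun x : E => |inner ℝ x y|) hgi (by simp)
    rw [SimpleFunc.integral_eq_integral _ (SimpleFunc.integrable_of_isFiniteMeasure _)] at this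
    simpa using this
  have h2 : ∑ x ∈ g.range, |inner ℝ ((μ.real (g ⁻¹' {x}) / κ) • x) y| =
      (∫ x, |inner ℝ (g x) y| ∂μ) / κ := by
    rw [h1, Finset.sum_div]
    refine Finset.sum_congr rfl fun x _ => ?_
    rw [inner_smul_left, abs_mul, conj_trivial, abs_of_nonneg (by positivity)]
    ring
  have hgy : Integrable (fun x => |inner ℝ (g x) y|) μ := (hgi.inner_const (𝕜 := ℝ) y).abs
  have h3 : |(∫ x, |inner ℝ (g x) y| ∂μ) - κ * ‖y‖| ≤ η * κ * ‖y‖ := by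
    rw [← hy y, ← integral_sub hgy (integrableOn_abs_inner y), ← Real.norm_eq_abs]
    refine (norm_integral_le_of_norm_le (μ := μ) (hsub.norm.mul_const ‖y‖) ?_).trans ?_
    · filter_upwards with x
      rw [Real.norm_eq_abs]
      refine (abs_abs_sub_abs_le_abs_sub _ _).trans ?_
      rw [← inner_sub_left, norm_sub_rev]
      exact abs_real_inner_le_norm _ _
    · rw [integral_mul_const]
      gcongr
  rw [h2]
  have e : (∫ x, |inner ℝ (g x) y| ∂μ) / κ - ‖y‖ =
      ((∫ x, |inner ℝ (g x) y| ∂μ) - κ * ‖y‖) / κ := by field_simp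
  rw [e, abs_div, abs_of_pos hκ, div_le_iff₀ hκ]
  linarith

theorem zonotope_subset_closedBall {ι : Type*} [Fintype ι] {u : ι → E} {r : ℝ} (hr : 0 ≤ r)
    (h : ∀ y : E, ∑ i, |inner ℝ (u i) y| ≤ r * ‖y‖) : zonotope u 1 ⊆ closedBall 0 r := by
  rintro z ⟨c, hc, hz⟩
  rw [mem_closedBall_zero_iff]
  have h1 : ‖z‖ * ‖z‖ ≤ r * ‖z‖ := by
    rw [← real_inner_self_eq_norm_mul_norm]
    nth_rewrite 1 [hz]
    rw [sum_inner]
    refine (Finset.sum_le_sum fun i _ => ?_).trans (h z)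
    rw [inner_smul_left, conj_trivial]
    refine (le_abs_self _).trans ?_
    rw [abs_mul]
    exact mul_le_of_le_one_left (abs_nonneg _) (hc i)
  rcases (norm_nonneg z).eq_or_lt with h0 | h0
  · rw [← h0]; exact hr
  · exact le_of_mul_le_mul_right h1 h0

theorem closedBall_subset_zonotope {ι : Type*} [Fintype ι] {u : ι → E} {r : ℝ}
    (h : ∀ y : E, r * ‖y‖ ≤ ∑ i, |inner ℝ (u i) y|) : closedBall 0 r ⊆ zonotope u 1 := by
  intro z hz
  by_contra hn
  obtain ⟨f, t, h1, h2⟩ := geometric_hahn_banach_closed_point (convex_zonotope u 1)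
    (isCompact_zonotope u 1).isClosed hn
  set w := (InnerProductSpace.toDual ℝ E).symm f with hw
  have hf : ∀ x, f x = inner ℝ w x := fun x => by
    rw [hw, InnerProductSpace.toDual_symm_apply]
  have h3 := h1 (∑ i, (SignType.sign (inner ℝ (u i) w) : ℝ) • u i) ⟨_, fun i => ?_, rfl⟩
  · rw [hf, inner_sum] at h3
    have h4 : ∀ i, inner ℝ w ((SignType.sign (inner ℝ (u i) w) : ℝ) • u i) =
        |inner ℝ (u i) w| := fun i => by
      rw [inner_smul_right, real_inner_comm, sign_mul_self]
    simp_rw [h4] at h3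
    have h5 := h w
    rw [hf] at h2
    have h6 := real_inner_le_norm w z
    rw [mem_closedBall_zero_iff] at hz
    nlinarith [norm_nonneg w]
  · rcases lt_trichotomy (inner ℝ (u i) w) 0 with h0 | h0 | h0 <;> simp [h0]

/-- The Euclidean ball is a limit of zonotopes. -/
theorem exists_zonotope_near_closedBall [Nontrivial E] {η : ℝ} (hη : 0 < η) :
    ∃ (T : Finset E) (u : T → E), (∀ i, u i ≠ 0) ∧
      closedBall 0 (1 - η) ⊆ zonotope u 1 ∧ zonotope u 1 ⊆ closedBall 0 (1 + η) := by
  classical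
  obtain ⟨s, u, h⟩ := exists_sum_abs_inner_near_norm (E := E) hη
  have hs : ∀ y : E, ∑ i : {i // i ∈ s.filter (fun i => u i ≠ 0)}, |inner ℝ (u i) y| =
      ∑ i ∈ s, |inner ℝ (u i) y| := fun y => by
    rw [Finset.sum_coe_sort (s.filter (fun i => u i ≠ 0)) (fun i => |inner ℝ (u i) y|),
      Finset.sum_filter]
    refine Finset.sum_congr rfl fun i _ => ?_
    by_cases h0 : u i = 0 <;> simp [h0]
  refine ⟨s.filter (fun i => u i ≠ 0), fun i => u i,
    fun i => (Finset.mem_filter.1 i.2).2, closedBall_subset_zonotope fun y => ?_,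
    zonotope_subset_closedBall (by positivity) fun y => ?_⟩
  · rw [hs]
    linarith [(abs_le.1 (h y)).1]
  · rw [hs]
    linarith [(abs_le.1 (h y)).2]

theorem span_eq_top_of_closedBall_subset_zonotope {ι : Type*} [Fintype ι] {u : ι → E} {r : ℝ}
    (hr : 0 < r) (h : closedBall 0 r ⊆ zonotope u 1) : Submodule.span ℝ (range u) = ⊤ := by
  refine Submodule.eq_top_of_nonempty_interior' _ ⟨0, ?_⟩
  rw [mem_interior_iff_mem_nhds]
  refine Filter.mem_of_superset (closedBall_mem_nhds 0 hr) (h.trans ?_)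
  rintro z ⟨c, -, rfl⟩
  exact Submodule.sum_mem _ fun i _ => Submodule.smul_mem _ _ (Submodule.subset_span ⟨i, rfl⟩)

end Zonoid

theorem isOpen_innerPar {E : Type*} [NormedAddCommGroup E] [NormedSpace ℝ E] [ProperSpace E]
    {K : Set E} (hK : IsOpen K) {t : ℝ} (ht : 0 ≤ t) : IsOpen (innerPar K t) := by
  refine Metric.isOpen_iff.2 fun x hx => ?_
  obtain ⟨δ, hδ, h⟩ := (isCompact_closedBall x t).exists_cthickening_subset_open hK hx
  rw [cthickening_closedBall hδ.le ht] at h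
  refine ⟨δ, hδ, fun y hy => Subset.trans (closedBall_subset_closedBall' ?_) h⟩
  rw [mem_ball] at hy
  linarith

theorem isConvexBody_innerPar {E : Type*} [NormedAddCommGroup E] [NormedSpace ℝ E] [ProperSpace E]
    {K : Set E} (hK : IsConvexBody K) {t : ℝ} (ht : 0 ≤ t) (hn : (innerPar K t).Nonempty) :
    IsConvexBody (innerPar K t) :=
  ⟨isOpen_innerPar hK.isOpen ht, hK.convex.innerPar t, hK.isBounded.subset (innerPar_subset ht), hn⟩

/-- Cancellation of a compact summand. -/
theorem mem_closure_of_add_subset_add {E : Type*} [NormedAddCommGroup E] [NormedSpace ℝ E]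
    {M D : Set E} (hM : Convex ℝ M) (hD : IsCompact D) (hDn : D.Nonempty) {x : E}
    (h : ∀ z ∈ D, x + z ∈ M + D) : x ∈ closure M := by
  by_contra hx
  obtain ⟨f, u, h1, h2⟩ := geometric_hahn_banach_closed_point hM.closure isClosed_closure hx
  obtain ⟨z, hz, hmax⟩ := hD.exists_isMaxOn hDn f.continuous.continuousOn
  obtain ⟨m, hm, z', hz', he⟩ := h z hz
  have h3 := congrArg f he
  simp only [map_add] at h3
  have h4 : f z' ≤ f z := hmax hz'
  have h5 := h1 m (subset_closure hm)
  linarith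

theorem zonotope_smul_add {ι E : Type*} [Fintype ι] [NormedAddCommGroup E] [NormedSpace ℝ E]
    [FiniteDimensional ℝ E] [MeasurableSpace E] [BorelSpace E] (u : ι → E)
    {a b : ℝ} (ha : 0 < a) (hb : 0 < b) :
    zonotope u ((a + b) • 1) = zonotope u (a • 1) + zonotope u (b • 1) := by
  rw [← smul_zonotope_one u ha, ← smul_zonotope_one u hb, ← smul_zonotope_one u (add_pos ha hb),
    (convex_zonotope u 1).add_smul ha.le hb.le]

section

variable {d : ℕ} {Ω K : Set (EuclideanSpace ℝ (Fin (d + 1)))} {ι : Type*} [Fintype ι]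
  {u : ι → EuclideanSpace ℝ (Fin (d + 1))} {p : ℝ → ℝ} {r η : ℝ}

theorem IsConvexBody.measureReal_mono {K L : Set (EuclideanSpace ℝ (Fin (d + 1)))}
    (hL : IsConvexBody L) (h : K ⊆ L) : volume.real K ≤ volume.real L :=
  MeasureTheory.measureReal_mono h (hL.measure_ne_top volume)

/-- The initial growth of `|K + s Z|` dominates the inner volume differences. -/
theorem IsConvexBody.le_deriv_zero (hK : IsConvexBody K) (hη1 : η < 1)
    (hZ : closedBall 0 (1 - η) ⊆ zonotope u 1)
    (hp : ∀ s, 0 ≤ s → p s = volume.real (K + zonotope u (s • 1)))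
    (hr : HasDerivAt p r 0) {ε : ℝ} (hε : 0 < ε) :
    (1 - η) * ((volume.real K - volume.real (innerPar K ε)) / ε) ≤ r := by
  have h0 : p 0 = volume.real K := by
    rw [hp 0 le_rfl, zero_smul]
    have : zonotope u 0 = {0} := by
      ext z
      simp only [zonotope, Pi.zero_apply, abs_nonpos_iff, mem_ofPred_eq, mem_singleton_iff]
      constructor
      · rintro ⟨c, hc, rfl⟩; simp [hc]
      · rintro rfl; exact ⟨0, by simp, by simp⟩
    rw [this]; simp
  have hs : ∀ s, 0 < s → (1 - η) * ((volume.real K - volume.real (innerPar K ε)) / ε) ≤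
      (p s - p 0) / s := by
    intro s hs
    have hδ : 0 < s * (1 - η) := mul_pos hs (by linarith)
    have h1 := hK.volume_innerPar_add_le (ε := ε) hδ
    have h2 : volume (K + ball 0 (s * (1 - η))) ≤ volume (K + zonotope u (s • 1)) := by
      refine measure_mono (add_subset_add_left ?_)
      rw [← smul_zonotope_one u hs]
      refine Subset.trans ?_ (smul_set_mono hZ)
      rw [_root_.smul_closedBall _ _ (by linarith), smul_zero, Real.norm_of_nonneg hs.le]
      exact ball_subset_closedBall
    have hKs := (hK.add_zonotope u (x := s • 1) (smul_nonneg hs.le zero_le_one)).measure_ne_top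
      volume
    have hKe : volume (innerPar K ε) ≠ ∞ :=
      ((measure_mono (innerPar_subset hε.le)).trans_lt (hK.measure_ne_top volume).lt_top).ne
    have h3 := ENNReal.toReal_mono (ENNReal.add_ne_top.2
      ⟨ENNReal.mul_ne_top ENNReal.ofReal_ne_top hKe, ENNReal.mul_ne_top ENNReal.ofReal_ne_top hKs⟩)
      (h1.trans (add_le_add le_rfl (mul_le_mul_right h2 _)))
    rw [ENNReal.toReal_mul, ENNReal.toReal_add (by simp) (by simp),
      ENNReal.toReal_add (ENNReal.mul_ne_top ENNReal.ofReal_ne_top hKe)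
        (ENNReal.mul_ne_top ENNReal.ofReal_ne_top hKs), ENNReal.toReal_mul, ENNReal.toReal_mul,
      ENNReal.toReal_ofReal hδ.le, ENNReal.toReal_ofReal hε.le] at h3
    rw [h0, hp s hs.le, ← mul_div_assoc, div_le_div_iff₀ hε hs]
    simp only [Measure.real]
    nlinarith
  have hlim := (hasDerivWithinAt_iff_tendsto_slope' (s := Ioi 0) (by simp)).1 hr.hasDerivWithinAt
  refine ge_of_tendsto hlim ?_
  filter_upwards [self_mem_nhdsWithin] with s h
  rw [slope_def_field, sub_zero]
  exact hs s h

/-- The terminal growth of `|K + s Z|` is at most the surface area of any surrounding set. -/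
theorem IsConvexBody.deriv_le {c : ℝ≥0∞} (hc : IsPrismConst d c) (hΩ : IsBounded Ω) {S : ℝ}
    (hS0 : 0 ≤ S) (hS : μH[(d : ℝ)] (frontier Ω) ≤ c * ENNReal.ofReal S)
    (hK : IsConvexBody K) (hη0 : 0 < η)
    (hZ : zonotope u 1 ⊆ closedBall 0 (1 + η)) {t : ℝ} (ht : 0 < t)
    (hKΩ : K + zonotope u (t • 1) ⊆ Ω)
    (hp : ∀ s, 0 ≤ s → p s = volume.real (K + zonotope u (s • 1)))
    (hr : HasDerivAt p r t) : r ≤ (1 + η) * S := by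
  have hs : ∀ e, 0 < e → e < t → (p (t - e) - p t) / (-e) ≤ (1 + η) * S := by
    intro e he het
    set L := K + zonotope u (t • 1) with hLdef
    set M := K + zonotope u ((t - e) • 1) with hMdef
    have hL : IsConvexBody L := hK.add_zonotope u (smul_nonneg ht.le zero_le_one)
    have hM : IsConvexBody M := hK.add_zonotope u (smul_nonneg (by linarith) zero_le_one)
    have h1 := hc.volume_le_innerPar_add hL hΩ hKΩ (e * (1 + η))
    have h2 : innerPar L (e * (1 + η)) ⊆ closure M := by
      intro x hx
      refine mem_closure_of_add_subset_add hM.convex (isCompact_zonotope u (e • 1))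
        (zonotope_nonneg_nonempty u (smul_nonneg he.le zero_le_one)) fun z hz => ?_
      have : M + zonotope u (e • 1) = L := by
        rw [hMdef, hLdef, add_assoc, ← zonotope_smul_add u (by linarith) he, sub_add_cancel]
      rw [this]
      refine hx ?_
      rw [← smul_zonotope_one u he] at hz
      have h3 := smul_set_mono hZ hz
      rw [_root_.smul_closedBall _ _ (by linarith), smul_zero, Real.norm_of_nonneg he.le] at h3
      simpa [dist_eq_norm] using h3
    have h3 : volume (innerPar L (e * (1 + η))) ≤ volume M := by
      refine (measure_mono h2).trans ?_
      rw [closure_eq_self_union_frontier]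
      refine (measure_union_le _ _).trans ?_
      rw [hM.convex.addHaar_frontier volume, add_zero]
    have h4 : volume L ≤ volume M + ENNReal.ofReal (e * (1 + η)) * ENNReal.ofReal S := by
      rw [← ENNReal.mul_le_mul_iff_right hc.ne_zero hc.ne_top]
      refine h1.trans ?_
      rw [mul_add c, mul_left_comm c]
      gcongr
    have hMf := hM.measure_ne_top volume
    rw [← ENNReal.ofReal_mul (by positivity)] at h4
    have h5 := ENNReal.toReal_mono (by simp [hMf]) h4
    rw [ENNReal.toReal_add hMf (by simp), ENNReal.toReal_ofReal (by positivity)] at h5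
    rw [hp t ht.le, hp (t - e) (by linarith), div_le_iff_of_neg (by linarith)]
    simp only [Measure.real]
    linarith
  have hlim := (hasDerivWithinAt_iff_tendsto_slope' (s := Iio t) (by simp)).1 hr.hasDerivWithinAt
  refine le_of_tendsto hlim ?_
  filter_upwards [self_mem_nhdsWithin, mem_nhdsWithin_of_mem_nhds (lt_mem_nhds ht)] with s h h'
  have := hs (t - s) (sub_pos.2 h) (by linarith)
  have e : t - (t - s) = s := by ring
  rw [e, neg_sub] at this
  rw [slope_def_field]
  exact this

/-- The volume deficit of the inner parallel sets of a convex body is dominated by that of a ball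
with at least the same perimeter. -/
theorem IsConvexBody.innerPar_volume_deficit (hd : 1 ≤ d) {c : ℝ≥0∞} (hc : IsPrismConst d c)
    (hΩ : IsConvexBody Ω) {R : ℝ} (hR : 0 < R)
    (hS : μH[(d : ℝ)] (frontier Ω) ≤ c * ENNReal.ofReal ((d + 1) *
      volume.real (ball (0 : EuclideanSpace ℝ (Fin (d + 1))) 1) * R ^ d))
    {t ε : ℝ} (ht : 0 < t) (hε : 0 < ε) (hne : (innerPar Ω t).Nonempty) :
    t ≤ R ∧ volume.real (innerPar Ω t) - volume.real (innerPar Ω (t + ε)) ≤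
      ε * ((d + 1) * volume.real (ball (0 : EuclideanSpace ℝ (Fin (d + 1))) 1) * (R - t) ^ d) := by
  set ω := volume.real (ball (0 : EuclideanSpace ℝ (Fin (d + 1))) 1) with hω
  have hB : IsConvexBody (ball (0 : EuclideanSpace ℝ (Fin (d + 1))) 1) :=
    ⟨isOpen_ball, convex_ball _ _, isBounded_ball, nonempty_ball.2 one_pos⟩
  have hω0 : 0 < ω := hB.measureReal_pos volume
  have hK : IsConvexBody (innerPar Ω t) := isConvexBody_innerPar hΩ ht.le hne
  set K := innerPar Ω t with hKdef
  set X := (volume.real K - volume.real (innerPar K ε)) / ε with hX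
  have hX0 : 0 ≤ X := div_nonneg (sub_nonneg.2 (hK.measureReal_mono (innerPar_subset hε.le))) hε.le
  have hd0 : (0:ℝ) < d := by exact_mod_cast hd
  have key : ∀ η : ℝ, 0 < η → η < 1 → ((1 - η) * X) ^ (1 / d : ℝ) +
      t / (1 + η) * ((d + 1) * ((1 - η) ^ (d + 1) * ω)) ^ (1 / d : ℝ) ≤
      ((1 + η) * ((d + 1) * ω * R ^ d)) ^ (1 / d : ℝ) := by
    intro η hη0 hη1
    obtain ⟨T, u, hu, hZ1, hZ2⟩ := exists_zonotope_near_closedBall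
      (E := EuclideanSpace ℝ (Fin (d + 1))) hη0
    have hZv : (1 - η) ^ (d + 1) * ω ≤ volume.real (zonotope u 1) := by
      have : volume.real (ball (0 : EuclideanSpace ℝ (Fin (d + 1))) (1 - η)) =
          (1 - η) ^ (d + 1) * ω := by
        rw [Measure.real, Measure.addHaar_ball _ _ (by linarith), ENNReal.toReal_mul,
          ENNReal.toReal_ofReal (by have : 0 < 1 - η := by linarith
                                    positivity)]
        simp [hω, Measure.real]
      rw [← this]
      exact MeasureTheory.measureReal_mono (ball_subset_closedBall.trans hZ1)
        (isCompact_zonotope u 1).measure_lt_top.ne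
    have hη1' : 0 < 1 - η := by linarith
    obtain ⟨p, r, hp, hr, hr0, -, hbm⟩ := hK.exists_hasDerivAt_volume volume hu
      (span_eq_top_of_closedBall_subset_zonotope hη1' hZ1) hd (by simp)
      (lt_of_lt_of_le (by positivity) hZv)
    have ht' : 0 < t / (1 + η) := by positivity
    have h1 := hK.le_deriv_zero hη1 hZ1 hp (hr 0) hε
    have hsub : K + zonotope u ((t / (1 + η)) • 1) ⊆ Ω := by
      rintro _ ⟨x, hx, z, hz, rfl⟩
      refine hx ?_
      rw [← smul_zonotope_one u ht'] at hz
      have h3 := smul_set_mono hZ2 hz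
      rw [_root_.smul_closedBall _ _ (by linarith), smul_zero, Real.norm_of_nonneg ht'.le,
        div_mul_cancel₀ _ (by positivity)] at h3
      simpa [dist_eq_norm] using h3
    have h2 := hK.deriv_le hc hΩ.isBounded (by positivity) hS hη0 hZ2 ht' hsub hp (hr _)
    refine le_trans (add_le_add ?_ ?_) ((hbm _ ht'.le).trans ?_)
    · exact Real.rpow_le_rpow (by positivity) h1 (by positivity)
    · gcongr
    · exact Real.rpow_le_rpow (hr0 _ ht'.le).le h2 (by positivity)
  have hlim : X ^ (1 / d : ℝ) + t * ((d + 1) * ω) ^ (1 / d : ℝ) ≤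
      ((d + 1) * ω * R ^ d) ^ (1 / d : ℝ) := by
    have hd1 : (0:ℝ) ≤ 1 / d := by positivity
    have c1 : ContinuousWithinAt (fun η : ℝ => ((1 - η) * X) ^ (1 / d : ℝ) +
        t / (1 + η) * ((d + 1) * ((1 - η) ^ (d + 1) * ω)) ^ (1 / d : ℝ)) (Ioo 0 1) 0 := by
      refine ContinuousAt.continuousWithinAt ?_
      refine ContinuousAt.add (ContinuousAt.rpow_const (by fun_prop) (Or.inr hd1))
        (ContinuousAt.mul ?_ (ContinuousAt.rpow_const (by fun_prop) (Or.inr hd1)))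
      exact ContinuousAt.div (by fun_prop) (by fun_prop) (by norm_num)
    have c2 : ContinuousWithinAt (fun η : ℝ =>
        ((1 + η) * ((d + 1) * ω * R ^ d)) ^ (1 / d : ℝ)) (Ioo 0 1) 0 :=
      (ContinuousAt.rpow_const (by fun_prop) (Or.inr hd1)).continuousWithinAt
    have : (nhdsWithin (0:ℝ) (Ioo 0 1)).NeBot := by
      rw [← mem_closure_iff_nhdsWithin_neBot, closure_Ioo (by norm_num)]
      simp
    have := le_of_tendsto_of_tendsto c1 c2 (by
      filter_upwards [self_mem_nhdsWithin] with η hη using key η hη.1 hη.2)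
    simpa using this
  have hn0 : 0 < ((d + 1) * ω : ℝ) ^ (1 / d : ℝ) := by positivity
  have hpow : ∀ y : ℝ, 0 ≤ y → (((d + 1) * ω * y ^ d : ℝ)) ^ (1 / d : ℝ) =
      ((d + 1) * ω) ^ (1 / d : ℝ) * y := by
    intro y hy
    rw [Real.mul_rpow (by positivity) (by positivity), one_div, Real.pow_rpow_inv_natCast hy
      (by omega)]
  rw [hpow R hR.le] at hlim
  have hXp : 0 ≤ X ^ (1 / d : ℝ) := by positivity
  have htR : t ≤ R := by
    by_contra! h
    nlinarith
  refine ⟨htR, ?_⟩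
  have h1 : X ^ (1 / d : ℝ) ≤ ((d + 1) * ω * (R - t) ^ d) ^ (1 / d : ℝ) := by
    rw [hpow _ (by linarith)]
    linarith
  have hRt : 0 ≤ R - t := by linarith
  have h2 : X ≤ (d + 1) * ω * (R - t) ^ d :=
    (Real.rpow_le_rpow_iff hX0 (by positivity) (by positivity)).1 h1
  have h3 : volume.real (innerPar K ε) ≤ volume.real (innerPar Ω (t + ε)) := by
    refine MeasureTheory.measureReal_mono (innerPar_innerPar_subset ht.le hε.le) ?_
    exact ((measure_mono (innerPar_subset (by positivity))).trans_lt
      (hΩ.measure_ne_top volume).lt_top).ne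
  rw [hX, div_le_iff₀ hε] at h2
  linarith

end

theorem hasDerivWithinAt_max_pow {d : ℕ} (hd : 1 ≤ d) (R x : ℝ) :
    HasDerivWithinAt (fun t => max (R - t) 0 ^ (d + 1)) (-((d + 1) * max (R - x) 0 ^ d))
      (Ici x) x := by
  rcases lt_or_ge x R with h | h
  · rw [max_eq_left (by linarith)]
    have h1 : HasDerivAt (fun t : ℝ => (R - t) ^ (d + 1)) (-((d + 1) * (R - x) ^ d)) x := by
      refine (((hasDerivAt_id x).const_sub R).fun_pow (d + 1)).congr_deriv ?_
      simp
    refine (h1.congr_of_eventuallyEq ?_).hasDerivWithinAt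
    filter_upwards [gt_mem_nhds h] with t ht
    rw [max_eq_left (by linarith)]
  · rw [max_eq_right (by linarith), zero_pow (by omega), mul_zero, neg_zero]
    refine (hasDerivWithinAt_const x (Ici x) (0:ℝ)).congr (fun t ht => ?_) ?_
    · rw [mem_Ici] at ht
      rw [max_eq_right (by linarith), zero_pow (by omega)]
    · rw [max_eq_right (by linarith), zero_pow (by omega)]

/-- Integration of a one-sided growth bound. -/
theorem sub_le_of_forall_sub_le {d : ℕ} (hd : 1 ≤ d) {A : ℝ → ℝ} {R C : ℝ} (hC : 0 ≤ C)
    (hA : AntitoneOn A (Ioi 0))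
    (h : ∀ t ε, 0 < t → 0 < ε → A t - A (t + ε) ≤ ε * ((d + 1) * C * max (R - t) 0 ^ d))
    {s t : ℝ} (hs : 0 < s) (hst : s ≤ t) :
    A s - A t ≤ C * max (R - s) 0 ^ (d + 1) - C * max (R - t) 0 ^ (d + 1) := by
  have hmono : ∀ x, s ≤ x → (d + 1) * C * max (R - x) 0 ^ d ≤ (d + 1) * C * max (R - s) 0 ^ d := by
    intro x hx
    gcongr
  have hlip : LipschitzOnWith (((d + 1) * C * max (R - s) 0 ^ d).toNNReal) (fun x => A s - A x)
      (Icc s t) := by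
    have key : ∀ x ∈ Icc s t, ∀ y ∈ Icc s t, x ≤ y →
        |A x - A y| ≤ (d + 1) * C * max (R - s) 0 ^ d * (y - x) := by
      intro x hx y hy hxy
      rcases hxy.eq_or_lt with rfl | hxy
      · simp
      rw [abs_of_nonneg (sub_nonneg.2 (hA (mem_Ioi.2 (hs.trans_le hx.1))
        (mem_Ioi.2 (hs.trans_le hy.1)) hxy.le))]
      have h1 := h x (y - x) (by linarith [hx.1]) (by linarith)
      rw [add_sub_cancel] at h1
      refine h1.trans ?_
      rw [mul_comm]
      exact mul_le_mul_of_nonneg_right (hmono x hx.1) (by linarith)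
    refine LipschitzOnWith.of_dist_le_mul fun x hx y hy => ?_
    rw [Real.coe_toNNReal _ (by positivity), Real.dist_eq, Real.dist_eq,
      show A s - A x - (A s - A y) = A y - A x by ring]
    rcases le_total x y with hxy | hxy
    · rw [abs_sub_comm, abs_sub_comm x, abs_of_nonneg (sub_nonneg.2 hxy)]
      exact key x hx y hy hxy
    · rw [abs_of_nonneg (sub_nonneg.2 hxy)]
      exact key y hy x hx hxy
  refine image_le_of_liminf_slope_right_le_deriv_boundary (f := fun x => A s - A x)
    (B := fun x => C * max (R - s) 0 ^ (d + 1) - C * max (R - x) 0 ^ (d + 1))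
    (B' := fun x => (d + 1) * C * max (R - x) 0 ^ d) hlip.continuousOn (by simp)
    (by fun_prop) (fun x hx => ?_) (fun x hx r hr => ?_) (right_mem_Icc.2 hst)
  · refine (((hasDerivWithinAt_max_pow hd R x).const_mul C).const_sub _).congr_deriv ?_
    ring
  · refine Filter.Eventually.frequently ?_
    filter_upwards [self_mem_nhdsWithin] with z hz
    rw [mem_Ioi] at hz
    have h1 := h x (z - x) (by linarith [hx.1]) (by linarith)
    rw [add_sub_cancel] at h1
    rw [slope_def_field]
    refine lt_of_le_of_lt ?_ hr
    rw [div_le_iff₀ (by linarith)]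
    linarith

/-- Comparison of finite measures on the line through half-open intervals. -/
theorem measure_le_of_forall_Ioc_le {μ ν : Measure ℝ} [IsFiniteMeasure μ] [IsFiniteMeasure ν]
    (h : ∀ a b, a < b → μ (Ioc a b) ≤ ν (Ioc a b)) : μ ≤ ν := by
  have hcont : ∀ (ρ : Measure ℝ) [IsFiniteMeasure ρ] (x : ℝ),
      ContinuousWithinAt (fun t => ρ.real (Iic t)) (Ici x) x := by
    intro ρ _ x
    rw [← continuousWithinAt_Ioi_iff_Ici]
    have h1 : Filter.Tendsto (fun t => ρ (Iic t)) (nhdsWithin x (Ioi x))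
        (nhds (ρ (⋂ r > x, Iic r))) :=
      tendsto_measure_biInter_gt (fun _ _ => measurableSet_Iic.nullMeasurableSet)
        (fun i j _ hij => Iic_subset_Iic.2 hij) ⟨x + 1, by linarith, measure_ne_top _ _⟩
    have h2 : (⋂ r > x, Iic r) = Iic x := by
      ext y
      simp only [mem_iInter, mem_Iic]
      exact ⟨fun h => le_of_forall_gt_imp_ge_of_dense h, fun h r hr => h.trans (le_of_lt hr)⟩
    rw [h2] at h1
    exact (ENNReal.tendsto_toReal (measure_ne_top _ _)).comp h1
  have hIoc : ∀ (ρ : Measure ℝ) [IsFiniteMeasure ρ] (a b : ℝ), a ≤ b →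
      ρ.real (Iic b) - ρ.real (Iic a) = ρ.real (Ioc a b) := by
    intro ρ _ a b hab
    rw [show Ioc a b = Iic b \ Iic a by ext; simp [and_comm],
      measureReal_sdiff (Iic_subset_Iic.2 hab) measurableSet_Iic]
  let F : StieltjesFunction ℝ :=
    { toFun := fun t => ν.real (Iic t) - μ.real (Iic t)
      mono' := by
        intro a b hab
        rcases hab.eq_or_lt with rfl | hab
        · exact le_rfl
        have h1 := ENNReal.toReal_mono (measure_ne_top _ _) (h a b hab)
        have h2 := hIoc μ a b hab.le
        have h3 := hIoc ν a b hab.le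
        simp only [Measure.real] at h1 h2 h3 ⊢
        linarith
      right_continuous' := fun x => (hcont ν x).sub (hcont μ x) }
  have : μ + F.measure = ν := by
    symm
    refine Measure.ext_of_Ioc _ _ fun a b hab => ?_
    rw [Measure.add_apply, StieltjesFunction.measure_Ioc]
    have h1 : F b - F a = ν.real (Ioc a b) - μ.real (Ioc a b) := by
      rw [← hIoc μ a b hab.le, ← hIoc ν a b hab.le]
      change (ν.real (Iic b) - μ.real (Iic b)) - (ν.real (Iic a) - μ.real (Iic a)) = _
      ring
    rw [h1, ENNReal.ofReal_sub _ measureReal_nonneg, ofReal_measureReal, ofReal_measureReal,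
      add_tsub_cancel_of_le (h a b hab)]
  rw [← this]
  exact Measure.le_add_right le_rfl

theorem measure_le_of_forall_pos_Ioc_le {μ ν : Measure ℝ} [IsFiniteMeasure μ] [IsFiniteMeasure ν]
    (h0 : μ (Iic 0) = 0) (h : ∀ a b, 0 < a → a < b → μ (Ioc a b) ≤ ν (Ioc a b)) : μ ≤ ν := by
  refine measure_le_of_forall_Ioc_le fun a b hab => ?_
  rcases lt_or_ge 0 a with ha | ha
  · exact h a b ha hab
  have h1 : Ioc a b ⊆ Iic 0 ∪ ⋃ k : ℕ, Ioc (1 / ((k:ℝ) + 1)) b := by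
    intro x hx
    rcases le_or_gt x 0 with hx0 | hx0
    · exact Or.inl hx0
    · obtain ⟨k, hk⟩ := exists_nat_one_div_lt hx0
      exact Or.inr (mem_iUnion.2 ⟨k, hk, hx.2⟩)
  have hm : Monotone fun k : ℕ => Ioc (1 / ((k:ℝ) + 1)) b := fun i j hij =>
    Ioc_subset_Ioc_left (Nat.one_div_le_one_div hij)
  refine (measure_mono h1).trans ((measure_union_le _ _).trans ?_)
  rw [h0, zero_add, hm.measure_iUnion]
  refine iSup_le fun k => ?_
  have hk : 0 < 1 / ((k:ℝ) + 1) := Nat.one_div_pos_of_nat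
  rcases lt_or_ge (1 / ((k:ℝ) + 1)) b with hb | hb
  · exact (h _ _ hk hb).trans (measure_mono (Ioc_subset_Ioc_left (by linarith)))
  · rw [Ioc_eq_empty (not_lt.2 hb)]; simp

theorem innerPar_mono_right {X : Type*} [PseudoMetricSpace X] {K : Set X} {s t : ℝ} (h : s ≤ t) :
    innerPar K t ⊆ innerPar K s := fun _ hx => (closedBall_subset_closedBall h).trans hx

theorem mem_innerPar_iff_lt_infDist {E : Type*} [NormedAddCommGroup E] [ProperSpace E]
    {Ω : Set E} (hΩ : IsOpen Ω) (hne : Ωᶜ.Nonempty) {s : ℝ} {x : E} :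
    x ∈ innerPar Ω s ↔ s < infDist x Ωᶜ := by
  constructor
  · intro h
    obtain ⟨y, hy, he⟩ := hΩ.isClosed_compl.exists_infDist_eq_dist hne x
    by_contra! hle
    rw [he, dist_comm] at hle
    exact hy (h hle)
  · intro h y hy
    by_contra hyΩ
    have := infDist_le_dist_of_mem (x := x) (show y ∈ Ωᶜ from hyΩ)
    rw [mem_closedBall, dist_comm] at hy
    linarith

section

variable {d : ℕ} {Ω : Set (EuclideanSpace ℝ (Fin (d + 1)))}

theorem volume_real_ball_zero (r : ℝ) :
    volume.real (ball (0 : EuclideanSpace ℝ (Fin (d + 1))) r) =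
      volume.real (ball (0 : EuclideanSpace ℝ (Fin (d + 1))) 1) * max r 0 ^ (d + 1) := by
  rcases le_or_gt r 0 with h | h
  · rw [ball_eq_empty.2 h, max_eq_right h]; simp
  · rw [max_eq_left h.le, Measure.real, Measure.addHaar_ball _ _ h.le, ENNReal.toReal_mul,
      ENNReal.toReal_ofReal (by positivity)]
    simp [Measure.real, mul_comm]

/-- The distribution of the distance to the boundary of a convex body is dominated by that of a
ball of at least the same perimeter. -/
theorem IsConvexBody.map_infDist_le (hd : 1 ≤ d) {c : ℝ≥0∞} (hc : IsPrismConst d c)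
    (hΩ : IsConvexBody Ω) {R : ℝ} (hR : 0 < R)
    (hS : μH[(d : ℝ)] (frontier Ω) ≤ c * ENNReal.ofReal ((d + 1) *
      volume.real (ball (0 : EuclideanSpace ℝ (Fin (d + 1))) 1) * R ^ d)) :
    (volume.restrict Ω).map (fun x => infDist x Ωᶜ) ≤
      (volume.restrict (ball (0 : EuclideanSpace ℝ (Fin (d + 1))) R)).map (fun x => R - ‖x‖) := by
  have hne : Ωᶜ.Nonempty := by
    rw [nonempty_compl]
    rintro h
    have := hΩ.isBounded
    rw [h] at this
    exact NormedSpace.unbounded_univ ℝ (EuclideanSpace ℝ (Fin (d + 1))) this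
  have hm1 : Measurable fun x : EuclideanSpace ℝ (Fin (d + 1)) => infDist x Ωᶜ :=
    (continuous_infDist_pt _).measurable
  have hm2 : Measurable fun x : EuclideanSpace ℝ (Fin (d + 1)) => R - ‖x‖ := by fun_prop
  have hf1 : IsFiniteMeasure (volume.restrict Ω) := ⟨by
    rw [Measure.restrict_apply_univ]; exact (hΩ.measure_ne_top volume).lt_top⟩
  have hf2 : IsFiniteMeasure (volume.restrict (ball (0 : EuclideanSpace ℝ (Fin (d + 1))) R)) := ⟨by
    rw [Measure.restrict_apply_univ]; exact measure_ball_lt_top⟩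
  have hf3 := Measure.isFiniteMeasure_map (volume.restrict Ω) fun x => infDist x Ωᶜ
  have hf4 := Measure.isFiniteMeasure_map
    (volume.restrict (ball (0 : EuclideanSpace ℝ (Fin (d + 1))) R)) fun x => R - ‖x‖
  have hpos : ∀ x ∈ Ω, 0 < infDist x Ωᶜ := fun x hx =>
    (hΩ.isOpen.isClosed_compl.notMem_iff_infDist_pos hne).1 (fun h => h hx)
  refine measure_le_of_forall_pos_Ioc_le ?_ fun a b ha hab => ?_
  · rw [Measure.map_apply hm1 measurableSet_Iic,
      Measure.restrict_apply (hm1 measurableSet_Iic)]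
    convert measure_empty (μ := (volume : Measure (EuclideanSpace ℝ (Fin (d + 1)))))
    ext x
    simp only [mem_inter_iff, mem_preimage, mem_Iic, mem_empty_iff_false, iff_false, not_and]
    intro h hx
    linarith [hpos x hx]
  · rw [Measure.map_apply hm1 measurableSet_Ioc, Measure.map_apply hm2 measurableSet_Ioc,
      Measure.restrict_apply (hm1 measurableSet_Ioc), Measure.restrict_apply (hm2 measurableSet_Ioc)]
    have e1 : (fun x => infDist x Ωᶜ) ⁻¹' Ioc a b ∩ Ω = innerPar Ω a \ innerPar Ω b := by
      ext x
      simp only [mem_inter_iff, mem_preimage, mem_Ioc, mem_sdiff,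
        mem_innerPar_iff_lt_infDist hΩ.isOpen hne, not_lt]
      refine ⟨fun h => h.1, fun h => ⟨h, ?_⟩⟩
      exact innerPar_subset ha.le ((mem_innerPar_iff_lt_infDist hΩ.isOpen hne).2 h.1)
    have e2 : (fun x : EuclideanSpace ℝ (Fin (d + 1)) => R - ‖x‖) ⁻¹' Ioc a b ∩ ball 0 R =
        ball 0 (R - a) \ ball 0 (R - b) := by
      ext x
      simp only [mem_inter_iff, mem_preimage, mem_Ioc, mem_sdiff, mem_ball_zero_iff, not_lt]
      constructor
      · rintro ⟨⟨h1, h2⟩, h3⟩; constructor <;> linarith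
      · rintro ⟨h1, h2⟩; refine ⟨⟨?_, ?_⟩, ?_⟩ <;> linarith
    rw [e1, e2]
    have hfin : ∀ t, 0 < t → volume (innerPar Ω t) ≠ ∞ := fun t ht =>
      ((measure_mono (innerPar_subset ht.le)).trans_lt (hΩ.measure_ne_top volume).lt_top).ne
    rw [← ENNReal.toReal_le_toReal (measure_ne_top_of_subset sdiff_subset (hfin a ha))
      (measure_ne_top_of_subset sdiff_subset measure_ball_lt_top.ne)]
    change volume.real _ ≤ volume.real _
    rw [measureReal_sdiff (innerPar_mono_right hab.le)
      (isOpen_innerPar hΩ.isOpen (ha.trans hab).le).measurableSet (hfin a ha),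
      measureReal_sdiff (ball_subset_ball (by linarith)) measurableSet_ball measure_ball_lt_top.ne,
      volume_real_ball_zero, volume_real_ball_zero (R - b)]
    set ω := volume.real (ball (0 : EuclideanSpace ℝ (Fin (d + 1))) 1)
    have hω : 0 ≤ ω := measureReal_nonneg
    have hA : AntitoneOn (fun t => volume.real (innerPar Ω t)) (Ioi 0) := fun s hs t ht hst =>
      MeasureTheory.measureReal_mono (innerPar_mono_right hst) (hfin s hs)
    have hdef : ∀ t ε, 0 < t → 0 < ε → volume.real (innerPar Ω t) - volume.real (innerPar Ω (t + ε))
        ≤ ε * ((d + 1) * ω * max (R - t) 0 ^ d) := by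
      intro t ε ht hε
      rcases (innerPar Ω t).eq_empty_or_nonempty with h | h
      · rw [h, measureReal_empty]
        have : 0 ≤ volume.real (innerPar Ω (t + ε)) := measureReal_nonneg
        have : 0 ≤ ε * ((d + 1) * ω * max (R - t) 0 ^ d) := by positivity
        linarith
      · obtain ⟨h1, h2⟩ := hΩ.innerPar_volume_deficit hd hc hR hS ht hε h
        rwa [max_eq_left (by linarith)]
    exact sub_le_of_forall_sub_le hd hω hA hdef ha hab.le

end

theorem norm_fderiv_comp_le {E : Type*} [NormedAddCommGroup E] [NormedSpace ℝ E] {G : ℝ → ℝ}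
    {ρ : E → ℝ} (hρ : LipschitzWith 1 ρ) {x : E} (hG : DifferentiableAt ℝ G (ρ x)) :
    ‖fderiv ℝ (fun y => G (ρ y)) x‖ ≤ |deriv G (ρ x)| := by
  by_cases hu : DifferentiableAt ℝ (fun y => G (ρ y)) x
  · refine le_of_forall_pos_le_add fun ε hε => ?_
    refine hu.hasFDerivAt.le_of_lip' (by positivity) ?_
    have h1 := (hasDerivAt_iff_isLittleO.1 hG.hasDerivAt).def hε
    filter_upwards [hρ.continuous.continuousAt.eventually h1] with y hy
    have h2 : |ρ y - ρ x| ≤ ‖y - x‖ := by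
      have := hρ.dist_le_mul y x
      rwa [NNReal.coe_one, one_mul, dist_eq_norm, dist_eq_norm, Real.norm_eq_abs] at this
    have h3 : ‖G (ρ y) - G (ρ x)‖ ≤
        ‖G (ρ y) - G (ρ x) - (ρ y - ρ x) • deriv G (ρ x)‖ + ‖(ρ y - ρ x) • deriv G (ρ x)‖ := by
      simpa using norm_add_le (G (ρ y) - G (ρ x) - (ρ y - ρ x) • deriv G (ρ x))
        ((ρ y - ρ x) • deriv G (ρ x))
    rw [norm_smul, Real.norm_eq_abs (ρ y - ρ x), Real.norm_eq_abs (deriv G (ρ x))] at h3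
    rw [Real.norm_eq_abs (ρ y - ρ x)] at hy
    calc _ ≤ ε * |ρ y - ρ x| + |ρ y - ρ x| * |deriv G (ρ x)| := h3.trans (by gcongr)
      _ = (|deriv G (ρ x)| + ε) * |ρ y - ρ x| := by ring
      _ ≤ _ := by gcongr
  · rw [fderiv_zero_of_not_differentiableAt hu, norm_zero]
    positivity

theorem differentiableAt_of_radial {E : Type*} [NormedAddCommGroup E] [NormedSpace ℝ E]
    {G : ℝ → ℝ} {R : ℝ} {x : E} (hx : x ≠ 0)
    (hw : DifferentiableAt ℝ (fun y : E => G (R - ‖y‖)) x) :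
    DifferentiableAt ℝ G (R - ‖x‖) ∧
      |deriv G (R - ‖x‖)| ≤ ‖fderiv ℝ (fun y : E => G (R - ‖y‖)) x‖ := by
  set w := fun y : E => G (R - ‖y‖) with hwdef
  have hx0 : 0 < ‖x‖ := norm_pos_iff.2 hx
  have hline : HasDerivAt (fun s : ℝ => ((R - s) / ‖x‖) • x) ((-1 / ‖x‖) • x) (R - ‖x‖) :=
    (((hasDerivAt_id (R - ‖x‖)).const_sub R).div_const ‖x‖).smul_const x
  have hval : ((R - (R - ‖x‖)) / ‖x‖) • x = x := by
    rw [sub_sub_cancel, div_self hx0.ne', one_smul]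
  have hw' : HasFDerivAt w (fderiv ℝ w x) (((R - (R - ‖x‖)) / ‖x‖) • x) := by
    rw [hval]; exact hw.hasFDerivAt
  have h1 := hw'.comp_hasDerivAt (R - ‖x‖) hline
  have h2 : G =ᶠ[nhds (R - ‖x‖)] (w ∘ fun s : ℝ => ((R - s) / ‖x‖) • x) := by
    filter_upwards [gt_mem_nhds (show R - ‖x‖ < R by linarith)] with s hs
    have : 0 < R - s := by linarith
    simp only [hwdef, Function.comp_apply, norm_smul, norm_div, norm_norm]
    rw [Real.norm_of_nonneg this.le, div_mul_cancel₀ _ hx0.ne', sub_sub_cancel]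
  have h3 := h1.congr_of_eventuallyEq h2
  refine ⟨h3.differentiableAt, ?_⟩
  rw [h3.deriv, ← Real.norm_eq_abs]
  refine ((fderiv ℝ w x).le_opNorm _).trans ?_
  rw [norm_smul, norm_div, norm_neg, norm_one, norm_norm, one_div, inv_mul_cancel₀ hx0.ne', mul_one]

section

variable {E : Type*} [NormedAddCommGroup E] [NormedSpace ℝ E] [FiniteDimensional ℝ E] [Nontrivial E]
  [MeasurableSpace E] [BorelSpace E] {μ : Measure E} [μ.IsAddHaarMeasure]
  {Ω : Set E} {ρ : E → ℝ} {G : ℝ → ℝ} {K : ℝ≥0} {R p : ℝ}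

/-- Energy comparison under transplantation of a radial profile. -/
theorem setIntegral_norm_fderiv_le (hρ : LipschitzWith 1 ρ) (hG : LipschitzWith K G) (hp : 0 ≤ p)
    (hle : (μ.restrict Ω).map ρ ≤ (μ.restrict (ball 0 R)).map fun x => R - ‖x‖) :
    ∫ x in Ω, ‖fderiv ℝ (fun y => G (ρ y)) x‖ ^ p ∂μ ≤
      ∫ x in ball 0 R, ‖fderiv ℝ (fun y : E => G (R - ‖y‖)) x‖ ^ p ∂μ := by
  have hτ : Measurable fun x : E => R - ‖x‖ := by fun_prop
  have hlip : LipschitzWith K fun y : E => G (R - ‖y‖) := by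
    have : LipschitzWith 1 fun y : E => R - ‖y‖ := by
      refine LipschitzWith.of_dist_le_mul fun x y => ?_
      rw [NNReal.coe_one, one_mul, Real.dist_eq, sub_sub_sub_cancel_left, dist_comm, dist_eq_norm]
      exact abs_norm_sub_norm_le _ _
    exact mul_one K ▸ hG.comp this
  have hae : ∀ᵐ x ∂μ.restrict (ball (0:E) R), DifferentiableAt ℝ G (R - ‖x‖) ∧
      |deriv G (R - ‖x‖)| ≤ ‖fderiv ℝ (fun y : E => G (R - ‖y‖)) x‖ := by
    refine ae_restrict_of_ae ?_
    filter_upwards [hlip.ae_differentiableAt (μ := μ),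
      compl_mem_ae_iff.2 (measure_singleton (μ := μ) (0:E))] with x h1 h2
    exact differentiableAt_of_radial h2 h1
  have hfin : IsFiniteMeasure (μ.restrict (ball (0:E) R)) :=
    ⟨by rw [Measure.restrict_apply_univ]; exact measure_ball_lt_top⟩
  have hfin' := Measure.isFiniteMeasure_map (μ.restrict (ball (0:E) R)) fun x => R - ‖x‖
  have hdiff : ∀ᵐ t ∂(μ.restrict (ball (0:E) R)).map fun x => R - ‖x‖, DifferentiableAt ℝ G t := by
    rw [ae_map_iff hτ.aemeasurable (measurableSet_of_differentiableAt ℝ G)]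
    filter_upwards [hae] with x hx using hx.1
  have hdiff' : ∀ᵐ x ∂μ.restrict Ω, DifferentiableAt ℝ G (ρ x) :=
    ae_of_ae_map hρ.continuous.measurable.aemeasurable (hdiff.filter_mono (ae_mono hle))
  have hφm : Measurable fun t => |deriv G t| ^ p := by
    exact ((measurable_deriv G).abs).pow_const p
  have hφb : ∀ t, |deriv G t| ^ p ≤ (K:ℝ) ^ p := fun t =>
    Real.rpow_le_rpow (abs_nonneg _) (norm_deriv_le_of_lipschitz hG) hp
  have hφi : Integrable (fun t => |deriv G t| ^ p)
      ((μ.restrict (ball (0:E) R)).map fun x => R - ‖x‖) := by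
    refine Integrable.of_bound hφm.aestronglyMeasurable ((K:ℝ) ^ p) (Filter.Eventually.of_forall ?_)
    intro t
    rw [Real.norm_of_nonneg (by positivity)]
    exact hφb t
  have hφi' := hφi.mono_measure hle
  calc _ ≤ ∫ x in Ω, |deriv G (ρ x)| ^ p ∂μ := by
        refine integral_mono_of_nonneg (Filter.Eventually.of_forall fun x => by positivity)
          (hφi'.comp_measurable hρ.continuous.measurable) ?_
        filter_upwards [hdiff'] with x hx
        exact Real.rpow_le_rpow (norm_nonneg _) (norm_fderiv_comp_le hρ hx) hp
    _ = ∫ t, |deriv G t| ^ p ∂(μ.restrict Ω).map ρ :=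
        (integral_map hρ.continuous.measurable.aemeasurable hφm.aestronglyMeasurable).symm
    _ ≤ ∫ t, |deriv G t| ^ p ∂(μ.restrict (ball (0:E) R)).map fun x => R - ‖x‖ :=
        integral_mono_measure hle (Filter.Eventually.of_forall fun x => by positivity) hφi
    _ = ∫ x in ball 0 R, |deriv G (R - ‖x‖)| ^ p ∂μ :=
        integral_map hτ.aemeasurable hφm.aestronglyMeasurable
    _ ≤ _ := by
        refine integral_mono_of_nonneg (Filter.Eventually.of_forall fun x => by positivity) ?_ ?_
        · refine Integrable.of_bound (((measurable_fderiv ℝ _).norm).pow_const p).aestronglyMeasurable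
            ((K:ℝ) ^ p) (Filter.Eventually.of_forall ?_)
          intro t
          rw [Real.norm_of_nonneg (by positivity)]
          exact Real.rpow_le_rpow (norm_nonneg _) (norm_fderiv_le_of_lipschitz ℝ hlip) hp
        · filter_upwards [hae] with x hx
          exact Real.rpow_le_rpow (abs_nonneg _) hx.2 hp

/-- Mass comparison under transplantation of a radial profile. -/
theorem sub_le_setIntegral_rpow (hρ : Measurable ρ) (hG : Continuous G) {M : ℝ}
    (hG0 : ∀ t, 0 ≤ G t) (hGM : ∀ t, G t ≤ M) (hp : 0 ≤ p)
    (hle : (μ.restrict Ω).map ρ ≤ (μ.restrict (ball 0 R)).map fun x => R - ‖x‖) :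
    ∫ x in ball 0 R, G (R - ‖x‖) ^ p ∂μ - M ^ p * (μ.real (ball 0 R) - μ.real Ω) ≤
      ∫ x in Ω, G (ρ x) ^ p ∂μ := by
  have hτ : Measurable fun x : E => R - ‖x‖ := by fun_prop
  have hfin : IsFiniteMeasure (μ.restrict (ball (0:E) R)) :=
    ⟨by rw [Measure.restrict_apply_univ]; exact measure_ball_lt_top⟩
  have hfin' := Measure.isFiniteMeasure_map (μ.restrict (ball (0:E) R)) fun x => R - ‖x‖
  have hfin1 : IsFiniteMeasure ((μ.restrict Ω).map ρ) := isFiniteMeasure_of_le _ hle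
  have hGp : Continuous fun t => G t ^ p := hG.rpow_const fun _ => Or.inr hp
  have hb : ∀ t, G t ^ p ≤ M ^ p := fun t => Real.rpow_le_rpow (hG0 t) (hGM t) hp
  have hi : Integrable (fun t => G t ^ p) ((μ.restrict (ball (0:E) R)).map fun x => R - ‖x‖) := by
    refine Integrable.of_bound hGp.aestronglyMeasurable (M ^ p) (Filter.Eventually.of_forall ?_)
    intro t
    rw [Real.norm_of_nonneg (Real.rpow_nonneg (hG0 t) p)]
    exact hb t
  have h1 : ∫ t, M ^ p - G t ^ p ∂(μ.restrict Ω).map ρ ≤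
      ∫ t, M ^ p - G t ^ p ∂(μ.restrict (ball (0:E) R)).map fun x => R - ‖x‖ :=
    integral_mono_measure hle (Filter.Eventually.of_forall fun x => sub_nonneg.2 (hb x))
      ((integrable_const _).sub hi)
  rw [integral_sub (integrable_const _) (hi.mono_measure hle), integral_sub (integrable_const _) hi,
    integral_const, integral_const, map_measureReal_apply hρ MeasurableSet.univ,
    map_measureReal_apply hτ MeasurableSet.univ,
    integral_map hρ.aemeasurable hGp.aestronglyMeasurable,
    integral_map hτ.aemeasurable hGp.aestronglyMeasurable] at h1
  simp only [preimage_univ, measureReal_restrict_apply_univ, smul_eq_mul] at h1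
  linarith

end

/-- A radial Lipschitz function on a ball has a globally Lipschitz profile. -/
theorem exists_lipschitz_profile {E : Type*} [NormedAddCommGroup E] [NormedSpace ℝ E]
    [Nontrivial E] {R : ℝ} (hR : 0 < R) {v : E → ℝ} {K : ℝ≥0}
    (hv : LipschitzOnWith K v (closedBall 0 R)) {h : ℝ → ℝ}
    (hh : ∀ x ∈ closedBall (0:E) R, v x = h ‖x‖) :
    ∃ G : ℝ → ℝ, LipschitzWith K G ∧ (∀ t, ∃ x ∈ closedBall (0:E) R, G t = v x) ∧
      ∀ x ∈ closedBall (0:E) R, v x = G (R - ‖x‖) := by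
  obtain ⟨e, he⟩ := exists_norm_eq E zero_le_one
  have hmem : ∀ t : ℝ, (projIcc 0 R hR.le (R - t) : ℝ) • e ∈ closedBall (0:E) R := fun t => by
    have := (projIcc 0 R hR.le (R - t)).2
    rw [mem_closedBall_zero_iff, norm_smul, he, mul_one, Real.norm_of_nonneg this.1]
    exact this.2
  refine ⟨fun t => v ((projIcc 0 R hR.le (R - t) : ℝ) • e), ?_, fun t => ⟨_, hmem t, rfl⟩, ?_⟩
  · refine LipschitzWith.of_dist_le_mul fun s t => (hv.dist_le_mul _ (hmem s) _ (hmem t)).trans ?_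
    gcongr
    rw [dist_eq_norm, ← sub_smul, norm_smul, he, mul_one, ← dist_eq_norm]
    refine (abs_projIcc_sub_projIcc hR.le).trans ?_
    rw [sub_sub_sub_cancel_left, abs_sub_comm, Real.dist_eq]
  · intro x hx
    have hx' := mem_closedBall_zero_iff.1 hx
    have h1 : (projIcc 0 R hR.le (R - (R - ‖x‖)) : ℝ) = ‖x‖ := by
      rw [sub_sub_cancel, projIcc_of_mem hR.le ⟨norm_nonneg x, hx'⟩]
    have h2 := hmem (R - ‖x‖)
    rw [h1] at h2
    simp only [h1]
    rw [hh x hx, hh _ h2, norm_smul, he, norm_norm, mul_one]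

theorem rayleigh_nonneg {n : ℕ} {p β : ℝ} (hβ : 0 ≤ β) (Ω : Set (EuclideanSpace ℝ (Fin n)))
    (u : EuclideanSpace ℝ (Fin n) → ℝ) : 0 ≤ rayleigh n p β Ω u := by
  have h1 : 0 ≤ ∫ x in Ω, ‖fderiv ℝ u x‖ ^ p :=
    integral_nonneg fun x => Real.rpow_nonneg (norm_nonneg _) _
  have h2 : 0 ≤ ∫ x in frontier Ω, |u x| ^ p ∂(μH[(n : ℝ) - 1]) :=
    integral_nonneg fun x => Real.rpow_nonneg (abs_nonneg _) _
  have h3 : 0 ≤ ∫ x in Ω, |u x| ^ p := integral_nonneg fun x => Real.rpow_nonneg (abs_nonneg _) _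
  unfold rayleigh
  positivity

theorem setIntegral_frontier_of_eqOn {n : ℕ} {p a : ℝ} {Ω : Set (EuclideanSpace ℝ (Fin n))}
    {u : EuclideanSpace ℝ (Fin n) → ℝ} (h : ∀ x ∈ frontier Ω, u x = a) :
    ∫ x in frontier Ω, |u x| ^ p ∂(μH[(n : ℝ) - 1]) = perim n Ω * |a| ^ p := by
  rw [setIntegral_congr_fun (g := fun _ => |a| ^ p) isClosed_frontier.measurableSet
    (fun x hx => by simp only [h x hx]), setIntegral_const, smul_eq_mul]
  rfl

theorem robinEig_le_of_perim_eq {d : ℕ} (hd : 1 ≤ d) {p β : ℝ} (hp1 : 1 < p) (hβ : 0 < β)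
    {Ω : Set (EuclideanSpace ℝ (Fin (d + 1)))} (hΩ : IsConvexBody Ω) {R : ℝ} (hR : 0 < R)
    (hper : perim (d + 1) (ball 0 R) = perim (d + 1) Ω) {v : EuclideanSpace ℝ (Fin (d + 1)) → ℝ}
    (hv : IsFirstEigenfunction (d + 1) p β (ball 0 R) v) {C : ℝ}
    (hC : C = (sSup (v '' closure (ball 0 R))) ^ p *
      (volume (ball (0 : EuclideanSpace ℝ (Fin (d + 1))) R)).toReal / ∫ x in ball 0 R, |v x| ^ p)
    (hsmall : C * (1 - (volume Ω).toReal /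
      (volume (ball (0 : EuclideanSpace ℝ (Fin (d + 1))) R)).toReal) < 1) :
    robinEig (d + 1) p β Ω ≤ robinEig (d + 1) p β (ball 0 R) / (1 - C * (1 - (volume Ω).toReal /
      (volume (ball (0 : EuclideanSpace ℝ (Fin (d + 1))) R)).toReal)) := by
  obtain ⟨⟨K, hvK⟩, hv0, ⟨h, hh⟩, hvp, hvr⟩ := hv
  have hp0 : 0 ≤ p := by linarith
  have hcl : closure (ball (0 : EuclideanSpace ℝ (Fin (d + 1))) R) = closedBall 0 R :=
    closure_ball _ hR.ne'
  rw [hcl] at hvK hv0 hh hC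
  obtain ⟨G, hG, hGv, hvG⟩ := exists_lipschitz_profile hR hvK hh
  have hG0 : ∀ t, 0 ≤ G t := fun t => by
    obtain ⟨x, hx, e⟩ := hGv t
    exact e ▸ (hv0 x hx).le
  set M := sSup (v '' closedBall 0 R) with hM
  have hGM : ∀ t, G t ≤ M := fun t => by
    obtain ⟨x, hx, e⟩ := hGv t
    rw [e]
    exact le_csSup ((isCompact_closedBall _ _).image_of_continuousOn hvK.continuousOn).bddAbove
      (mem_image_of_mem v hx)
  have hcast : ((d + 1 : ℕ) : ℝ) - 1 = d := by push_cast; ring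
  -- surface measures
  obtain ⟨c, hc⟩ := exists_isPrismConst d
  have hle := hc.hausdorffMeasure_frontier_ball_le hR
  have hfin : μH[(d:ℝ)] (frontier (ball (0 : EuclideanSpace ℝ (Fin (d + 1))) R)) ≠ ∞ :=
    (hle.trans_lt (ENNReal.mul_lt_top hc.ne_top.lt_top ENNReal.ofReal_lt_top)).ne
  have hS : μH[(d:ℝ)] (frontier Ω) =
      μH[(d:ℝ)] (frontier (ball (0 : EuclideanSpace ℝ (Fin (d + 1))) R)) := by
    have h0 := hper
    unfold perim at h0
    rw [hcast, eq_comm, ENNReal.toReal_eq_toReal_iff] at h0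
    rcases h0 with h0 | h0 | h0
    · exact h0
    · exact absurd h0.2 hfin
    · exact absurd h0.2 (hausdorffMeasure_frontier_ball_pos hR).ne'
  have hmap := hΩ.map_infDist_le hd hc hR (hS.le.trans hle)
  set ρ : EuclideanSpace ℝ (Fin (d + 1)) → ℝ := fun x => infDist x Ωᶜ with hρdef
  have hρ : LipschitzWith 1 ρ := lipschitz_infDist_pt _
  set u : EuclideanSpace ℝ (Fin (d + 1)) → ℝ := fun x => G (ρ x) with hu
  have huL : LipschitzWith K u := mul_one K ▸ hG.comp hρ
  -- energy
  have hE : ∫ x in Ω, ‖fderiv ℝ u x‖ ^ p ≤ ∫ x in ball 0 R, ‖fderiv ℝ v x‖ ^ p := by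
    refine (setIntegral_norm_fderiv_le hρ hG hp0 hmap).trans_eq ?_
    refine setIntegral_congr_fun measurableSet_ball fun x hx => ?_
    have : (fun y : EuclideanSpace ℝ (Fin (d + 1)) => G (R - ‖y‖)) =ᶠ[nhds x] v := by
      filter_upwards [isOpen_ball.mem_nhds hx] with y hy
      exact (hvG y (ball_subset_closedBall hy)).symm
    simp only [this.fderiv_eq]
  -- boundary terms
  have hB : ∫ x in frontier Ω, |u x| ^ p ∂(μH[((d + 1 : ℕ) : ℝ) - 1]) =
      ∫ x in frontier (ball 0 R), |v x| ^ p ∂(μH[((d + 1 : ℕ) : ℝ) - 1]) := by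
    rw [setIntegral_frontier_of_eqOn (a := G 0), setIntegral_frontier_of_eqOn (a := G 0), hper]
    · intro x hx
      rw [frontier_ball _ hR.ne', mem_sphere_zero_iff_norm] at hx
      rw [hvG x (mem_closedBall_zero_iff.2 hx.le), hx, sub_self]
    · intro x hx
      rw [hΩ.isOpen.frontier_eq] at hx
      simp only [hu, hρdef, infDist_zero_of_mem (show x ∈ Ωᶜ from hx.2)]
  -- mass
  have hD : (∫ x in ball 0 R, |v x| ^ p) - M ^ p * ((volume (ball
      (0 : EuclideanSpace ℝ (Fin (d + 1))) R)).toReal - (volume Ω).toReal) ≤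
      ∫ x in Ω, |u x| ^ p := by
    have h1 := sub_le_setIntegral_rpow hρ.continuous.measurable hG.continuous hG0 hGM hp0 hmap
    have h2 : ∫ x in ball (0 : EuclideanSpace ℝ (Fin (d + 1))) R, G (R - ‖x‖) ^ p =
        ∫ x in ball 0 R, |v x| ^ p := by
      refine setIntegral_congr_fun measurableSet_ball fun x hx => ?_
      simp only [hvG x (ball_subset_closedBall hx), abs_of_nonneg (hG0 _)]
    have h3 : ∀ x, |u x| ^ p = G (ρ x) ^ p := fun x => by simp only [hu, abs_of_nonneg (hG0 _)]
    simp only [h3, ← h2]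
    exact h1
  set m := ∫ x in ball 0 R, |v x| ^ p with hm
  set B := (volume (ball (0 : EuclideanSpace ℝ (Fin (d + 1))) R)).toReal with hBdef
  have hB0 : 0 < B := ENNReal.toReal_pos (measure_ball_pos _ _ hR).ne' measure_ball_lt_top.ne
  set q := 1 - C * (1 - (volume Ω).toReal / B) with hq
  have hq0 : 0 < q := by linarith
  have hmq : m - M ^ p * (B - (volume Ω).toReal) = m * q := by
    rw [hq, hC]
    field_simp
  rw [hmq] at hD
  have hD0 : 0 < m * q := mul_pos hvp hq0
  have hDu := hD0.trans_le hD
  have h1 : robinEig (d + 1) p β Ω ≤ rayleigh (d + 1) p β Ω u :=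
    csInf_le ⟨0, by rintro _ ⟨w, -, -, rfl⟩; exact rayleigh_nonneg hβ.le Ω w⟩
      ⟨u, ⟨K, huL.lipschitzOnWith⟩, hDu, rfl⟩
  refine h1.trans ?_
  rw [← hvr]
  unfold rayleigh
  rw [hB, ← hm, div_div]
  have h2 : 0 ≤ ∫ x in frontier (ball 0 R), |v x| ^ p ∂(μH[((d + 1 : ℕ) : ℝ) - 1]) :=
    integral_nonneg fun x => Real.rpow_nonneg (abs_nonneg _) _
  have h3 : 0 ≤ ∫ x in ball 0 R, ‖fderiv ℝ v x‖ ^ p :=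
    integral_nonneg fun x => Real.rpow_nonneg (norm_nonneg _) _
  gcongr

/-- Key comparison in the proof of Theorem 1 (β > 0). -/
theorem stmt1 {n : ℕ} (hn : 2 ≤ n) (p β : ℝ) (hp1 : 1 < p) (hβ : 0 < β)
    (Ω : Set (EuclideanSpace ℝ (Fin n))) (hΩo : IsOpen Ω) (hΩb : IsBounded Ω)
    (hΩc : Convex ℝ Ω) (hΩne : Ω.Nonempty)
    (R : ℝ) (hR : 0 < R)
    (Ωstar : Set (EuclideanSpace ℝ (Fin n)))
    (hstar : Ωstar = ball (0 : EuclideanSpace ℝ (Fin n)) R)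
    (hper : perim n Ωstar = perim n Ω)
    (v : EuclideanSpace ℝ (Fin n) → ℝ) (hv : IsFirstEigenfunction n p β Ωstar v)
    (C : ℝ)
    (hC : C = (sSup (v '' closure Ωstar)) ^ p * (volume Ωstar).toReal /
      ∫ x in Ωstar, |v x| ^ p)
    (hsmall : C * (1 - (volume Ω).toReal / (volume Ωstar).toReal) < 1) :
    robinEig n p β Ω ≤
      robinEig n p β Ωstar / (1 - C * (1 - (volume Ω).toReal / (volume Ωstar).toReal)) := by
  subst hstar
  obtain ⟨d, rfl⟩ := Nat.exists_eq_add_of_le' (show 1 ≤ n by omega)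
  exact robinEig_le_of_perim_eq (by omega) hp1 hβ ⟨hΩo, hΩc, hΩb, hΩne⟩ hR hper hv hC hsmall
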